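/- Let m ∈ {6, 7, 8}. Consider the 3×m matrix M(x,y) with columns c_1 = (0,0,1), c_2 = (0,−1,0), c_3 = (1,0,0), c_4 = (1,1,1), and c_j = (1, x_{j−4}, y_{j−4}) for 5 ≤ j ≤ m, in the 2(m−4) unknowns x_1,…,x_{m−4}, y_1,…,y_{m−4}. For a triple I = (i_1 < i_2 < i_3) of column indices let p_I(x,y) = det(c_{i_1}, c_{i_2}, c_{i_3}), and let T_m be the set of triples not contained in {(1,2,j) : 3 ≤ j ≤ m} ∪ {(1,3,4), (2,3,4)}. Then there exists a nonzero polynomial g in the variables (s_I)_{I∈T_m} such that for every s ∈ ℂ^{T_m} with g(s) ≠ 0, the number of points (x,y) ∈ ℂ^{2(m−4)} satisfying p_I(x,y) ≠ 0 for all I ∈ T_m together with the 2(m−4) rational critical equations Σ_{I∈T_m} s_I·(∂p_I/∂x_k)/p_I = 0 and Σ_{I∈T_m} s_I·(∂p_I/∂y_k)/p_I = 0 for k = 1,…,m−4, equals 26 when m = 6, equals 1272 when m = 7, and equals 188112 when m = 8. -/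

import Mathlib

open scoped BigOperators

noncomputable section

/-- The columns of the normalized `3 × m` matrix `M(x,y)`:
`c_1 = (0,0,1)`, `c_2 = (0,-1,0)`, `c_3 = (1,0,0)`, `c_4 = (1,1,1)`, and
`c_j = (1, x_{j-4}, y_{j-4})` for `5 ≤ j ≤ m`; the point `(x,y) ∈ ℂ^{2(m-4)}`
is encoded as a pair `z`. -/
def cegmCol (m : ℕ) (z : (Fin (m - 4) → ℂ) × (Fin (m - 4) → ℂ)) (j : ℕ) : Fin 3 → ℂ :=
  if j = 1 then ![0, 0, 1]
  else if j = 2 then ![0, -1, 0]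
  else if j = 3 then ![1, 0, 0]
  else if j = 4 then ![1, 1, 1]
  else ![1, if h : j - 5 < m - 4 then z.1 ⟨j - 5, h⟩ else 0,
           if h : j - 5 < m - 4 then z.2 ⟨j - 5, h⟩ else 0]

/-- The `3 × 3` minor `p_I(x,y) = det(c_{i₁}, c_{i₂}, c_{i₃})`. -/
def cegmP (m : ℕ) (I : ℕ × ℕ × ℕ) (z : (Fin (m - 4) → ℂ) × (Fin (m - 4) → ℂ)) : ℂ :=
  Matrix.det (Matrix.of fun r c => cegmCol m z (![I.1, I.2.1, I.2.2] c) r)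

/-- The set `T_m` of triples `1 ≤ i₁ < i₂ < i₃ ≤ m` not contained in
`{(1,2,j) : 3 ≤ j ≤ m} ∪ {(1,3,4), (2,3,4)}`. -/
def cegmT (m : ℕ) : Finset (ℕ × ℕ × ℕ) :=
  ((Finset.Icc 1 m) ×ˢ (Finset.Icc 1 m) ×ˢ (Finset.Icc 1 m)).filter fun t =>
    t.1 < t.2.1 ∧ t.2.1 < t.2.2 ∧
      ¬((t.1 = 1 ∧ t.2.1 = 2) ∨ t = (1, 3, 4) ∨ t = (2, 3, 4))

/-- The solutions of the `2(m-4)` rational critical equations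
`∑_{I ∈ T_m} s_I (∂p_I/∂x_k)/p_I = 0` and `∑_{I ∈ T_m} s_I (∂p_I/∂y_k)/p_I = 0`
on the locus where all `p_I ≠ 0`. -/
def cegmSol (m : ℕ) (s : {I : ℕ × ℕ × ℕ // I ∈ cegmT m} → ℂ) :
    Set ((Fin (m - 4) → ℂ) × (Fin (m - 4) → ℂ)) :=
  {z | (∀ I ∈ cegmT m, cegmP m I z ≠ 0) ∧
    (∀ k : Fin (m - 4),
      ∑ I ∈ (cegmT m).attach,
        s I * fderiv ℂ (cegmP m I.val) z (Pi.single k 1, 0) / cegmP m I.val z = 0) ∧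
    (∀ k : Fin (m - 4),
      ∑ I ∈ (cegmT m).attach,
        s I * fderiv ℂ (cegmP m I.val) z (0, Pi.single k 1) / cegmP m I.val z = 0)}

set_option linter.unusedSectionVars false
namespace ML
open List renaming mem_append_left → mL, mem_map → mM, mem_cons → mC, mem_append_right → mR, mem_append → mA, not_mem_nil → nmn, mem_map_of_mem → mMM, mem_cons_of_mem → mCC, mem_filter → mF, map_cons → mpC, cons_append → cA, nil_append → nA, mem_range → mRg, forall_mem_cons → fmC, get_mem → gM, map_nil → mpN, mem_singleton → mS, mem_product → mPr, mem_cons_self → mCS, map_append → mpA, get_of_mem → gOM, forall_mem_append → fmA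
open PowerSeries renaming X → pX, C → pC, X_ne_zero → pXz, X_dvd_iff → pXd, mk → pMk, coeff → pco
open Finset renaming sum_congr → sCg, mul_sum → mSm, mem_univ → mU, sum_add_distrib → sAd
open Matrix renaming cons_val_zero → cv0, cons_val_one → cv1, cons_val → cv
open TrivSqZeroExt renaming inl → tl0, inr → tr0
open Function renaming Injective → Inj, Surjective → Sur, extend → fex
open MvPolynomial Set
local notation "Zp" x:max => MvPolynomial x ℤ
local notation "om" => (by omega)
local notation "sm" => (by simp)
local notation "nn" => (by norm_num)
local notation "S2" => [(0, -1), (1, 0)]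
variable {σ ι τ σ' ι' : Type}
def ev {R : Type} [CommRing R] (z : σ → R) : Zp σ →+* R :=
  eval₂Hom (Int.castRingHom R) z
section ev
variable {R S : Type} [CommRing R] [CommRing S]
@[simp] lemma ev_X (z : σ → R) (k : σ) : ev z (X k) = z k := by simp [ev]
@[simp] lemma ev_C (z : σ → R) (n : ℤ) : ev z (C n) = (n : R) := by simp [ev]
lemma mev (φ : R →+* S) (z : σ → R) (p : Zp σ) :
    φ (ev z p) = ev (fun k => φ (z k)) p := by
  have : φ.comp (ev z) = ev (fun k => φ (z k)) := by
    ext k <;> simp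
  exact DFunLike.congr_fun this p
lemma ev_rename (z : σ → R) (g : τ → σ) (p : Zp τ) :
    ev z (rename g p) = ev (fun k => z (g k)) p := by
  simp [ev, eval₂Hom_rename, Function.comp_def]
lemma ev_bind (z : σ → R) (g : τ → Zp σ) (p : Zp τ) :
    ev z (ev g p) = ev (fun k => ev z (g k)) p := mev _ _ _
lemma ev_id (p : Zp σ) : ev (fun k => X k) p = p := by
  have : ev (fun k => (X k : Zp σ)) = RingHom.id _ := by
    ext k <;> simp
  rw [this]; rfl
end ev
def Gen {K : Type} [CommRing K] (s : ι → K) : Prop := Inj (ev s)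
lemma gen_iff {K : Type} [Field K] (s : ι → K) : Gen s ↔ AlgebraicIndependent ℤ s := by
  unfold Gen AlgebraicIndependent ev
  have : (eval₂Hom (Int.castRingHom K) s : Zp ι → K) = aeval s := by
    ext p; simp [aeval_def]
  rw [this]
lemma Gen.ne_zero {K : Type} [CommRing K] {s : ι → K} (hs : Gen s) {p : Zp ι}
    (hp : p ≠ 0) : ev s p ≠ 0 := fun h => hp (hs (by simpa using h))
lemma Gen.map {K L : Type} [Field K] [Field L] {s : ι → K} (hs : Gen s) (φ : K →+* L) :
    Gen (fun i => φ (s i)) := by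
  intro p q h
  rw [← mev, ← mev] at h
  exact hs (φ.injective h)
lemma Gen.subst {K : Type} [CommRing K] {s : ι → K} (hs : Gen s) (g : τ → Zp ι)
    (g' : ι → Zp τ) (hg : ∀ t, ev g' (g t) = X t) : Gen (fun t => ev s (g t)) := by
  intro p q h
  rw [← ev_bind, ← ev_bind] at h
  have foo := hs h
  have bar := congrArg (ev g') foo
  rw [ev_bind, ev_bind] at bar
  simpa [hg, ev_id] using bar
lemma Gen.comp {K : Type} [CommRing K] {s : ι → K} (hs : Gen s) (g : τ → ι)
    (hg : Inj g) : Gen (fun t => s (g t)) := by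
  intro p q h
  rw [← ev_rename s g p, ← ev_rename s g q] at h
  exact rename_injective g hg (hs h)
lemma exists_gen_complex (ι : Type) [Finite ι] : ∃ s : ι → ℂ, Gen s := by
  obtain ⟨β, b, hb⟩ := exists_isTranscendenceBasis' ℤ ℂ
  have foo : Cardinal.mk ℂ = Cardinal.mk β :=
by
    have := IsAlgClosed.cardinal_eq_cardinal_transcendence_basis_of_aleph0_lt b hb sm
      (by simp [Cardinal.aleph0_lt_continuum])
    simpa using this
  have bar : Infinite β := by
    rw [← Cardinal.aleph0_le_mk_iff, ← foo]; simp [Cardinal.aleph0_le_continuum]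
  obtain ⟨n, ⟨e⟩⟩ := Finite.exists_equiv_fin ι
  have hb' : Gen b := (gen_iff b).2 hb.1
  refine ⟨_, hb'.comp (fun i => Infinite.natEmbedding β (e i)) ?_⟩
  intro i j h
  have h' : ((e i : Fin n) : ℕ) = e j := by simpa using h
  exact e.injective (Fin.ext h')
section acl
variable {K : Type} [Field K]
def acl (w : Set K) : Subfield K where
  toSubring := (Subalgebra.algebraicClosure (Algebra.adjoin ℤ w) K).toSubring
  inv_mem' := by
    intro x hx
    exact IsAlgebraic.inv hx
lemma mem_acl {w : Set K} {x : K} : x ∈ acl w ↔ IsAlgebraic (Algebra.adjoin ℤ w) x := Iff.rfl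
lemma subset_acl {w : Set K} {x : K} (hx : x ∈ w) : x ∈ acl w :=
  isAlgebraic_algebraMap (⟨x, Algebra.subset_adjoin hx⟩ : Algebra.adjoin ℤ w)
lemma ev_mem (A : Subfield K) {z : σ → K} (hz : ∀ k, z k ∈ A) (p : Zp σ) :
    ev z p ∈ A := by
  have := mev A.subtype (fun k => (⟨z k, hz k⟩ : A)) p
  simp only [Subfield.subtype_apply] at this
  rw [← this]; exact SetLike.coe_mem _
variable [CharZero K]
lemma acl_eq (w : Set K) : (acl w : Set K) = (AlgebraicIndependent.matroid ℤ K).closure w := by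
  rw [AlgebraicIndependent.matroid_closure_eq]; rfl
lemma exchange [Finite ι] {s w : ι → K} (hs : Gen s) (h : ∀ i, s i ∈ acl (range w)) :
    Gen w ∧ ∀ i, w i ∈ acl (range s) := by
  set M := AlgebraicIndependent.matroid ℤ K
  have hs' := (gen_iff s).1 hs
  have hI : M.Indep (range s) := hs'.to_subtype_range
  have hsub : range s ⊆ M.closure (range w) := by
    rintro _ ⟨i, rfl⟩
    rw [← acl_eq]; exact h i
  have hcard : (range s).encard = ENat.card ι := by
    rw [← image_univ, hs'.injective.encard_image, encard_univ]
  have hle : (range w).encard ≤ ENat.card ι := by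
    rw [← image_univ, ← encard_univ ι]; exact encard_image_le _ _
  have foo : M.eRk (range s) = ENat.card ι := by rw [hI.eRk_eq_encard, hcard]
  have bar : M.eRk (range s) ≤ M.eRk (range w) := by
    rw [← M.eRk_closure_eq (range w)]; exact M.eRk_mono hsub
  have baz : M.eRk (range w) ≤ (range w).encard := M.eRk_le_encard _
  have hfin : (range w).Finite := finite_range w
  have hwI : M.Indep (range w) := by
    rw [Matroid.indep_iff_eRk_eq_encard_of_finite hfin]
    exact le_antisymm baz (hle.trans (foo.symm.le.trans bar))
  have hinj : Inj w := by
    have : (range w).encard = ENat.card ι := le_antisymm hle (foo.symm.le.trans (bar.trans baz))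
    rw [← image_univ, ← encard_univ ι] at this
    have := (finite_univ (α := ι)).injOn_of_encard_image_eq this
    exact injOn_univ.1 this
  refine ⟨(gen_iff w).2 (hwI.of_subtype_range hinj) , fun i => ?_⟩
  have box : M.closure (range s) = M.closure (M.closure (range w)) := by
    refine Matroid.IsRkFinite.closure_eq_closure_of_subset_of_eRk_ge_eRk
      (M.isRkFinite_of_finite (finite_range s)) hsub ?_
    rw [M.eRk_closure_eq, foo]
    exact baz.trans hle
  rw [← SetLike.mem_coe, acl_eq, box, Matroid.closure_closure]
  exact M.mem_closure_of_mem' (mem_range_self i) (mem_univ _)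
end acl
structure Sol {R : Type} [CommRing R] [Fintype ι] (f : ι → Zp σ)
    (h : Zp σ) (s : ι → R) (e : R) (z : σ → R) (u : ι → R) (μ : R) : Prop where
  unit : ∀ i, u i * ev z (f i) = 1
  eqn : ∀ k, ∑ i, s i * (u i * ev z (pderiv k (f i))) = μ * ev z (pderiv k h)
  last : μ * ev z h = e
lemma Sol.map {R S : Type} [CommRing R] [CommRing S] [Fintype ι] {f : ι → Zp σ}
    {h : Zp σ} {s : ι → R} {e : R} {z : σ → R} {u : ι → R} {μ : R}
    (H : Sol f h s e z u μ) (φ : R →+* S) :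
    Sol f h (fun i => φ (s i)) (φ e) (fun k => φ (z k)) (fun i => φ (u i)) (φ μ) where
  unit i := by rw [← mev, ← map_mul, H.unit, map_one]
  eqn k := by
    simp only [← mev, ← map_mul, ← map_sum, H.eqn]
  last := by rw [← mev, ← map_mul, H.last]
lemma Sol.of_map {R S : Type} [CommRing R] [CommRing S] [Fintype ι] {f : ι → Zp σ}
    {h : Zp σ} {s : ι → R} {e : R} {z : σ → R} {u : ι → R} {μ : R}
    (φ : R →+* S) (hφ : Inj φ)
    (H : Sol f h (fun i => φ (s i)) (φ e) (fun k => φ (z k)) (fun i => φ (u i)) (φ μ)) :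
    Sol f h s e z u μ where
  unit i := by
    apply hφ; rw [map_mul, mev, H.unit, map_one]
  eqn k := by
    apply hφ
    simp only [map_sum, map_mul, mev, H.eqn]
  last := by apply hφ; rw [map_mul, mev, H.last]
def Crit (K : Type) [Field K] [Fintype ι] (f : ι → Zp σ) (s : ι → K) :
    Set (σ → K) :=
  {z | (∀ i, ev z (f i) ≠ 0) ∧ ∀ k, ∑ i, s i * ((ev z (f i))⁻¹ * ev z (pderiv k (f i))) = 0}
structure Good (f : ι → Zp σ) (ξ : σ → ι) : Prop where
  inj : Inj ξ
  eq : ∀ k, f (ξ k) = X k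
section gen
variable {K : Type} [Field K] [Fintype ι] {f : ι → Zp σ}
    {h : Zp σ} {s : ι → K} {e : K} {z : σ → K} {u : ι → K} {μ : K} {ξ : σ → ι}
lemma crit_iff_sol : z ∈ Crit K f s ↔ Sol f h s 0 z (fun i => (ev z (f i))⁻¹) 0 := by
  constructor
  · intro H
    exact ⟨fun i => inv_mul_cancel₀ (H.1 i), fun k => by rw [H.2]; simp, by simp⟩
  · intro H
    refine ⟨fun i hi => ?_, fun k => by rw [H.eqn]; simp⟩
    have := H.unit i
    simp [hi] at this
lemma Sol.u_eq (H : Sol f h s e z u μ) : u = fun i => (ev z (f i))⁻¹ := by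
  funext i
  exact eq_inv_of_mul_eq_one_left (H.unit i)
lemma pderiv_coord [DecidableEq σ] (hG : Good f ξ) (k : σ) (i : ι) (hi : i ∈ range ξ) (hk : i ≠ ξ k) :
    pderiv k (f i) = 0 := by
  obtain ⟨j, rfl⟩ := hi
  rw [hG.eq, pderiv_X, Pi.single_apply, if_neg]
  rintro rfl; exact hk rfl
lemma s_mem (hG : Good f ξ) (A : Subfield K) (H : Sol f h s e z u μ) (hz : ∀ k, z k ∈ A)
    (hs : ∀ i, i ∉ range ξ → s i ∈ A) (hμ : μ ∈ A) (i : ι) : s i ∈ A := by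
  classical
  by_cases hi : i ∈ range ξ
  swap
  · exact hs i hi
  obtain ⟨k, rfl⟩ := hi
  have hu : ∀ i, u i ∈ A := by
    intro i; rw [H.u_eq]; exact A.inv_mem (ev_mem A hz _)
  have foo := H.eqn k
  rw [← Finset.add_sum_erase _ _ (mU (ξ k))] at foo
  have bar : ∑ i ∈ Finset.univ.erase (ξ k), s i * (u i * ev z (pderiv k (f i))) ∈ A := by
    refine sum_mem fun i hi => ?_
    by_cases hi' : i ∈ range ξ
    · rw [pderiv_coord hG k i hi' (Finset.ne_of_mem_erase hi)]; simp [A.zero_mem]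
    · exact A.mul_mem (hs i hi') (A.mul_mem (hu i) (ev_mem A hz _))
  have baz : s (ξ k) * (u (ξ k) * ev z (pderiv k (f (ξ k)))) ∈ A := by
    rw [eq_sub_of_add_eq foo]
    exact A.sub_mem (A.mul_mem hμ (ev_mem A hz _)) bar
  have box := H.unit (ξ k)
  rw [hG.eq] at baz box
  simp only [pderiv_X_self, map_one, mul_one, ev_X] at baz box
  have : s (ξ k) = (s (ξ k) * u (ξ k)) * z k := by rw [mul_assoc, box, mul_one]
  rw [this]; exact A.mul_mem baz (hz k)
variable [CharZero K]
lemma extend_mem (hG : Good f ξ) (k : σ) : z k = fex ξ z s (ξ k) :=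
  (hG.inj.extend_apply _ _ _).symm
lemma gen_zero (hG : Good f ξ) (hs : Gen s) (H : Sol f h s e z u 0) :
    Gen (fex ξ z s) ∧ ∀ i, fex ξ z s i ∈ acl (range s) := by
  refine exchange hs (s_mem hG _ H (fun k => ?_) (fun i hi => ?_) (Subfield.zero_mem _))
  · rw [extend_mem hG (s := s) (z := z) k]; exact subset_acl (mem_range_self _)
  · have : s i = fex ξ z s i := (Function.extend_apply' _ _ _ (by simpa using hi)).symm
    rw [this]; exact subset_acl (mem_range_self _)
lemma gen_zero_z (hG : Good f ξ) (hs : Gen s) (H : Sol f h s e z u 0) :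
    Gen z ∧ ∀ k, z k ∈ acl (range s) := by
  obtain ⟨foo, bar⟩ := gen_zero hG hs H
  refine ⟨?_, fun k => ?_⟩
  · have := foo.comp ξ hG.inj
    simpa [hG.inj.extend_apply] using this
  · rw [extend_mem hG (s := s) (z := z) k]; exact bar _
lemma alg_of_pderiv [DecidableEq σ] (p : Zp σ) (k : σ) (hp : ev z p = 0)
    (hd : ev z (pderiv k p) ≠ 0) (w : Set K) (hw : ∀ j, j ≠ k → z j ∈ w) : z k ∈ acl w := by
  set A := Algebra.adjoin ℤ w
  set g : σ → Polynomial A := fun j => if hj : j = k then Polynomial.X else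
    Polynomial.C ⟨z j, Algebra.subset_adjoin (hw j hj)⟩
  have hder : ∀ q : Zp σ, Polynomial.derivative (ev g q) = ev g (pderiv k q) := by
    intro q
    induction q using MvPolynomial.induction_on with
    | C a => simp
    | add p q hp hq => simp [hp, hq]
    | mul_X p j hp =>
      simp only [map_mul, ev_X, Polynomial.derivative_mul, hp, Derivation.leibniz, map_add,
        smul_eq_mul, pderiv_X]
      by_cases hj : j = k
      · subst hj; simp [g]; ring
      · simp [g, hj]; ring
  have hev : ∀ q : Zp σ, Polynomial.aeval (z k) (ev g q) = ev z q := by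
    intro q
    have := mev (Polynomial.aeval (R := A) (z k)).toRingHom g q
    simp only [AlgHom.toRingHom_eq_coe, RingHom.coe_coe] at this
    rw [this]
    congr 2
    funext j
    by_cases hj : j = k
    · subst hj; simp [g]
    · simp [g, hj]
  refine ⟨ev g p, fun h0 => hd ?_, by rw [hev, hp]⟩
  rw [← hev, ← hder, h0]; simp
lemma gen_H [DecidableEq ι] [DecidableEq σ] (hG : Good f ξ) (hs : Gen s) (H : Sol f h s e z u μ)
    (hz : ev z h = 0) (k : σ)
    (hk : ev z (pderiv k h) ≠ 0) :
    Gen (Function.update (fex ξ z s) (ξ k) μ) ∧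
      (∀ i, Function.update (fex ξ z s) (ξ k) μ i ∈ acl (range s)) ∧
      ∀ j, z j ∈ acl (range s) := by
  set w := Function.update (fex ξ z s) (ξ k) μ with hw
  have hw1 : ∀ j, j ≠ k → z j = w (ξ j) := by
    intro j hj
    rw [hw, Function.update_of_ne (fun h' => hj (hG.inj h')), extend_mem hG (s := s) (z := z) j]
  have hzk : ∀ j, z j ∈ acl (range w) := by
    intro j
    by_cases hj : j = k
    · subst hj
      exact alg_of_pderiv h j hz hk _ (fun i hi => by rw [hw1 i hi]; exact mem_range_self _)
    · rw [hw1 j hj]; exact subset_acl (mem_range_self _)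
  have hμ : μ = w (ξ k) := by rw [hw, Function.update_self]
  have := exchange hs (s_mem hG (acl (range w)) H hzk (fun i hi => ?_)
    (by rw [hμ]; exact subset_acl (mem_range_self _)))
  · refine ⟨this.1, this.2, fun j => ?_⟩
    by_cases hj : j = k
    · have bar := alg_of_pderiv (K := K) h k hz hk (acl (range s) : Set K) (fun i hi => by
        rw [hw1 i hi]; exact this.2 _)
      rw [hj]
      rw [← SetLike.mem_coe, acl_eq] at bar ⊢
      rwa [acl_eq, Matroid.closure_closure] at bar
    · rw [hw1 j hj]; exact this.2 _
  · have foo : s i = w i := by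
      rw [hw, Function.update_of_ne, Function.extend_apply' _ _ _ (by simpa using hi)]
      rintro rfl; exact hi (mem_range_self _)
    rw [foo]; exact subset_acl (mem_range_self _)
end gen
section inv
abbrev Qo (ι : Type) : Type := FractionRing (Zp ι)
abbrev A0 (ι : Type) : Type := AlgebraicClosure (Qo ι)
def gen0 (ι : Type) (i : ι) : A0 ι := algebraMap (Qo ι) (A0 ι) (algebraMap (Zp ι) (Qo ι) (X i))
instance : CharZero (Qo ι) := charZero_of_injective_algebraMap (R := Zp ι)
  (IsFractionRing.injective _ _)
instance : CharZero (A0 ι) := charZero_of_injective_algebraMap (R := Qo ι)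
  (algebraMap (Qo ι) (A0 ι)).injective
lemma ev_gen0 (p : Zp ι) : ev (gen0 ι) p = algebraMap (Qo ι) (A0 ι) (algebraMap _ _ p) := by
  conv_rhs => rw [← ev_id p]
  rw [mev (algebraMap (Zp ι) (Qo ι)), mev]
  rfl
lemma gen_gen0 : Gen (gen0 ι) := by
  intro p q h
  rw [ev_gen0, ev_gen0] at h
  exact IsFractionRing.injective _ _ ((algebraMap (Qo ι) (A0 ι)).injective h)
def NNf [Fintype ι] (f : ι → Zp σ) : ℕ∞ := (Crit (A0 ι) f (gen0 ι)).encard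
lemma crit_map {K L : Type} [Field K] [Field L] [Fintype ι] {f : ι → Zp σ}
    {s : ι → K} (φ : K →+* L) (z : σ → K) :
    (fun k => φ (z k)) ∈ Crit L f (fun i => φ (s i)) ↔ z ∈ Crit K f s := by
  simp only [Crit, mem_ofPred_eq, ← mev, ← map_inv₀, ← map_mul, ← map_sum, ne_eq,
    map_eq_zero]
lemma exists_emb {K : Type} [Field K] [IsAlgClosed K] {s : ι → K} (hs : Gen s) :
    ∃ φ : A0 ι →+* K, (∀ i, φ (gen0 ι i) = s i) ∧ ∀ x ∈ acl (range s), ∃ y, φ y = x := by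
  let j : Qo ι →+* K := IsFractionRing.lift (A := Zp ι) (g := ev s) hs
  have hj : ∀ p, j (algebraMap _ _ p) = ev s p := fun p => IsFractionRing.lift_algebraMap _ _
  let _ : Algebra (Qo ι) K := j.toAlgebra
  let φ : A0 ι →ₐ[Qo ι] K := IsAlgClosed.lift
  have hφ : ∀ i, φ (gen0 ι i) = s i := fun i => by
    have : φ (gen0 ι i) = j (algebraMap (Zp ι) (Qo ι) (X i)) := φ.commutes _
    rw [this, hj, ev_X]
  refine ⟨φ, hφ, fun x hx => ?_⟩
  have hs' := (gen_iff s).1 hs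
  let _ : Algebra (A0 ι) K := φ.toRingHom.toAlgebra
  have hx' : IsAlgebraic (A0 ι) x := by
    refine IsAlgebraic.ringHom_of_comp_eq (((ev (gen0 ι)).comp
      (hs'.repr : Algebra.adjoin ℤ (range s) →+* Zp ι))) (RingHom.id K) hx ?_ ?_
    · rw [RingHom.coe_comp]
      exact Inj.comp (g := ev (gen0 ι)) gen_gen0 hs'.aevalEquiv.symm.injective
    · ext a
      change φ.toRingHom (ev (gen0 ι) (hs'.repr a)) = (a : K)
      rw [mev]
      have : (fun k => φ.toRingHom (gen0 ι k)) = s := funext hφ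
      rw [this]
      conv_rhs => rw [← hs'.aeval_repr a]
      simp [ev, aeval_def]
  have := minpoly.mem_range_of_degree_eq_one (A0 ι) x
    (IsAlgClosed.degree_eq_one_of_irreducible _ (minpoly.irreducible hx'.isIntegral))
  exact this
lemma NNf_eq {K : Type} [Field K] [CharZero K] [IsAlgClosed K] [Fintype ι]
    {f : ι → Zp σ} {ξ : σ → ι} (hG : Good f ξ) {s : ι → K} (hs : Gen s) :
    (Crit K f s).encard = NNf f := by
  obtain ⟨φ, foo, bar⟩ := exists_emb hs
  have : Crit K f s = (fun z : σ → A0 ι => fun k => φ (z k)) '' Crit (A0 ι) f (gen0 ι) := by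
    have hsφ : s = fun i => φ (gen0 ι i) := by funext i; rw [foo]
    ext z
    constructor
    · intro hz
      have baz := (gen_zero_z hG hs ((crit_iff_sol (h := 0)).1 hz)).2
      choose y hy using fun k => bar _ (baz k)
      have hzy : z = fun k => φ (y k) := by funext k; rw [hy]
      refine ⟨y, ?_, hzy.symm⟩
      rw [← crit_map φ, ← hsφ, ← hzy]; exact hz
    · rintro ⟨y, hy, rfl⟩
      rw [hsφ, crit_map φ]; exact hy
  rw [this, Inj.encard_image, NNf]
  intro z z' h
  funext k
  exact φ.injective (congrFun h k)
end inv
section deriv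
variable {K : Type} [Field K] [CharZero K]
def fstR (K : Type) [Field K] : DualNumber K →+* K where
  toFun a := a.fst
  map_one' := rfl
  map_mul' _ _ := rfl
  map_zero' := rfl
  map_add' _ _ := rfl
@[simp] lemma fstR_apply (a : DualNumber K) : fstR K a = a.fst := rfl
lemma ker_nilp : IsNilpotent (RingHom.ker (fstR K)) := by
  refine ⟨2, ?_⟩
  have : RingHom.ker (fstR K) * RingHom.ker (fstR K) = 0 := ?_
  · rw [← this]; exact pow_two (RingHom.ker (fstR K))
  rw [ Ideal.zero_eq_bot, eq_bot_iff, Ideal.mul_le]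
  intro a ha b hb
  rw [RingHom.mem_ker] at ha hb
  have ha : TrivSqZeroExt.fst a = 0 := ha
  have hb : TrivSqZeroExt.fst b = 0 := hb
  rw [Ideal.mem_bot]
  ext <;> simp [ha, hb]
lemma exists_lift [Finite ι] {w : ι → K} (hw : Gen w) (v : ι → K) :
    ∃ δ : K →+* DualNumber K, (∀ a, (δ a).fst = a) ∧ ∀ i, (δ (w i)).snd = v i := by
  have hw' := (gen_iff w).1 hw
  obtain ⟨t, ht, hB⟩ := exists_isTranscendenceBasis_superset (R := ℤ) (s := range w)
    hw'.to_subtype_range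
  have htg : Gen ((↑) : t → K) := (gen_iff _).2 hB.1
  classical
  let e : ι → t := fun i => ⟨w i, ht (mem_range_self i)⟩
  have he : Inj e := fun i j h => hw'.injective (congrArg Subtype.val h)
  let v' : t → K := fex e v 0
  let θ : Zp t →+* DualNumber K :=
    ev (fun b => tl0 (b : K) + tr0 (v' b))
  have hθ : ∀ p, (θ p).fst = ev ((↑) : t → K) p := by
    intro p
    have := mev (fstR K)
      (fun b : t => tl0 (b : K) + tr0 (v' b)) p
    rw [fstR_apply] at this
    rw [this]; simp
  let j : Qo t →+* K := IsFractionRing.lift (A := Zp t) (g := ev ((↑) : t → K)) htg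
  have hj : ∀ p, j (algebraMap _ _ p) = ev ((↑) : t → K) p :=
    fun p => IsFractionRing.lift_algebraMap _ _
  have hu : ∀ y : nonZeroDivisors (Zp t), IsUnit (θ y) := by
    intro y
    rw [TrivSqZeroExt.isUnit_iff_isUnit_fst, hθ]
    exact (htg.ne_zero (nonZeroDivisors.ne_zero y.2)).isUnit
  let J : Qo t →+* DualNumber K := IsLocalization.lift (M := nonZeroDivisors (Zp t)) hu
  have hJ : ∀ p, J (algebraMap _ _ p) = θ p := fun p => IsLocalization.lift_eq _ _
  have hJj : ∀ q, (J q).fst = j q := by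
    intro q
    have : (fstR K).comp J = j := by
      apply IsLocalization.ringHom_ext (nonZeroDivisors (Zp t))
      refine RingHom.ext fun p => ?_
      rw [RingHom.comp_apply, RingHom.comp_apply, RingHom.comp_apply, hJ, fstR_apply, hθ, hj]
    exact DFunLike.congr_fun this q
  let _ : Algebra (Qo t) K := j.toAlgebra
  let _ : Algebra (Qo t) (DualNumber K) := J.toAlgebra
  have halg : Algebra.IsAlgebraic (Qo t) K := by
    have hal := hB.isAlgebraic
    refine ⟨fun x => ?_⟩
    refine IsAlgebraic.ringHom_of_comp_eq ((algebraMap (Zp t) (Qo t)).comp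
      (hB.1.repr : Algebra.adjoin ℤ (range ((↑) : t → K)) →+* Zp t)) (RingHom.id K)
      (hal.isAlgebraic x) ?_ ?_
    · rw [RingHom.coe_comp]
      exact Inj.comp (g := algebraMap (Zp t) (Qo t))
        (IsFractionRing.injective _ _) hB.1.aevalEquiv.symm.injective
    · ext a
      change j (algebraMap (Zp t) (Qo t) (hB.1.repr a)) = (a : K)
      rw [hj]
      conv_rhs => rw [← hB.1.aeval_repr a]
      simp [ev, aeval_def]
  have : Algebra.IsSeparable (Qo t) K := inferInstance
  have : Algebra.FormallyEtale (Qo t) K := Algebra.FormallyEtale.of_isSeparable _ _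
  let g : DualNumber K →ₐ[Qo t] K :=
    { (fstR K) with
      commutes' := fun q => hJj q }
  let δ := Algebra.FormallySmooth.liftOfSurjective (AlgHom.id (Qo t) K) g
    (fun a => ⟨tl0 a, rfl⟩) ker_nilp
  have hδ : ∀ a, (δ a).fst = a := fun a =>
    Algebra.FormallySmooth.liftOfSurjective_apply (AlgHom.id (Qo t) K) g _ ker_nilp a
  refine ⟨δ, hδ, fun i => ?_⟩
  have foo : w i = algebraMap (Qo t) K (algebraMap (Zp t) _ (X (e i))) := by
    change _ = j _
    rw [hj, ev_X]
  have bar : δ (w i) = J (algebraMap (Zp t) _ (X (e i))) := by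
    conv_lhs => rw [foo]
    exact δ.commutes _
  rw [RingHom.coe_coe, bar, hJ]
  simp [θ, v', he.extend_apply]
lemma deriv_acl (D : Derivation ℤ K K) {w : Set K} (hD : ∀ x ∈ w, D x = 0) {x : K}
    (hx : x ∈ acl w) : D x = 0 := by
  have hA : ∀ a : Algebra.adjoin ℤ w, D a = 0 := by
    rintro ⟨a, ha⟩
    induction ha using Algebra.adjoin_induction with
    | mem x hx => exact hD x hx
    | algebraMap r => simp
    | add x y hx hy foo bar => simp at foo bar; simp [foo, bar]
    | mul x y hx hy foo bar => simp at foo bar; simp [foo, bar]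
  let D' : Derivation (Algebra.adjoin ℤ w) K K :=
    Derivation.mk' { D.toLinearMap with
      map_smul' := fun c y => by
        have : D ((c : K) * y) = (c : K) * D y := by simp [hA c]
        exact this } (fun a b => D.leibniz a b)
  have key : ∀ n, ∀ p : Polynomial (Algebra.adjoin ℤ w), p.natDegree = n → p ≠ 0 →
      Polynomial.aeval x p = 0 → D' x = 0 := by
    intro n
    induction n using Nat.strong_induction_on with
    | _ n ih =>
      intro p hn hp hpx
      have foo := D'.map_aeval p x
      rw [hpx, map_zero] at foo
      by_cases bar : Polynomial.aeval x p.derivative = 0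
      · have hpos : 0 < p.natDegree := by
          by_contra h0
          have h0 : p.natDegree = 0 := by omega
          rw [Polynomial.eq_C_of_natDegree_eq_zero h0] at hpx hp
          simp at hpx hp
          exact hp hpx
        refine ih _ ?_ p.derivative rfl ?_ bar
        · rw [← hn]; exact Polynomial.natDegree_derivative_lt om
        · intro baz
          have := Polynomial.derivative_eq_zero.1 baz
          omega
      · simpa [bar] using foo.symm
  obtain ⟨p, hp, hpx⟩ := hx
  exact key _ p rfl hp hpx
lemma lift_acl (δ : K →+* DualNumber K) (hδ : ∀ a, (δ a).fst = a) {w : Set K}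
    (hD : ∀ x ∈ w, (δ x).snd = 0) {x : K} (hx : x ∈ acl w) : (δ x).snd = 0 := by
  let D : Derivation ℤ K K := Derivation.mk'
    ((⟨⟨fun a => (δ a).snd, by simp⟩, by simp⟩ : K →+ K).toIntLinearMap) (by
      intro a b
      simp [hδ, mul_comm])
  exact deriv_acl D hD hx
end deriv
lemma s_det {R : Type} [CommRing R] [Fintype ι] {f : ι → Zp σ} {ξ : σ → ι}
    (hG : Good f ξ)
    {h : Zp σ} {s s' : ι → R} {e e' : R} {z : σ → R} {u : ι → R} {μ : R}
    (H : Sol f h s e z u μ) (H' : Sol f h s' e' z u μ) (hs : ∀ i, i ∉ range ξ → s i = s' i) :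
    s = s' := by
  classical
  funext i
  by_cases hi : i ∈ range ξ
  swap
  · exact hs i hi
  obtain ⟨k, rfl⟩ := hi
  have foo := (H.eqn k).trans (H'.eqn k).symm
  rw [← Finset.add_sum_erase _ _ (mU (ξ k)),
    ← Finset.add_sum_erase _ _ (mU (ξ k))] at foo
  have bar : ∑ i ∈ Finset.univ.erase (ξ k), s i * (u i * ev z (pderiv k (f i))) =
      ∑ i ∈ Finset.univ.erase (ξ k), s' i * (u i * ev z (pderiv k (f i))) := by
    refine sCg rfl fun i hi => ?_
    by_cases hi' : i ∈ range ξ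
    · rw [pderiv_coord hG k i hi' (Finset.ne_of_mem_erase hi)]; simp
    · rw [hs i hi']
  rw [bar, add_left_inj] at foo
  have box := H.unit (ξ k)
  rw [hG.eq] at foo box
  simp only [pderiv_X_self, map_one, mul_one, ev_X] at foo box
  calc s (ξ k) = (s (ξ k) * u (ξ k)) * z k := by rw [mul_assoc, box, mul_one]
    _ = (s' (ξ k) * u (ξ k)) * z k := by rw [foo]
    _ = s' (ξ k) := by rw [mul_assoc, box, mul_one]
lemma Sol.u_det {R : Type} [CommRing R] [Fintype ι] {f : ι → Zp σ}
    {h : Zp σ} {s s' : ι → R} {e e' : R} {z : σ → R} {u u' : ι → R} {μ μ' : R}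
    (H : Sol f h s e z u μ) (H' : Sol f h s' e' z u' μ') : u = u' := by
  funext i
  calc u i = u i * (u' i * ev z (f i)) := by rw [H'.unit, mul_one]
    _ = u' i * (u i * ev z (f i)) := by ring
    _ = u' i := by rw [H.unit, mul_one]
section nondeg
variable {K : Type} [Field K] [Fintype σ]
lemma fev (z : σ → DualNumber K) (p : Zp σ) :
    (ev z p).fst = ev (fun k => (z k).fst) p := mev (fstR K) z p
lemma snd_ev (z : σ → DualNumber K) (p : Zp σ) :
    (ev z p).snd = ∑ k, ev (fun k => (z k).fst) (pderiv k p) * (z k).snd := by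
  classical
  induction p using MvPolynomial.induction_on with
  | C a => simp
  | add p q hp hq => simp [hp, hq, add_mul, sAd]
  | mul_X p j hp =>
    simp only [map_mul, ev_X, TrivSqZeroExt.snd_mul, fev, hp, Derivation.leibniz, map_add,
      smul_eq_mul, pderiv_X, Pi.single_apply, add_mul, sAd,
      MulOpposite.smul_eq_mul_unop, MulOpposite.unop_op, apply_ite (ev _), map_one, map_zero,
      mul_ite, mul_one, mul_zero, ite_mul, zero_mul]
    simp [mSm, mul_comm, mul_left_comm]
lemma dn_ext {a b : DualNumber K} (foo : a.fst = b.fst) (bar : a.snd = b.snd) : a = b :=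
  TrivSqZeroExt.ext foo bar
variable [CharZero K] [Fintype ι]
lemma nondeg {f : ι → Zp σ} {ξ : σ → ι} (hG : Good f ξ) {h : Zp σ}
    {s : ι → K} (hs : Gen s) {z : σ → DualNumber K} {u : ι → DualNumber K} {μ : DualNumber K}
    (H : Sol f h (fun i => tl0 (s i)) 0 z u μ)
    (hsm : ev (fun k => (z k).fst) h = 0 → ∃ k, ev (fun k => (z k).fst) (pderiv k h) ≠ 0) :
    (∀ k, (z k).snd = 0) ∧ (∀ i, (u i).snd = 0) ∧ μ.snd = 0 := by
  classical
  have H0 := H.map (fstR K)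
  simp only [fstR_apply, map_zero, TrivSqZeroExt.fst_inl] at H0
  have red : ∀ δ : K →+* DualNumber K, (∀ a, (δ a).fst = a) → (∀ k, δ (z k).fst = z k) →
      δ μ.fst = μ → (∀ i, i ∉ range ξ → (δ (s i)).snd = 0) →
      (∀ k, (z k).fst ∈ acl (range s)) → μ.fst ∈ acl (range s) →
      (∀ k, (z k).snd = 0) ∧ (∀ i, (u i).snd = 0) ∧ μ.snd = 0 := by
    intro δ hδ hz hμ hsf hza hμa
    have H1 := H0.map δ
    simp only [hz, hμ, map_zero] at H1
    have hu := H1.u_det H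
    rw [hu] at H1
    have hss := s_det hG H1 H (fun i hi => dn_ext (by simp [hδ]) (by simp [hsf i hi]))
    have hk : ∀ x ∈ range s, (δ x).snd = 0 := by
      rintro _ ⟨i, rfl⟩
      rw [congrFun hss i]; simp
    refine ⟨fun k => ?_, fun i => ?_, ?_⟩
    · rw [← hz]; exact lift_acl δ hδ hk (hza k)
    · rw [← congrFun hu i]
      refine lift_acl δ hδ hk ?_
      have := congrFun H0.u_eq i
      rw [this]
      exact Subfield.inv_mem _ (ev_mem _ hza _)
    · rw [← hμ]; exact lift_acl δ hδ hk hμa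
  by_cases hh : ev (fun k => (z k).fst) h = 0
  · obtain ⟨k, hk⟩ := hsm hh
    obtain ⟨g1, g2, g3⟩ := gen_H hG hs H0 hh k hk
    obtain ⟨δ, hδ, hδw⟩ := exists_lift g1
      (Function.update (fex ξ (fun k => (z k).snd) 0) (ξ k) μ.snd)
    have hμw := hδw (ξ k)
    simp only [Function.update_self] at hμw
    have hzw : ∀ j, j ≠ k → (δ (z j).fst).snd = (z j).snd := by
      intro j hj
      have := hδw (ξ j)
      have hne : ξ j ≠ ξ k := fun h' => hj (hG.inj h')
      simpa [Function.update_of_ne hne, hG.inj.extend_apply] using this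
    have hμ0 : μ.fst ≠ 0 := by
      have := g1.ne_zero (p := X (ξ k)) sm
      simpa using this
    have hun : IsUnit μ := by rw [TrivSqZeroExt.isUnit_iff_isUnit_fst]; exact hμ0.isUnit
    have hhz : ev z h = 0 := (hun.mul_right_eq_zero).1 H.last
    have hy : ev (fun k => δ (z k).fst) h = 0 := by rw [← mev, hh, map_zero]
    have hzk : (δ (z k).fst).snd = (z k).snd := by
      have e1 := congrArg TrivSqZeroExt.snd (hy.trans hhz.symm)
      rw [snd_ev, snd_ev] at e1
      simp only [hδ] at e1
      rw [← Finset.add_sum_erase _ _ (mU k),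
        ← Finset.add_sum_erase _ _ (mU k),
        sCg rfl (fun j hj => by rw [hzw j (Finset.ne_of_mem_erase hj)]),
        add_left_inj] at e1
      exact mul_left_cancel₀ hk e1
    refine red δ hδ (fun j => dn_ext (hδ _) ?_) (dn_ext (hδ _) hμw) (fun i hi => ?_) g3 ?_
    · by_cases hj : j = k
      · rw [hj, hzk]
      · exact hzw j hj
    · have := hδw i
      have hne : i ≠ ξ k := by rintro rfl; exact hi (mem_range_self _)
      have hi' : ¬ ∃ a, ξ a = i := by simpa using hi
      simpa [Function.update_of_ne hne, Function.extend_apply' _ _ _ hi'] using this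
    · have := g2 (ξ k)
      simpa using this
  · have hun : IsUnit (ev z h) := by
      rw [TrivSqZeroExt.isUnit_iff_isUnit_fst, fev]; exact (Ne.isUnit hh)
    have hμ : μ = 0 := (hun.mul_left_eq_zero).1 H.last
    subst hμ
    obtain ⟨g1, g2⟩ := gen_zero hG hs H0
    obtain ⟨δ, hδ, hδw⟩ := exists_lift g1 (fex ξ (fun k => (z k).snd) 0)
    refine red δ hδ (fun j => dn_ext (hδ _) ?_) sm (fun i hi => ?_)
      (gen_zero_z hG hs H0).2 (Subfield.zero_mem _)
    · have := hδw (ξ j)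
      simpa [hG.inj.extend_apply] using this
    · have := hδw i
      have hi' : ¬ ∃ a, ξ a = i := by simpa using hi
      simpa [Function.extend_apply' _ _ _ hi'] using this
end nondeg
section hensel
lemma taylor {R : Type} [CommRing R] {ν : Type} [Fintype ν] (z w : ν → R) (t : R)
    (p : Zp ν) : ∃ r, ev (fun k => z k + t * w k) p =
      ev z p + t * ∑ k, ev z (pderiv k p) * w k + t ^ 2 * r := by
  classical
  induction p using MvPolynomial.induction_on with
  | C a => exact ⟨0, by simp⟩
  | add p q hp hq =>
    obtain ⟨r, hr⟩ := hp
    obtain ⟨r', hr'⟩ := hq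
    refine ⟨r + r', ?_⟩
    simp only [map_add, hr, hr', add_mul, sAd]
    ring
  | mul_X p j hp =>
    obtain ⟨r, hr⟩ := hp
    have foo : ∑ k, ev z (pderiv k (p * X j)) * w k =
        ev z p * w j + z j * ∑ k, ev z (pderiv k p) * w k := by
      simp only [Derivation.leibniz, map_add, smul_eq_mul, pderiv_X, Pi.single_apply, add_mul,
        sAd, map_mul, apply_ite (ev z), map_one, map_zero, mul_ite, ite_mul,
        mul_one, mul_zero, zero_mul, ev_X, mSm, mul_assoc]
      simp
    refine ⟨r * (z j + t * w j) + (∑ k, ev z (pderiv k p) * w k) * w j, ?_⟩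
    rw [foo, map_mul, map_mul, hr, ev_X, ev_X]
    ring
variable {ν P : Type} [Fintype ν] [Fintype P]
lemma taylor' {R : Type} [CommRing R] (z w : ν → R) (c : P → R) (t : R)
    (p : Zp (ν ⊕ P)) : ∃ r, ev (Sum.elim (fun k => z k + t * w k) c) p =
      ev (Sum.elim z c) p + t * ∑ k, ev (Sum.elim z c) (pderiv (Sum.inl k) p) * w k + t ^ 2 * r := by
  obtain ⟨r, hr⟩ := taylor (Sum.elim z c) (Sum.elim w 0) t p
  refine ⟨r, ?_⟩
  rw [Fintype.sum_sum_type] at hr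
  simp only [Sum.elim_inl, Sum.elim_inr, Pi.zero_apply, mul_zero, Finset.sum_const_zero,
    add_zero] at hr
  rw [← hr]
  congr 2
  funext x
  cases x <;> simp
abbrev PS := PowerSeries ℂ
abbrev cc : PS →+* ℂ := PowerSeries.constantCoeff
lemma cc_elim (z : ν → PS) (c : P → PS) :
    (fun k => cc (Sum.elim z c k)) = Sum.elim (fun k => cc (z k)) (fun k => cc (c k)) := by
  funext k; cases k <;> rfl
variable {G : ν → Zp (ν ⊕ P)} {c : P → PS} {z0 : ν → ℂ}
lemma hensel_unique
    (hJ : ∀ v : ν → ℂ, (∀ i, ∑ j, ev (Sum.elim z0 (fun k => cc (c k))) (pderiv (Sum.inl j) (G i))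
      * v j = 0) → v = 0)
    (z z' : ν → PS) (foo : ∀ i, cc (z i) = z0 i) (h1' : ∀ i, cc (z' i) = z0 i)
    (bar : ∀ i, ev (Sum.elim z c) (G i) = 0) (h2' : ∀ i, ev (Sum.elim z' c) (G i) = 0) :
    z = z' := by
  have key : ∀ n : ℕ, ∃ w : ν → PS, ∀ i, z' i = z i + pX ^ (n+1) * w i := by
    intro n
    induction n with
    | zero =>
      have : ∀ i, ∃ w, z' i - z i = pX * w := by
        intro i
        rw [← dvd_def, pXd]
        have := foo i; have := h1' i
        simp_all
      choose w hw using this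
      exact ⟨w, fun i => by rw [zero_add, pow_one, ← hw]; ring⟩
    | succ n ih =>
      obtain ⟨w, hw⟩ := ih
      have hw0 : (fun i => cc (w i)) = 0 := by
        apply hJ
        intro i
        obtain ⟨r, hr⟩ := taylor' z w c (pX ^ (n+1)) (G i)
        have : (fun k => z k + pX ^ (n+1) * w k) = z' := by
          funext k; rw [hw]
        rw [this, bar, h2', zero_add] at hr
        have baz : (pX : PS) ^ (n+1) * (∑ k, ev (Sum.elim z c) (pderiv (Sum.inl k) (G i))
            * w k + pX ^ (n+1) * r) = 0 := by rw [hr]; ring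
        have box := (mul_eq_zero.1 baz).resolve_left (pow_ne_zero _ pXz)
        have h5 := congrArg cc box
        simp only [map_add, map_sum, map_mul, map_pow, mev, cc_elim, foo] at h5
        simpa using h5
      have : ∀ i, ∃ w', w i = pX * w' := by
        intro i
        rw [← dvd_def, pXd]
        exact congrFun hw0 i
      choose w' hw' using this
      exact ⟨w', fun i => by rw [hw, hw' i]; ring⟩
  funext i
  ext n
  obtain ⟨w, hw⟩ := key n
  rw [hw, map_add, PowerSeries.coeff_X_pow_mul', if_neg om, add_zero]
lemma hensel_exists
    (h0 : ∀ i, ev (Sum.elim z0 (fun k => cc (c k))) (G i) = 0)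
    (hJ : ∀ v : ν → ℂ, (∀ i, ∑ j, ev (Sum.elim z0 (fun k => cc (c k))) (pderiv (Sum.inl j) (G i))
      * v j = 0) → v = 0) :
    ∃ z : ν → PS, (∀ i, cc (z i) = z0 i) ∧ ∀ i, ev (Sum.elim z c) (G i) = 0 := by
  classical
  have hsurj : ∀ b : ν → ℂ, ∃ v : ν → ℂ, ∀ i,
      ∑ j, ev (Sum.elim z0 (fun k => cc (c k))) (pderiv (Sum.inl j) (G i)) * v j = b i := by
    let M : Matrix ν ν ℂ := Matrix.of fun i j =>
      ev (Sum.elim z0 (fun k => cc (c k))) (pderiv (Sum.inl j) (G i))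
    have hM : ∀ v i, M.mulVecLin v i = ∑ j, ev (Sum.elim z0 (fun k => cc (c k)))
      (pderiv (Sum.inl j) (G i)) * v j := fun v i => rfl
    have hinj : Inj M.mulVecLin := by
      rw [← LinearMap.ker_eq_bot, LinearMap.ker_eq_bot']
      intro v hv
      refine hJ v fun i => ?_
      rw [← hM, hv]; rfl
    intro b
    obtain ⟨v, hv⟩ := (LinearMap.injective_iff_surjective.1 hinj) b
    exact ⟨v, fun i => by rw [← hM, hv]⟩
  let Q : ℕ → (ν → PS) → Prop := fun n z => (∀ i, cc (z i) = z0 i) ∧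
    ∀ i, pX ^ (n+1) ∣ ev (Sum.elim z c) (G i)
  have step : ∀ n (z : {z // Q n z}), ∃ z' : {z // Q (n+1) z}, ∀ i, ∀ m, m ≤ n →
      pco m (z'.1 i) = pco m (z.1 i) := by
    rintro n ⟨z, hz, hd⟩
    have hd' := hd
    choose r hr using hd'
    obtain ⟨v, hv⟩ := hsurj (fun i => - cc (r i))
    refine ⟨⟨fun i => z i + pX ^ (n+1) * pC (v i), fun i => ?_, fun i => ?_⟩,
      fun i m hm => ?_⟩
    · simp [hz]
    · obtain ⟨r', hr'⟩ := taylor' z (fun i => pC (v i)) c (pX ^ (n+1)) (G i)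
      rw [hr', hr]
      have : pX ∣ r i + ∑ k, ev (Sum.elim z c) (pderiv (Sum.inl k) (G i)) *
          pC (v k) := by
        rw [pXd]
        have h5 := hv i
        have h6 : ∀ p, (PowerSeries.constantCoeff : PS →+* ℂ) (ev (Sum.elim z c) p) =
            ev (Sum.elim z0 (fun k => cc (c k))) p := by
          intro p
          rw [mev, cc_elim]; simp only [hz]
        simp only [map_add, map_sum, map_mul, h6, PowerSeries.constantCoeff_C]
        rw [h5]; simp
      obtain ⟨q, hq⟩ := this
      refine ⟨q + pX ^ n * r', ?_⟩
      calc _ = pX ^ (n+1) * (r i + ∑ k, ev (Sum.elim z c) (pderiv (Sum.inl k) (G i)) *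
          pC (v k)) + (pX ^ (n+1))^2 * r' := by ring
        _ = _ := by rw [hq]; ring
    · simp only
      rw [map_add, PowerSeries.coeff_X_pow_mul', if_neg om, add_zero]
  choose F hF using step
  have hQ0 : Q 0 (fun i => pC (z0 i)) := by
    refine ⟨fun i => by simp, fun i => ?_⟩
    rw [zero_add, pow_one, pXd, mev]
    have := cc_elim (fun i => pC (z0 i)) c
    rw [this]
    simp only [PowerSeries.constantCoeff_C]
    exact h0 i
  let seq : (n : ℕ) → {z // Q n z} := fun n => Nat.rec ⟨_, hQ0⟩ (fun n z => F n z) n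
  have hseq : ∀ n i m, m ≤ n → pco m ((seq (n+1)).1 i) =
      pco m ((seq n).1 i) := fun n i m hm => hF n (seq n) i m hm
  have hseq' : ∀ m i d, pco m ((seq (m+d)).1 i) =
      pco m ((seq m).1 i) := by
    intro m i d
    induction d with
    | zero => rfl
    | succ d ih => rw [← ih, ← add_assoc, hseq _ _ _ om]
  let z : ν → PS := fun i => pMk fun n => pco n ((seq n).1 i)
  have hz : ∀ n i, pX ^ (n+1) ∣ z i - (seq n).1 i := by
    intro n i
    rw [PowerSeries.X_pow_dvd_iff]
    intro m hm
    obtain ⟨d, rfl⟩ := Nat.exists_eq_add_of_le (show m ≤ n by omega)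
    rw [map_sub, hseq', PowerSeries.coeff_mk, sub_self]
  refine ⟨z, fun i => ?_, fun i => ?_⟩
  · have foo := hz 0 i
    rw [zero_add, pow_one, pXd, map_sub, sub_eq_zero] at foo
    exact foo.trans ((seq 0).2.1 i)
  · have hd : ∀ n, pX ^ (n+1) ∣ ev (Sum.elim z c) (G i) := by
      intro n
      choose w hw using fun i => hz n i
      obtain ⟨r, hr⟩ := taylor' (seq n).1 w c (pX ^ (n+1)) (G i)
      have : (fun k => (seq n).1 k + pX ^ (n+1) * w k) = z := by
        funext k; rw [← hw]; ring
      rw [this] at hr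
      rw [hr]
      refine dvd_add (dvd_add ((seq n).2.2 i) (Dvd.intro _ rfl)) ?_
      rw [pow_two, mul_assoc]; exact Dvd.intro _ rfl
    ext n
    have := (PowerSeries.X_pow_dvd_iff.1 (hd n)) n om
    rw [this]; simp
end hensel
lemma digits {O : Type} [CommRing O] [IsDomain O] (c : O →+* ℂ) (j : ℂ →+* O)
    (hcj : ∀ a, c (j a) = a) (ϖ : O) (hϖ : ϖ ≠ 0) (hker : ∀ a, c a = 0 → ϖ ∣ a) (hϖ0 : c ϖ = 0) :
    ∃ φ : O →+* PS, (∀ a, cc (φ a) = c a) ∧ (∀ a, φ (j a) = pC a) ∧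
      φ ϖ = pX := by
  have foo : ∀ a, ∃ b, a = j (c a) + ϖ * b := by
    intro a
    obtain ⟨b, hb⟩ := hker (a - j (c a)) (by rw [map_sub, hcj, sub_self])
    exact ⟨b, by rw [← hb]; ring⟩
  choose S hS using foo
  have hu : ∀ a x b, a = j x + ϖ * b → S a = b := by
    intro a x b h
    have hx : c a = x := by rw [h]; simp [hϖ0, hcj]
    have := hS a
    rw [hx] at this
    have bar := this.symm.trans h
    exact mul_left_cancel₀ hϖ (add_left_cancel bar)
  have hSadd : ∀ a b, S (a + b) = S a + S b := by
    intro a b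
    refine hu _ (c a + c b) _ ?_
    conv_lhs => rw [hS a, hS b]
    rw [map_add]; ring
  have hSmul : ∀ a b, S (a * b) = j (c a) * S b + S a * b := by
    intro a b
    refine hu _ (c a * c b) _ ?_
    rw [map_mul]
    linear_combination b * hS a + j (c a) * hS b
  have hSj : ∀ x, S (j x) = 0 := fun x => hu _ x _ sm
  have hSjmul : ∀ x b, S (j x * b) = j x * S b := by
    intro x b; rw [hSmul, hSj, hcj]; simp
  have hS0 : S 0 = 0 := by simpa using hSj 0
  have hSϖ : S ϖ = 1 := hu _ 0 _ sm
  let co : ℕ → O → ℂ := fun n a => c (S^[n] a)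
  have co0 : ∀ a, co 0 a = c a := fun a => rfl
  have cos : ∀ n a, co (n+1) a = co n (S a) := fun n a => by
    simp only [co, Function.iterate_succ_apply]
  have coadd : ∀ n a b, co n (a + b) = co n a + co n b := by
    intro n
    induction n with
    | zero => intro a b; simp [co0]
    | succ n ih => intro a b; rw [cos, cos, cos, hSadd, ih]
  have cojmul : ∀ n x b, co n (j x * b) = x * co n b := by
    intro n
    induction n with
    | zero => intro a b; simp [co0, hcj]
    | succ n ih => intro a b; rw [cos, cos, hSjmul, ih]
  have cozero : ∀ n, co n 0 = 0 := by
    intro n; have := cojmul n 0 0; simpa using this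
  have comul : ∀ n a b, pco n
      ((pMk fun n => co n a) * (pMk fun n => co n b)) = co n (a * b) := by
    intro n
    induction n with
    | zero => intro a b; simp [co0, PowerSeries.coeff_mul]
    | succ n ih =>
      intro a b
      have e1 : (pMk fun n => co n a) =
          pC (c a) + pX * (pMk fun n => co n (S a)) := by
        ext m
        cases m with
        | zero => simp [co0]
        | succ m => simp [cos, PowerSeries.coeff_C]
      rw [e1, add_mul, mul_assoc, map_add, PowerSeries.coeff_succ_X_mul, ih,
        PowerSeries.coeff_C_mul, PowerSeries.coeff_mk, cos, cos, hSmul, coadd, cojmul]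
  have co1 : ∀ x, (pMk fun n => co n (j x)) = pC x := by
    intro x
    ext m
    cases m with
    | zero => simp [co0, hcj]
    | succ m => simp [cos, hSj, PowerSeries.coeff_C, cozero]
  refine ⟨{ toFun := fun a => pMk fun n => co n a
            map_one' := by rw [← map_one j, co1, map_one]
            map_zero' := by rw [← map_zero j, co1, map_zero]
            map_add' := fun a b => by ext n; simp [coadd]
            map_mul' := fun a b => by ext n; rw [comul]; simp }, fun a => ?_, co1, ?_⟩
  · change cc (pMk fun n => co n a) = _
    simp [← PowerSeries.coeff_zero_eq_constantCoeff_apply, co0]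
  · change (pMk fun n => co n ϖ) = _
    ext m
    cases m with
    | zero => simp [co0, hϖ0]
    | succ m =>
      simp only [PowerSeries.coeff_mk, cos, hSϖ]
      have := congrArg (pco m) (co1 1)
      simp only [map_one, PowerSeries.coeff_mk] at this
      rw [this, PowerSeries.coeff_X, PowerSeries.coeff_one]
      simp
abbrev Fo := FractionRing PS
abbrev KK := AlgebraicClosure Fo
instance : CharZero PS := charZero_of_injective_algebraMap (R := ℂ) (algebraMap ℂ PS).injective
instance : CharZero Fo := charZero_of_injective_algebraMap (R := PS) (IsFractionRing.injective _ _)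
instance : CharZero KK := charZero_of_injective_algebraMap (R := Fo) (algebraMap Fo KK).injective
lemma cc_unique (χ : PS →+* ℂ) (foo : ∀ a, χ (pC a) = a) (bar : χ pX = 0) (a : PS) :
    χ a = cc a := by
  have : pX ∣ a - pC (cc a) := by rw [pXd]; simp
  obtain ⟨b, hb⟩ := this
  rw [sub_eq_iff_eq_add'.1 hb, map_add, map_mul, foo, bar]; simp
lemma place_aux {Ci : Type} [CommRing Ci] [IsDedekindDomain Ci] [Algebra PS Ci]
    [hint : Algebra.IsIntegral PS Ci] (hinjC : Inj (algebraMap PS Ci)) :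
    ∃ φ : Ci →+* PS, Inj φ ∧ (∀ a, cc (φ (algebraMap PS Ci a)) = cc a) ∧
      ∀ a, φ (algebraMap PS Ci (pC a)) = pC a := by
  obtain ⟨P, hP⟩ := Ideal.exists_maximal Ci
  have hPp : P.IsPrime := hP.isPrime
  have hXP : algebraMap PS Ci pX ∈ P := by
    have hm := Ideal.isMaximal_comap_of_isIntegral_of_isMaximal (R := PS) P
    have := IsLocalRing.eq_maximalIdeal hm
    have hX : (pX : PS) ∈ IsLocalRing.maximalIdeal PS := by
      rw [IsLocalRing.mem_maximalIdeal, mem_nonunits_iff, PowerSeries.isUnit_iff_constantCoeff]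
      simp
    rw [← this] at hX
    exact hX
  have hPb : P ≠ ⊥ := by
    intro h
    rw [h, Ideal.mem_bot] at hXP
    have := hinjC (hXP.trans (map_zero _).symm)
    exact pXz this
  let O := Localization.AtPrime P
  have hdvr : IsDiscreteValuationRing O :=
    IsLocalization.AtPrime.isDiscreteValuationRing_of_dedekind_domain Ci hPb O
  let k := Ci ⧸ P
  let _ : Field k := Ideal.Quotient.field P
  let jk : ℂ →+* k := (Ideal.Quotient.mk P).comp ((algebraMap PS Ci).comp pC)
  have hjk : ∀ a : PS, Ideal.Quotient.mk P (algebraMap PS Ci a) = jk (cc a) := by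
    intro a
    have : pX ∣ a - pC (cc a) := by rw [pXd]; simp
    obtain ⟨b, hb⟩ := this
    rw [← sub_eq_zero]
    change Ideal.Quotient.mk P (algebraMap PS Ci a) - Ideal.Quotient.mk P (algebraMap PS Ci _) = 0
    rw [← map_sub, ← map_sub, hb, map_mul, Ideal.Quotient.eq_zero_iff_mem]
    exact P.mul_mem_right _ hXP
  have hkint : jk.IsIntegral := by
    intro x
    obtain ⟨y, rfl⟩ := Ideal.Quotient.mk_surjective x
    obtain ⟨p, hp, hy⟩ := hint.isIntegral y
    refine ⟨p.map cc, hp.map _, ?_⟩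
    rw [Polynomial.eval₂_map]
    have : jk.comp cc = (Ideal.Quotient.mk P).comp (algebraMap PS Ci) := by
      ext a; exact (hjk a).symm
    rw [this, ← Polynomial.hom_eval₂, hy, map_zero]
  have hbij : Function.Bijective jk := by
    let _ : Algebra ℂ k := jk.toAlgebra
    have : Algebra.IsIntegral ℂ k := ⟨hkint⟩
    exact IsAlgClosed.algebraMap_bijective_of_isIntegral (k := ℂ) (K := k)
  let ek : ℂ ≃+* k := RingEquiv.ofBijective jk hbij
  let c0 : Ci →+* ℂ := (ek.symm : k →+* ℂ).comp (Ideal.Quotient.mk P)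
  have hc0 : ∀ x, c0 x = 0 ↔ x ∈ P := by
    intro x
    change ek.symm (Ideal.Quotient.mk P x) = 0 ↔ _
    rw [map_eq_zero_iff _ ek.symm.injective, Ideal.Quotient.eq_zero_iff_mem]
  have hc0a : ∀ a : PS, c0 (algebraMap PS Ci a) = cc a := by
    intro a
    change ek.symm (Ideal.Quotient.mk P (algebraMap PS Ci a)) = _
    rw [hjk]; exact ek.symm_apply_apply _
  have hun : ∀ y : P.primeCompl, IsUnit (c0 y) := fun y =>
    (Ne.isUnit (fun h => y.2 ((hc0 _).1 h)))
  let c : O →+* ℂ := IsLocalization.lift (M := P.primeCompl) hun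
  have hc : ∀ x, c (algebraMap Ci O x) = c0 x := fun x => IsLocalization.lift_eq _ _
  let j : ℂ →+* O := (algebraMap Ci O).comp ((algebraMap PS Ci).comp pC)
  have hcj : ∀ a, c (j a) = a := by
    intro a
    change c (algebraMap Ci O (algebraMap PS Ci (pC a))) = a
    rw [hc, hc0a]; simp
  obtain ⟨ϖ, hϖ⟩ := IsDiscreteValuationRing.exists_irreducible O
  have hcker : ∀ a, c a = 0 ↔ a ∈ IsLocalRing.maximalIdeal O := by
    intro a
    have hsurj : Sur c := fun x => ⟨j x, hcj x⟩
    have : (RingHom.ker c).IsMaximal := RingHom.ker_isMaximal_of_surjective c hsurj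
    rw [← IsLocalRing.eq_maximalIdeal this, RingHom.mem_ker]
  have hme := hϖ.maximalIdeal_eq
  obtain ⟨φ, hφc, hφj, hφX⟩ := digits c j hcj ϖ hϖ.ne_zero (fun a ha => by
    rw [hcker, hme, Ideal.mem_span_singleton] at ha; exact ha) (by
    rw [hcker, hme]; exact Ideal.mem_span_singleton_self _)
  have hφinj : Inj φ := by
    rw [injective_iff_map_eq_zero]
    intro a ha
    by_contra h
    obtain ⟨n, u, hu⟩ := IsDiscreteValuationRing.eq_unit_mul_pow_irreducible h hϖ
    rw [hu, map_mul, map_pow, hφX] at ha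
    rcases mul_eq_zero.1 ha with foo | foo
    · exact (u.isUnit.map φ).ne_zero foo
    · exact pow_ne_zero _ pXz foo
  have hCO : Inj (algebraMap Ci O) := IsLocalization.injective O P.primeCompl_le_nonZeroDivisors
  refine ⟨φ.comp (algebraMap Ci O), hφinj.comp hCO, fun a => ?_, hφj⟩
  rw [RingHom.comp_apply, hφc, hc, hc0a]
lemma exists_place [Finite σ] (z : σ → KK) : ∃ (L : IntermediateField Fo KK) (ψ : L →+* Fo)
    (ψ0 : PS →+* PS), (∀ k, z k ∈ L) ∧ (∀ a, cc (ψ0 a) = cc a) ∧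
    (∀ a, ψ0 (pC a) = pC a) ∧
    (∀ a : PS, ψ (algebraMap Fo L (algebraMap PS Fo a)) = algebraMap PS Fo (ψ0 a)) := by
  let L : IntermediateField Fo KK := IntermediateField.adjoin Fo (range z)
  have hfin : FiniteDimensional Fo L := IntermediateField.finiteDimensional_adjoin
    (fun x _ => (Algebra.IsAlgebraic.isAlgebraic x).isIntegral)
  have : CharZero L := charZero_of_injective_algebraMap (R := Fo) (algebraMap Fo L).injective
  have hsep : Algebra.IsSeparable Fo L := inferInstance
  have htower : IsScalarTower PS Fo L := inferInstance
  let Ci := integralClosure PS L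
  have hD : IsDedekindDomain Ci := integralClosure.isDedekindDomain PS Fo L
  have hFr : IsFractionRing Ci L := integralClosure.isFractionRing_of_finite_extension Fo L
  have hinjC : Inj (algebraMap PS Ci) := by
    have foo : Inj (algebraMap PS L) := by
      rw [IsScalarTower.algebraMap_eq PS Fo L]
      exact (algebraMap Fo L).injective.comp (IsFractionRing.injective PS Fo)
    rw [IsScalarTower.algebraMap_eq PS Ci L, RingHom.coe_comp] at foo
    exact Inj.of_comp foo
  obtain ⟨φ, hφinj, hφc, hφj⟩ := place_aux hinjC
  let θ : Ci →+* Fo := (algebraMap PS Fo).comp φ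
  have hθ : Inj θ :=
    (IsFractionRing.injective PS Fo).comp hφinj
  let ψ : L →+* Fo := IsFractionRing.lift (A := Ci) hθ
  have hψ : ∀ x, ψ (algebraMap Ci L x) = θ x := fun x => IsFractionRing.lift_algebraMap _ _
  refine ⟨L, ψ, φ.comp (algebraMap PS Ci), fun k => ?_, hφc, hφj, fun a => ?_⟩
  · exact IntermediateField.subset_adjoin _ _ (mem_range_self k)
  · rw [← IsScalarTower.algebraMap_apply PS Fo L, IsScalarTower.algebraMap_apply PS Ci L, hψ]
    rfl
section proper
def thPS : PS →+* DualNumber Fo where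
  toFun a := tl0 (algebraMap PS Fo a) +
    tr0 (algebraMap PS Fo (pX * PowerSeries.derivative ℂ a))
  map_one' := by
    apply dn_ext <;> simp
  map_zero' := by
    apply dn_ext <;> simp
  map_add' a b := by
    apply dn_ext <;> simp [mul_add]
  map_mul' a b := by
    apply dn_ext
    · simp
    · simp; ring
lemma thPS_fst (a : PS) : (thPS a).fst = algebraMap PS Fo a := by simp [thPS]
lemma thPS_snd (a : PS) : (thPS a).snd =
    algebraMap PS Fo (pX * PowerSeries.derivative ℂ a) := by simp [thPS]
lemma exists_th : ∃ D : Fo →+* DualNumber Fo, (∀ g, (D g).fst = g) ∧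
    ∀ a, D (algebraMap PS Fo a) = thPS a := by
  have hu : ∀ y : nonZeroDivisors PS, IsUnit (thPS y) := by
    intro y
    rw [TrivSqZeroExt.isUnit_iff_isUnit_fst, thPS_fst]
    exact Ne.isUnit sm
  let D : Fo →+* DualNumber Fo := IsLocalization.lift (M := nonZeroDivisors PS) hu
  have hD : ∀ a, D (algebraMap PS Fo a) = thPS a := fun a => IsLocalization.lift_eq _ _
  refine ⟨D, fun g => ?_, hD⟩
  have : (fstR Fo).comp D = RingHom.id Fo := by
    apply IsLocalization.ringHom_ext (nonZeroDivisors PS)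
    refine RingHom.ext fun p => ?_
    rw [RingHom.comp_apply, RingHom.comp_apply, hD, fstR_apply, thPS_fst]; rfl
  exact DFunLike.congr_fun this g
def OF (D : Fo →+* DualNumber Fo) (g : Fo) (n : ℤ) : Prop :=
  ∃ w u : PS, IsUnit u ∧ g = (algebraMap PS Fo pX) ^ n * algebraMap PS Fo u ∧
    (D g).snd = g * algebraMap PS Fo (pC (n : ℂ) + pX * w)
lemma xne : algebraMap PS Fo pX ≠ 0 := by
  simp [pXz]
lemma of_ps {D : Fo →+* DualNumber Fo} (hD : ∀ a, D (algebraMap PS Fo a) = thPS a) (a : PS)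
    (ha : a ≠ 0) : ∃ n, OF D (algebraMap PS Fo a) n := by
  obtain ⟨n, u, hu⟩ := IsDiscreteValuationRing.eq_unit_mul_pow_irreducible ha PowerSeries.X_irreducible
  refine ⟨n, PowerSeries.derivative ℂ (u : PS) * (u⁻¹ : PSˣ), u, u.isUnit, ?_, ?_⟩
  · rw [hu, map_mul, map_pow, zpow_natCast, mul_comm]
  · rw [hD, thPS_snd, ← map_mul]
    congr 1
    have hi : (u : PS) * (u⁻¹ : PSˣ) = 1 := by simp
    rw [hu]
    have hC : (pC (((n : ℤ)) : ℂ) : PS) = n := by simp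
    rw [hC]
    cases n with
    | zero =>
      simp only [pow_zero, mul_one]
      push_cast
      linear_combination (-(pX : PS) * PowerSeries.derivative ℂ (u : PS)) * hi
    | succ n =>
      simp only [Derivation.leibniz, Derivation.leibniz_pow, PowerSeries.derivative_X, smul_eq_mul,
        nsmul_eq_mul, Nat.add_sub_cancel]
      push_cast
      linear_combination (-(pX : PS)^(n+2) * PowerSeries.derivative ℂ (u : PS)) * hi
lemma of_all {D : Fo →+* DualNumber Fo} (foo : ∀ g, (D g).fst = g)
    (hD : ∀ a, D (algebraMap PS Fo a) = thPS a) (g : Fo) (hg : g ≠ 0) : ∃ n, OF D g n := by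
  obtain ⟨a, b, hb, rfl⟩ := IsFractionRing.div_surjective (A := PS) g
  have hb0 : b ≠ 0 := nonZeroDivisors.ne_zero hb
  have ha0 : a ≠ 0 := by rintro rfl; simp at hg
  obtain ⟨n, w, u, hu, e1, e2⟩ := of_ps hD a ha0
  obtain ⟨m, w', u', hu', e1', e2'⟩ := of_ps hD b hb0
  obtain ⟨v, hv⟩ := hu'
  have hbne : algebraMap PS Fo b ≠ 0 := by simpa using hb0
  refine ⟨n - m, w - w', u * (v⁻¹ : PSˣ), hu.mul (Units.isUnit _), ?_, ?_⟩
  · have hvi : algebraMap PS Fo u' * algebraMap PS Fo (v⁻¹ : PSˣ) = 1 := by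
      rw [← map_mul, ← hv]; simp
    rw [div_eq_iff hbne, e1, e1', map_mul, zpow_sub₀ xne]
    have := zpow_ne_zero m xne
    field_simp
    linear_combination (-algebraMap PS Fo u) * hvi
  · set g := algebraMap PS Fo a / algebraMap PS Fo b with hgd
    have baz : g * algebraMap PS Fo b = algebraMap PS Fo a := div_mul_cancel₀ _ hbne
    have box := congrArg (fun x => (D x).snd) baz
    simp only [map_mul, TrivSqZeroExt.snd_mul, foo, e2, e2'] at box
    simp only [smul_eq_mul, MulOpposite.smul_eq_mul_unop, MulOpposite.unop_op] at box
    apply mul_right_cancel₀ hbne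
    rw [← baz] at box
    simp only [map_add, map_mul, map_sub, Int.cast_sub] at box ⊢
    linear_combination box
variable [Fintype σ] [Fintype ι]
lemma proper {f : ι → Zp σ} {ξ : σ → ι} (hG : Good f ξ) {h : Zp σ}
    {s : ι → ℂ} (hs : Gen s) {t : PS} (ht : cc t = 0) (ht0 : t ≠ 0) {z : σ → Fo} {u : ι → Fo}
    {μ : Fo} (H : Sol f h (fun i => algebraMap PS Fo (pC (s i))) (algebraMap PS Fo t) z u μ) :
    ∃ Z : σ → PS, (∀ k, algebraMap PS Fo (Z k) = z k) ∧ ∀ i, IsUnit (ev Z (f i)) := by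
  classical
  obtain ⟨D, foo, hD⟩ := exists_th
  have hne : ∀ i, ev z (f i) ≠ 0 := by
    intro i hi; have := H.unit i; rw [hi] at this; simp at this
  choose n hn using fun i => of_all foo hD _ (hne i)
  have hh : ev z h ≠ 0 := by
    intro hh
    have := H.last
    rw [hh, mul_zero] at this
    exact ht0 (by simpa using this.symm)
  obtain ⟨m, w', -, -, -, e2'⟩ := of_all foo hD _ hh
  choose w v hv e1 e2 using hn
  have hder : ∀ p, (D (ev z p)).snd = ∑ k, ev z (pderiv k p) * (D (z k)).snd := by
    intro p
    rw [mev, snd_ev]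
    simp only [foo]
  have key : ∑ i, algebraMap PS Fo (pC (s i)) * (u i * (D (ev z (f i))).snd) =
      μ * (D (ev z h)).snd := by
    simp only [hder, mSm]
    rw [Finset.sum_comm]
    refine sCg rfl fun k _ => ?_
    rw [← mul_assoc, ← H.eqn k, Finset.sum_mul]
    refine sCg rfl fun i _ => ?_
    ring
  have key2 : ∑ i, pC (s i) * (pC (n i : ℂ) + pX * w i) =
      t * (pC (m : ℂ) + pX * w') := by
    apply IsFractionRing.injective PS Fo
    rw [map_sum, map_mul, ← H.last, mul_assoc, ← e2', ← key]
    refine sCg rfl fun i _ => ?_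
    rw [e2, ← mul_assoc (u i), H.unit, one_mul, map_mul]
  have key3 := congrArg cc key2
  simp only [map_sum, map_mul, map_add, ht, zero_mul, PowerSeries.constantCoeff_C,
    PowerSeries.constantCoeff_X, add_zero] at key3
  have hn0 : ∀ i, n i = 0 := by
    by_contra hc
    push Not at hc
    obtain ⟨i, hi⟩ := hc
    have hp : (∑ i, X i * C (n i) : Zp ι) ≠ 0 := by
      intro h0
      have := congrArg (ev (Pi.single i (1 : ℤ))) h0
      simp [Pi.single_apply] at this
      exact hi this
    refine hs.ne_zero hp ?_
    rw [map_sum]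
    simpa using key3
  have hfz : ∀ i, ev z (f i) = algebraMap PS Fo (v i) := by
    intro i; rw [e1, hn0]; simp
  have hZ : ∀ k, algebraMap PS Fo (v (ξ k)) = z k := by
    intro k; rw [← hfz, hG.eq, ev_X]
  refine ⟨fun k => v (ξ k), hZ, fun i => ?_⟩
  have : ev (fun k => v (ξ k)) (f i) = v i := by
    apply IsFractionRing.injective PS Fo
    rw [mev, ← hfz]; simp only [hZ]
  rw [this]; exact hv i
lemma proper' {f : ι → Zp σ} {ξ : σ → ι} (hG : Good f ξ) {h : Zp σ}
    (hsm : ∀ z : σ → ℂ, (∀ i, ev z (f i) ≠ 0) → ev z h = 0 → ∃ k, ev z (pderiv k h) ≠ 0)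
    {s : ι → ℂ} (hs : Gen s) {t : PS} (ht : cc t = 0) (ht0 : t ≠ 0) {z : σ → Fo} {u : ι → Fo}
    {μ : Fo} (H : Sol f h (fun i => algebraMap PS Fo (pC (s i))) (algebraMap PS Fo t) z u μ) :
    ∃ (Z : σ → PS) (U : ι → PS) (M : PS), (∀ k, algebraMap PS Fo (Z k) = z k) ∧
      Sol f h (fun i => pC (s i)) t Z U M := by
  obtain ⟨Z, hZ, hu⟩ := proper hG hs ht ht0 H
  choose U hU using fun i => (hu i).exists_left_inv
  have hZ' : z = fun k => algebraMap PS Fo (Z k) := funext fun k => (hZ k).symm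
  subst hZ'
  have hUu : u = fun i => algebraMap PS Fo (U i) := by
    rw [H.u_eq]
    funext i
    rw [← mev]
    refine (eq_inv_of_mul_eq_one_left ?_).symm
    rw [← map_mul, hU, map_one]
  subst hUu
  have hM : ∃ M, algebraMap PS Fo M = μ := by
    by_cases h0 : ev (fun k => cc (Z k)) h = 0
    · obtain ⟨k, hk⟩ := hsm (fun k => cc (Z k)) (fun i => by
        rw [← mev]; exact ((hu i).map cc).ne_zero) h0
      have hun : IsUnit (ev Z (pderiv k h)) := by
        rw [PowerSeries.isUnit_iff_constantCoeff]
        rw [mev]; exact hk.isUnit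
      obtain ⟨q, hq⟩ := hun.exists_right_inv
      refine ⟨(∑ i, pC (s i) * (U i * ev Z (pderiv k (f i)))) * q, ?_⟩
      have := H.eqn k
      simp only [← mev, ← map_mul, ← map_sum] at this
      rw [map_mul, this, mul_assoc, ← map_mul, hq]; simp
    · have hun : IsUnit (ev Z h) := by
        rw [PowerSeries.isUnit_iff_constantCoeff]
        rw [mev]; exact Ne.isUnit h0
      obtain ⟨q, hq⟩ := hun.exists_right_inv
      refine ⟨t * q, ?_⟩
      have := H.last
      simp only [← mev] at this
      rw [map_mul, ← this, mul_assoc, ← map_mul, hq]; simp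
  obtain ⟨M, rfl⟩ := hM
  exact ⟨Z, U, M, hZ, H.of_map _ (IsFractionRing.injective PS Fo)⟩
end proper
section addcore
variable [Fintype σ] [Fintype ι]
def Gsys (f : ι → Zp σ) (h : Zp σ) :
    (σ ⊕ ι ⊕ Unit) → MvPolynomial ((σ ⊕ ι ⊕ Unit) ⊕ (ι ⊕ Unit)) ℤ
  | .inl k => ∑ i, X (.inr (.inl i)) * (X (.inl (.inr (.inl i))) *
      rename (fun j => .inl (.inl j)) (pderiv k (f i))) - X (.inl (.inr (.inr ()))) *
      rename (fun j => .inl (.inl j)) (pderiv k h)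
  | .inr (.inl i) => X (.inl (.inr (.inl i))) * rename (fun j => .inl (.inl j)) (f i) - 1
  | .inr (.inr _) => X (.inl (.inr (.inr ()))) * rename (fun j => .inl (.inl j)) h -
      X (.inr (.inr ()))
lemma sol_iff {R : Type} [CommRing R] {f : ι → Zp σ} {h : Zp σ}
    {s : ι → R} {e : R} (y : σ ⊕ ι ⊕ Unit → R) (c : ι ⊕ Unit → R)
    (hc : ∀ i, c (.inl i) = s i) (hc' : c (.inr ()) = e) :
    Sol f h s e (fun k => y (.inl k)) (fun i => y (.inr (.inl i))) (y (.inr (.inr ()))) ↔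
      ∀ i, ev (Sum.elim y c) (Gsys f h i) = 0 := by
  constructor
  · intro H i
    rcases i with k | i | ⟨⟩
    · have := H.eqn k
      simp only [Gsys, map_sub, map_sum, map_mul, ev_X, ev_rename, Sum.elim_inl, Sum.elim_inr, hc]
      rw [this, sub_self]
    · have := H.unit i
      simp only [Gsys, map_sub, map_mul, ev_X, ev_rename, Sum.elim_inl, map_one]
      rw [this, sub_self]
    · have := H.last
      simp only [Gsys, map_sub, map_mul, ev_X, ev_rename, Sum.elim_inl, Sum.elim_inr, hc']
      rw [this, sub_self]
  · intro H
    refine ⟨fun i => ?_, fun k => ?_, ?_⟩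
    · have := H (.inr (.inl i))
      simp only [Gsys, map_sub, map_mul, ev_X, ev_rename, Sum.elim_inl, map_one] at this
      exact sub_eq_zero.1 this
    · have := H (.inl k)
      simp only [Gsys, map_sub, map_sum, map_mul, ev_X, ev_rename, Sum.elim_inl, Sum.elim_inr,
        hc] at this
      exact sub_eq_zero.1 this
    · have := H (.inr (.inr ()))
      simp only [Gsys, map_sub, map_mul, ev_X, ev_rename, Sum.elim_inl, Sum.elim_inr, hc'] at this
      exact sub_eq_zero.1 this
def pk {R : Type} (z : σ → R) (u : ι → R) (μ : R) : σ ⊕ ι ⊕ Unit → R :=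
  Sum.elim z (Sum.elim u fun _ => μ)
variable {f : ι → Zp σ} {ξ : σ → ι} {h : Zp σ} {s : ι → ℂ}
lemma jac_inj (hG : Good f ξ)
    (hsm : ∀ z : σ → ℂ, (∀ i, ev z (f i) ≠ 0) → ev z h = 0 → ∃ k, ev z (pderiv k h) ≠ 0)
    (hs : Gen s) {z : σ → ℂ} {u : ι → ℂ} {μ : ℂ} (H : Sol f h s 0 z u μ)
    (v : σ ⊕ ι ⊕ Unit → ℂ)
    (hv : ∀ i, ∑ j, ev (Sum.elim (pk z u μ) (Sum.elim s fun _ => 0)) (pderiv (Sum.inl j) (Gsys f h i))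
      * v j = 0) : v = 0 := by
  let y : σ ⊕ ι ⊕ Unit → DualNumber ℂ := fun k =>
    tl0 (pk z u μ k) + tr0 (v k)
  let c : ι ⊕ Unit → DualNumber ℂ := fun k => tl0 (Sum.elim s (fun _ => 0) k)
  have hyf : ∀ k, (y k).fst = pk z u μ k := fun k => by simp [y]
  have hys : ∀ k, (y k).snd = v k := fun k => by simp [y]
  have hel : (fun k => (Sum.elim y c k).fst) = Sum.elim (pk z u μ) (Sum.elim s fun _ => 0) := by
    funext k
    rcases k with k | k
    · exact hyf k
    · simp [c]
  have hS : ∀ i, ev (Sum.elim y c) (Gsys f h i) = 0 := by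
    intro i
    apply dn_ext
    · rw [fev, hel]
      exact (sol_iff (s := s) (e := 0) (pk z u μ) (Sum.elim s fun _ => 0) (fun _ => rfl) rfl).1 H i
    · rw [snd_ev, hel, Fintype.sum_sum_type]
      simp only [Sum.elim_inl, Sum.elim_inr, hys, hv i]
      simp [c]
  have hsol := (sol_iff (f := f) (h := h) (s := fun i => tl0 (s i)) (e := 0) y c
    (fun i => rfl) (by simp [c])).2 hS
  obtain ⟨n1, n2, n3⟩ := nondeg hG hs hsol (by
    simp only [hyf]
    refine hsm _ (fun i hi => ?_)
    have := H.unit i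
    rw [show z = fun k => pk z u μ (.inl k) from rfl, hi] at this; simp at this)
  funext k
  rw [← hys]
  rcases k with k | k | ⟨⟩
  · exact n1 k
  · exact n2 k
  · exact n3
def addf (f : ι → Zp σ) (h : Zp σ) : Option ι → Zp σ
  | none => h
  | some i => f i
lemma addf_good (hG : Good f ξ) : Good (addf f h) (fun k => some (ξ k)) :=
  ⟨fun a b hab => hG.inj (Option.some_injective _ hab), fun k => hG.eq k⟩
abbrev iK : PS →+* KK := (algebraMap Fo KK).comp (algebraMap PS Fo)
lemma iK_inj : Inj iK :=
  (algebraMap Fo KK).injective.comp (IsFractionRing.injective PS Fo)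
def sK (s : ι → ℂ) : Option ι → KK := fun o => o.elim (-iK pX) (fun i => iK (pC (s i)))
lemma gen_option {K : Type} [Field K] (jC : ℂ →+* K) (hs : Gen s) (a : K)
    (ha : ∀ p : Polynomial ℂ, p ≠ 0 → p.eval₂ jC a ≠ 0) :
    Gen (fun o : Option ι => o.elim a (fun i => jC (s i))) := by
  have foo : Gen (fun i => jC (s i)) := hs.map jC
  rw [gen_iff] at foo
  rw [gen_iff]
  refine (foo.option_iff_transcendental a).2 ?_
  intro halg
  obtain ⟨p, hp, hp0⟩ := halg
  have hr : ∀ a : Algebra.adjoin ℤ (range fun i => jC (s i)), ∃ b : ℂ, jC b = a := by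
    rintro ⟨a, ha⟩
    induction ha using Algebra.adjoin_induction with
    | mem x hx => obtain ⟨i, rfl⟩ := hx; exact ⟨_, rfl⟩
    | algebraMap r => exact ⟨r, by simp⟩
    | add x y hx hy foo bar =>
      obtain ⟨a, ha⟩ := foo; obtain ⟨b, hb⟩ := bar
      exact ⟨a + b, by rw [map_add, ha, hb]⟩
    | mul x y hx hy foo bar =>
      obtain ⟨a, ha⟩ := foo; obtain ⟨b, hb⟩ := bar
      exact ⟨a * b, by rw [map_mul, ha, hb]⟩
  have hl : p.map (algebraMap _ K) ∈ Polynomial.lifts jC := by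
    rw [Polynomial.lifts_iff_coeff_lifts]
    intro n
    obtain ⟨b, hb⟩ := hr (p.coeff n)
    exact ⟨b, by rw [hb, Polynomial.coeff_map]; rfl⟩
  obtain ⟨q, hq⟩ := (Polynomial.mem_lifts _).1 hl
  refine ha q ?_ ?_
  · rintro rfl
    rw [Polynomial.map_zero] at hq
    have := (Polynomial.map_eq_zero_iff (f := algebraMap (Algebra.adjoin ℤ (range fun i => jC (s i))) K)
      Subtype.val_injective).1 hq.symm
    exact hp this
  · rw [← Polynomial.eval_map, hq, Polynomial.eval_map]; exact hp0
lemma sK_gen (hs : Gen s) : Gen (sK s) := by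
  refine gen_option (iK.comp pC) hs (-iK pX) ?_
  intro p hp hp0
  rw [show (-iK pX : KK) = iK (-pX) by simp] at hp0
  rw [← Polynomial.hom_eval₂] at hp0
  have baz := iK_inj (hp0.trans (map_zero iK).symm)
  have box : ((p.comp (-Polynomial.X) : Polynomial ℂ) : PS) = 0 := by
    rw [← baz, Polynomial.comp]
    have := Polynomial.hom_eval₂ p Polynomial.C (Polynomial.coeToPowerSeries.ringHom (R := ℂ)) (-Polynomial.X)
    rw [Polynomial.coeToPowerSeries.ringHom_apply] at this
    rw [this]
    congr 1
    · ext a; simp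
    · simp
  have h5 : p.comp (-Polynomial.X) = 0 := by
    apply Polynomial.coe_injective ℂ
    rw [box]; simp
  have h6 := congrArg (fun q => Polynomial.comp q (-Polynomial.X)) h5
  simp [Polynomial.comp_assoc] at h6
  exact hp h6
lemma crit_sol {z : σ → KK} : z ∈ Crit KK (addf f h) (sK s) ↔
    ∃ u μ, Sol f h (fun i => iK (pC (s i))) (iK pX) z u μ := by
  constructor
  · rintro ⟨foo, bar⟩
    have hh := foo none
    simp only [addf] at hh
    refine ⟨fun i => (ev z (f i))⁻¹, iK pX * (ev z h)⁻¹, fun i => inv_mul_cancel₀ (foo (some i)),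
      fun k => ?_, by rw [mul_assoc, inv_mul_cancel₀ hh, mul_one]⟩
    have := bar k
    rw [Fintype.sum_option] at this
    simp only [sK, addf, Option.elim] at this
    linear_combination this
  · rintro ⟨u, μ, H⟩
    have hX : iK pX ≠ 0 := by
      intro h0; exact pXz (iK_inj (h0.trans (map_zero iK).symm))
    have hh : ev z h ≠ 0 := by
      intro h0; have := H.last; rw [h0, mul_zero] at this; exact hX this.symm
    refine ⟨fun i => ?_, fun k => ?_⟩
    · rcases i with _ | i
      · exact hh
      · intro h0
        have := H.unit i
        simp only [addf] at h0
        rw [h0] at this; simp at this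
    · rw [Fintype.sum_option]
      have e1 := H.eqn k
      rw [H.u_eq] at e1
      simp only [sK, addf, Option.elim]
      rw [e1, ← H.last]
      field_simp; ring
def Tgt (f : ι → Zp σ) (h : Zp σ) (s : ι → ℂ) : Set ((σ → ℂ) × ℂ) :=
  {p | ∃ u, Sol f h s 0 p.1 u p.2}
theorem add_core (hG : Good f ξ)
    (hsm : ∀ z : σ → ℂ, (∀ i, ev z (f i) ≠ 0) → ev z h = 0 → ∃ k, ev z (pderiv k h) ≠ 0)
    (hs : Gen s) : NNf (addf f h) = (Tgt f h s).encard := by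
  classical
  rw [← NNf_eq (K := KK) (addf_good hG) (sK_gen hs)]
  let c : ι ⊕ Unit → PS := Sum.elim (fun i => pC (s i)) (fun _ => pX)
  have hcc : ∀ c : ι ⊕ Unit → PS, (∀ i, c (.inl i) = pC (s i)) → cc (c (.inr ())) = 0 →
      (fun k => cc (c k)) = (Sum.elim s fun _ => 0) := by
    intro c foo bar
    funext k
    rcases k with k | ⟨⟩
    · simp [foo]
    · exact bar
  have hlift : ∀ p : Tgt f h s, ∃ (Z : σ → PS) (U : ι → PS) (M : PS),
      Sol f h (fun i => pC (s i)) pX Z U M ∧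
      (∀ k, cc (Z k) = p.1.1 k) ∧ (∀ i, cc (U i) = (ev p.1.1 (f i))⁻¹) ∧ cc M = p.1.2 := by
    rintro ⟨⟨z, μ⟩, u, H⟩
    have hc1 := hcc c (fun _ => rfl) (by simp [c])
    obtain ⟨y, hy1, hy2⟩ := hensel_exists (G := Gsys f h) (c := c) (z0 := pk z u μ) (by
      rw [hc1]
      exact (sol_iff (s := s) (e := 0) (pk z u μ) (Sum.elim s fun _ => 0) (fun _ => rfl) rfl).1 H)
      (by rw [hc1]; exact jac_inj hG hsm hs H)
    refine ⟨_, _, _, (sol_iff y c (fun _ => rfl) rfl).2 hy2, fun k => hy1 _, fun i => ?_, hy1 _⟩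
    rw [hy1, ← congrFun H.u_eq i]; rfl
  choose Z U M hZ hz hu hm using hlift
  let Φ : Tgt f h s → (σ → KK) := fun p k => iK (Z p k)
  have hΦinj : Inj Φ := by
    intro p q hpq
    have hZZ : Z p = Z q := by
      funext k; exact iK_inj (congrFun hpq k)
    have hMM : M p = M q := by
      have e1 := (hZ p).last
      have e2 := (hZ q).last
      rw [← hZZ] at e2
      have hne : ev (Z p) h ≠ 0 := by
        intro h0; rw [h0, mul_zero] at e1; exact pXz e1.symm
      exact mul_right_cancel₀ hne (e1.trans e2.symm)
    apply Subtype.ext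
    apply Prod.ext
    · funext k; rw [← hz, ← hz, hZZ]
    · rw [← hm, ← hm, hMM]
  have hrange : Crit KK (addf f h) (sK s) = range Φ := by
    ext x
    rw [crit_sol]
    constructor
    swap
    · rintro ⟨p, rfl⟩
      exact ⟨_, _, (hZ p).map iK⟩
    rintro ⟨u, μ, H⟩
    obtain ⟨L, ψ, ψ0, hxL, hψc, hψC, hψ⟩ := exists_place x
    let x' : σ → L := fun k => ⟨x k, hxL k⟩
    let iL : PS →+* L := (algebraMap Fo L).comp (algebraMap PS Fo)
    have hxx : ∀ p, (L.val (ev x' p)) = ev x p := fun p => mev (L.val : L →+* KK) x' p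
    have hsolL : Sol f h (fun i => iL (pC (s i))) (iL pX) x'
        (fun i => (ev x' (f i))⁻¹) (iL pX * (ev x' h)⁻¹) := by
      apply Sol.of_map (L.val : L →+* KK) L.val.injective
      have hμ : μ = iK pX * (ev x h)⁻¹ := by
        have hh : ev x h ≠ 0 := by
          intro h0; have := H.last; rw [h0, mul_zero] at this
          exact pXz (iK_inj (this.symm.trans (map_zero iK).symm))
        rw [← H.last, mul_assoc, mul_inv_cancel₀ hh, mul_one]
      rw [H.u_eq, hμ] at H
      have e1 : ∀ p, (L.val : L →+* KK) ((ev x' p)⁻¹) = (ev x p)⁻¹ := by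
        intro p; rw [map_inv₀]; congr 1; exact hxx p
      simp only [map_mul, e1]
      exact H
    have hsolF := hsolL.map ψ
    have hiL : ∀ a, ψ (iL a) = algebraMap PS Fo (ψ0 a) := hψ
    simp only [hiL, hψC] at hsolF
    have ht : cc (ψ0 pX) = 0 := by rw [hψc]; simp
    have hψ0inj : Inj ψ0 := by
      intro a b hab
      have foo := congrArg (algebraMap PS Fo) hab
      rw [← hψ, ← hψ] at foo
      exact IsFractionRing.injective PS Fo ((algebraMap Fo L).injective (ψ.injective foo))
    have ht0 : ψ0 pX ≠ 0 := by
      intro h0; exact pXz (hψ0inj (h0.trans (map_zero ψ0).symm))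
    obtain ⟨Y, V, N, hY, hS⟩ := proper' hG hsm hs ht ht0 hsolF
    have hS0 := hS.map cc
    simp only [PowerSeries.constantCoeff_C, ht] at hS0
    let p : Tgt f h s := ⟨(fun k => cc (Y k), cc N), _, hS0⟩
    refine ⟨p, ?_⟩
    have hSp := (hZ p).map ψ0
    simp only [hψC] at hSp
    let c' : ι ⊕ Unit → PS := Sum.elim (fun i => pC (s i)) (fun _ => ψ0 pX)
    have huniq := hensel_unique (G := Gsys f h) (c := c')
      (z0 := pk (fun k => cc (Y k)) (fun i => cc (V i)) (cc N))
      (by rw [hcc c' (fun _ => rfl) ht]; exact jac_inj hG hsm hs hS0)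
      (pk Y V N) (pk (fun k => ψ0 (Z p k)) (fun i => ψ0 (U p i)) (ψ0 (M p)))
      (by rintro (k | i | ⟨⟩) <;> rfl)
      (by
        rintro (k | i | ⟨⟩)
        · exact (hψc _).trans (hz p k)
        · refine (hψc _).trans ((hu p i).trans ?_)
          exact (congrFun hS0.u_eq i).symm
        · exact (hψc _).trans (hm p))
      ((sol_iff (pk Y V N) c' (fun _ => rfl) rfl).1 hS)
      ((sol_iff (pk (fun k => ψ0 (Z p k)) (fun i => ψ0 (U p i)) (ψ0 (M p))) c'
        (fun _ => rfl) rfl).1 hSp)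
    funext k
    have h7 : Y k = ψ0 (Z p k) := congrFun huniq (.inl k)
    have h8 : x' k = iL (Z p k) := by
      apply ψ.injective
      rw [hiL, ← h7, hY]
    exact (congrArg L.val h8).symm
  rw [hrange, ← image_univ, hΦinj.encard_image, encard_univ]
  rfl
def HC (f : ι → Zp σ) (h : Zp σ) (s : ι → ℂ) : Set (σ → ℂ) :=
  {z | (∀ i, ev z (f i) ≠ 0) ∧ ev z h = 0 ∧ ∃ μ, ∀ k,
    ∑ i, s i * ((ev z (f i))⁻¹ * ev z (pderiv k (f i))) = μ * ev z (pderiv k h)}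
theorem add_HC (hG : Good f ξ)
    (hsm : ∀ z : σ → ℂ, (∀ i, ev z (f i) ≠ 0) → ev z h = 0 → ∃ k, ev z (pderiv k h) ≠ 0)
    (hs : Gen s) : NNf (addf f h) = NNf f + (HC f h s).encard := by
  classical
  by_cases h0 : h = 0
  · subst h0
    have hU : ∀ z : σ → ℂ, ¬ ∀ i, ev z (f i) ≠ 0 := fun z hz => by
      obtain ⟨k, hk⟩ := hsm z hz (map_zero _)
      simp at hk
    have e1 : Tgt f 0 s = ∅ := by
      rw [eq_empty_iff_forall_notMem]
      rintro ⟨z, μ⟩ ⟨u, H⟩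
      refine hU z fun i hi => ?_
      have := H.unit i
      simp only [hi] at this; simp at this
    have e2 : Crit ℂ f s = ∅ := by
      rw [eq_empty_iff_forall_notMem]
      exact fun z hz => hU z hz.1
    have e3 : HC f 0 s = ∅ := by
      rw [eq_empty_iff_forall_notMem]
      exact fun z hz => hU z hz.1
    rw [add_core hG hsm hs, ← NNf_eq hG hs, e1, e2, e3]; simp
  rw [add_core hG hsm hs, ← NNf_eq hG hs]
  let B : Set ((σ → ℂ) × ℂ) := {p | p ∈ Tgt f h s ∧ p.2 ≠ 0}
  have e1 : Tgt f h s = (fun z => (z, (0:ℂ))) '' Crit ℂ f s ∪ B := by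
    ext ⟨z, μ⟩
    constructor
    · rintro ⟨u, H⟩
      by_cases hμ : μ = 0
      · subst hμ
        left
        refine ⟨z, ?_, rfl⟩
        have H' := H
        rw [H.u_eq] at H'
        exact (crit_iff_sol (h := h)).2 H'
      · exact Or.inr ⟨⟨u, H⟩, hμ⟩
    · rintro (⟨z, hz, hzz⟩ | hB)
      · cases hzz
        exact ⟨_, (crit_iff_sol (h := h)).1 hz⟩
      · exact hB.1
  have hd : Disjoint ((fun z => (z, (0:ℂ))) '' Crit ℂ f s) B := by
    rw [Set.disjoint_left]
    rintro _ ⟨z, hz, rfl⟩ hB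
    exact hB.2 rfl
  have e2 : HC f h s = Prod.fst '' B := by
    ext z
    constructor
    · rintro ⟨a1, a2, μ, a3⟩
      have H : Sol f h s 0 z (fun i => (ev z (f i))⁻¹) μ :=
        ⟨fun i => inv_mul_cancel₀ (a1 i), a3, by rw [a2, mul_zero]⟩
      refine ⟨(z, μ), ⟨⟨_, H⟩, ?_⟩, rfl⟩
      rintro rfl
      exact (gen_zero_z hG hs H).1.ne_zero h0 a2
    · rintro ⟨⟨z, μ⟩, ⟨⟨u, H⟩, hμ⟩, rfl⟩
      have hu := H.u_eq
      subst hu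
      refine ⟨fun i hi => ?_, (mul_eq_zero.1 H.last).resolve_left hμ, μ, H.eqn⟩
      have := H.unit i
      simp only [hi] at this; simp at this
  have hinj : InjOn Prod.fst B := by
    rintro ⟨z, μ⟩ ⟨⟨u, H⟩, hμ⟩ ⟨z', μ'⟩ ⟨⟨u', H'⟩, hμ'⟩ hzz
    dsimp only at hzz H H' hμ hμ'
    subst hzz
    rw [H'.u_det H] at H'
    have hz := (mul_eq_zero.1 H.last).resolve_left hμ
    obtain ⟨k, hk⟩ := hsm z (fun i hi => by
      have := H.unit i
      simp [hi] at this) hz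
    have := mul_right_cancel₀ hk ((H.eqn k).symm.trans (H'.eqn k))
    rw [this]
  rw [e1, encard_union_eq hd, e2, hinj.encard_image, Inj.encard_image]
  intro a b hab
  exact congrArg Prod.fst hab
end addcore
abbrev E := DualNumber ℂ
def dl (a : E) : ℂ := a.snd / a.fst
lemma dl_mul {a b : E} (ha : a.fst ≠ 0) (hb : b.fst ≠ 0) : dl (a * b) = dl a + dl b := by
  simp only [dl, TrivSqZeroExt.snd_mul, TrivSqZeroExt.fst_mul, smul_eq_mul,
    MulOpposite.smul_eq_mul_unop, MulOpposite.unop_op]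
  field_simp
  ring
lemma dl_inl (c : ℂ) : dl (tl0 c) = 0 := by simp [dl]
lemma fst_inv' (a : E) : (a⁻¹).fst = (a.fst)⁻¹ := TrivSqZeroExt.fst_inv a
lemma mul_inv' {a : E} (ha : a.fst ≠ 0) : a * a⁻¹ = 1 := TrivSqZeroExt.mul_inv_cancel ha
lemma dl_inv {a : E} (ha : a.fst ≠ 0) : dl a⁻¹ = - dl a := by
  have foo := dl_mul ha (b := a⁻¹) (by rw [fst_inv']; exact inv_ne_zero ha)
  rw [mul_inv' ha] at foo
  have : dl (1 : E) = 0 := by simp [dl]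
  rw [this] at foo
  linear_combination -foo
def Mono [Fintype ι] (P : (σ → E) → Prop) (f : ι → Zp σ) (φ : (σ → E) → E) : Prop :=
  ∃ c : ι → ℤ, ∀ z, P z → (φ z).fst ≠ 0 ∧ dl (φ z) = ∑ i, (c i : ℂ) * dl (ev z (f i))
section mono
variable [Fintype ι] {P : (σ → E) → Prop} {f : ι → Zp σ} {φ ψ : (σ → E) → E}
lemma Mono.mul (foo : Mono P f φ) (bar : Mono P f ψ) : Mono P f (fun z => φ z * ψ z) := by
  obtain ⟨c, hc⟩ := foo
  obtain ⟨d, hd⟩ := bar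
  refine ⟨fun i => c i + d i, fun z hz => ⟨?_, ?_⟩⟩
  · rw [TrivSqZeroExt.fst_mul]; exact mul_ne_zero (hc z hz).1 (hd z hz).1
  · rw [dl_mul (hc z hz).1 (hd z hz).1, (hc z hz).2, (hd z hz).2, ← sAd]
    refine sCg rfl fun i _ => ?_
    push_cast; ring
lemma Mono.inv (foo : Mono P f φ) : Mono P f (fun z => (φ z)⁻¹) := by
  obtain ⟨c, hc⟩ := foo
  refine ⟨fun i => - c i, fun z hz => ⟨?_, ?_⟩⟩
  · rw [fst_inv']; exact inv_ne_zero (hc z hz).1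
  · rw [dl_inv (hc z hz).1, (hc z hz).2, ← Finset.sum_neg_distrib]
    refine sCg rfl fun i _ => ?_
    push_cast; ring
lemma Mono.const (c : ℂ) (hc : c ≠ 0) : Mono P f (fun _ => tl0 c) :=
  ⟨0, fun z _ => ⟨by simpa using hc, by simp [dl_inl]⟩⟩
lemma Mono.one : Mono P f (fun _ => 1) := Mono.const 1 one_ne_zero
lemma Mono.congr (foo : Mono P f φ) (h : ∀ z, P z → ψ z = φ z) : Mono P f ψ := by
  obtain ⟨c, hc⟩ := foo
  exact ⟨c, fun z hz => by rw [h z hz]; exact hc z hz⟩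
lemma Mono.neg (foo : Mono P f φ) : Mono P f (fun z => - φ z) :=
  ((Mono.const (-1) nn).mul foo).congr fun z _ => by
    apply dn_ext <;> simp
lemma Mono.of_neg (foo : Mono P f (fun z => - φ z)) : Mono P f φ :=
  foo.neg.congr fun z _ => by simp
lemma Mono.fn (i : ι) (h : ∀ z, P z → (ev z (f i)).fst ≠ 0) : Mono P f (fun z => ev z (f i)) := by
  classical
  exact ⟨Pi.single i 1, fun z hz => ⟨h z hz, by simp [Pi.single_apply]⟩⟩
lemma Mono.mono {P' : (σ → E) → Prop} (foo : Mono P f φ) (h : ∀ z, P' z → P z) : Mono P' f φ := by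
  obtain ⟨c, hc⟩ := foo
  exact ⟨c, fun z hz => hc z (h z hz)⟩
lemma Mono.ne (foo : Mono P f φ) {z} (hz : P z) : (φ z).fst ≠ 0 := by
  obtain ⟨c, hc⟩ := foo
  exact (hc z hz).1
lemma Mono.comp [Fintype ι'] {P' : (σ' → E) → Prop} {f' : ι' → Zp σ'}
    {χ : (σ' → E) → E}
    (foo : Mono P' f' χ) (Θ : (σ → E) → (σ' → E)) (hΘ : ∀ z, P z → P' (Θ z))
    (bar : ∀ j, Mono P f (fun z => ev (Θ z) (f' j))) : Mono P f (fun z => χ (Θ z)) := by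
  obtain ⟨c, hc⟩ := foo
  choose d hd using bar
  refine ⟨fun i => ∑ j, c j * d j i, fun z hz => ⟨(hc _ (hΘ z hz)).1, ?_⟩⟩
  rw [(hc _ (hΘ z hz)).2]
  simp only [fun j => (hd j z hz).2, mSm]
  rw [Finset.sum_comm]
  refine sCg rfl fun i _ => ?_
  push_cast
  rw [Finset.sum_mul]
  refine sCg rfl fun j _ => ?_
  ring
end mono
def Pt (f : ι → Zp σ) (z : σ → E) : Prop := ∀ i, (ev z (f i)).fst ≠ 0
def CritP [Fintype ι] (P : (σ → E) → Prop) (f : ι → Zp σ) (s : ι → ℂ) :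
    Set (σ → ℂ) :=
  {z | (∃ y, P y ∧ ∀ k, (y k).fst = z k) ∧ ∀ y, P y → (∀ k, (y k).fst = z k) →
    ∑ i, s i * dl (ev y (f i)) = 0}
section char
variable [Fintype ι] [Fintype σ] {f : ι → Zp σ} {s : ι → ℂ} {h : Zp σ}
lemma dl_sum {z : σ → ℂ} {y : σ → E} (hy : ∀ k, (y k).fst = z k) :
    ∑ i, s i * dl (ev y (f i)) =
      ∑ k, (∑ i, s i * ((ev z (f i))⁻¹ * ev z (pderiv k (f i)))) * (y k).snd := by
  simp only [dl, snd_ev, fev, hy, Finset.sum_mul, div_eq_mul_inv, mSm]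
  rw [Finset.sum_comm]
  refine sCg rfl fun k _ => sCg rfl fun i _ => ?_
  ring
lemma crit_eq : Crit ℂ f s = CritP (Pt f) f s := by
  classical
  ext z
  constructor
  · rintro ⟨foo, bar⟩
    refine ⟨⟨fun k => tl0 (z k), fun i => ?_, fun k => by simp⟩, fun y _ hy => ?_⟩
    · rw [fev]; simpa using foo i
    · rw [dl_sum hy]; simp [bar]
  · rintro ⟨⟨y, hy, hyz⟩, bar⟩
    have hne : ∀ i, ev z (f i) ≠ 0 := by
      intro i; have := hy i; rw [fev] at this; simpa only [hyz] using this
    refine ⟨hne, fun k => ?_⟩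
    have := bar (fun j => tl0 (z j) + tr0 (Pi.single k (1:ℂ) j))
      (fun i => by rw [fev]; simpa using hne i) (fun j => by simp)
    rw [dl_sum (z := z) (fun j => by simp)] at this
    simp only [TrivSqZeroExt.snd_add, TrivSqZeroExt.snd_inl, TrivSqZeroExt.snd_inr, zero_add,
      Pi.single_apply, mul_ite, mul_one, mul_zero, Finset.sum_ite_eq', mU,
      if_true] at this
    exact this
lemma HC_eq (hsm : ∀ z : σ → ℂ, (∀ i, ev z (f i) ≠ 0) → ev z h = 0 → ∃ k, ev z (pderiv k h) ≠ 0) :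
    HC f h s = CritP (fun y => Pt f y ∧ ev y h = 0) f s := by
  classical
  ext z
  constructor
  · rintro ⟨foo, bar, μ, baz⟩
    refine ⟨⟨fun k => tl0 (z k), ⟨fun i => ?_, ?_⟩, fun k => by simp⟩,
      fun y hy hyz => ?_⟩
    · rw [fev]; simpa using foo i
    · apply dn_ext
      · rw [fev]; simpa using bar
      · rw [snd_ev]; simp
    · rw [dl_sum hyz]
      simp only [baz, mul_assoc, ← mSm]
      have := congrArg TrivSqZeroExt.snd hy.2
      rw [snd_ev] at this
      simp only [hyz] at this
      rw [this]; simp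
  · rintro ⟨⟨y, ⟨hy, hyh⟩, hyz⟩, bar⟩
    have hne : ∀ i, ev z (f i) ≠ 0 := by
      intro i; have := hy i; rw [fev] at this; simpa only [hyz] using this
    have hzh : ev z h = 0 := by
      have := congrArg TrivSqZeroExt.fst hyh
      rw [fev] at this
      simp only [hyz] at this
      exact this.trans rfl
    obtain ⟨k0, hk0⟩ := hsm z hne hzh
    refine ⟨hne, hzh, (∑ i, s i * ((ev z (f i))⁻¹ * ev z (pderiv k0 (f i)))) / ev z (pderiv k0 h),
      fun k => ?_⟩
    have hfst : ∀ w : σ → ℂ, ∀ j, ((fun j => tl0 (z j) + tr0 (w j) : σ → E)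
      j).fst = z j := fun w j => by simp
    let w : σ → ℂ := Pi.single k (ev z (pderiv k0 h)) - Pi.single k0 (ev z (pderiv k h))
    have := bar (fun j => tl0 (z j) + tr0 (w j))
      ⟨(fun i => by rw [fev]; simpa using hne i), by
        apply dn_ext
        · rw [fev]; simpa using hzh
        · rw [snd_ev]
          simp only [hfst]
          simp [w, Pi.single_apply, mul_sub, Finset.sum_sub_distrib]
          ring⟩ (hfst w)
    rw [dl_sum (hfst w)] at this
    simp only [TrivSqZeroExt.snd_add, TrivSqZeroExt.snd_inl, TrivSqZeroExt.snd_inr, zero_add, w,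
      Pi.sub_apply, mul_sub, Finset.sum_sub_distrib, Pi.single_apply, mul_ite, mul_zero,
      Finset.sum_ite_eq', mU, if_true] at this
    rw [div_mul_eq_mul_div, eq_div_iff hk0]
    linear_combination this
end char
section transfer
variable [Fintype ι] [Fintype ι']
structure Iso (P : (σ → E) → Prop) (P' : (σ' → E) → Prop) (Θ : (σ → E) → (σ' → E))
    (Θ' : (σ' → E) → (σ → E)) : Prop where
  fwd : ∀ z, P z → P' (Θ z)
  bwd : ∀ w, P' w → P (Θ' w)
  inv1 : ∀ z, P z → Θ' (Θ z) = z
  inv2 : ∀ w, P' w → Θ (Θ' w) = w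
  fst1 : ∀ z z', P z → P z' → (∀ k, (z k).fst = (z' k).fst) → ∀ k, (Θ z k).fst = (Θ z' k).fst
  fst2 : ∀ z z', P' z → P' z' → (∀ k, (z k).fst = (z' k).fst) → ∀ k, (Θ' z k).fst = (Θ' z' k).fst
variable {P : (σ → E) → Prop} {P' : (σ' → E) → Prop} {Θ : (σ → E) → (σ' → E)}
    {Θ' : (σ' → E) → (σ → E)}
lemma crit_iso_aux (hI : Iso P P' Θ Θ') {f : ι → Zp σ} {f' : ι' → Zp σ'}
    {s : ι → ℂ} {s' : ι' → ℂ}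
    (h : ∀ z, P z → ∑ i, s i * dl (ev z (f i)) = ∑ i, s' i * dl (ev (Θ z) (f' i))) :
    (CritP P f s).encard ≤ (CritP P' f' s').encard := by
  have hch : ∀ z : CritP P f s, ∃ y, P y ∧ ∀ k, (y k).fst = z.1 k := fun z => z.2.1
  choose Y hY hYz using hch
  let F : CritP P f s → CritP P' f' s' := fun z => ⟨fun k => (Θ (Y z) k).fst, ⟨_, hI.fwd _ (hY z),
    fun k => rfl⟩, fun w hw hwz => by
      have foo := hI.fst2 w (Θ (Y z)) hw (hI.fwd _ (hY z)) hwz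
      rw [hI.inv1 _ (hY z)] at foo
      have := z.2.2 (Θ' w) (hI.bwd w hw) (fun k => (foo k).trans (hYz z k))
      rw [h _ (hI.bwd w hw), hI.inv2 w hw] at this
      exact this⟩
  have hF : Inj F := by
    intro z z' hzz
    have foo : ∀ k, (Θ (Y z) k).fst = (Θ (Y z') k).fst := fun k => congrFun (congrArg Subtype.val hzz) k
    have bar := hI.fst2 _ _ (hI.fwd _ (hY z)) (hI.fwd _ (hY z')) foo
    rw [hI.inv1 _ (hY z), hI.inv1 _ (hY z')] at bar
    apply Subtype.ext
    funext k
    rw [← hYz, ← hYz, bar]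
  have := Function.Embedding.encard_le (s := CritP P f s) (t := CritP P' f' s') ⟨F, hF⟩
  exact this
lemma Iso.symm (hI : Iso P P' Θ Θ') : Iso P' P Θ' Θ :=
  ⟨hI.bwd, hI.fwd, hI.inv2, hI.inv1, hI.fst2, hI.fst1⟩
lemma transfer (hI : Iso P P' Θ Θ') {f : ι → Zp σ} {f' : ι' → Zp σ'}
    (m1 : ∀ i, Mono P' f' (fun w => ev (Θ' w) (f i)))
    (m2 : ∀ j, Mono P f (fun z => ev (Θ z) (f' j))) :
    ∃ (s : ι → ℂ) (s' : ι' → ℂ), Gen s ∧ Gen s' ∧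
      (CritP P f s).encard = (CritP P' f' s').encard := by
  classical
  obtain ⟨a, ha⟩ := exists_gen_complex (ι ⊕ ι')
  choose d hd using m1
  choose c hc using m2
  let s : ι → ℂ := fun i => a (.inl i) + ∑ j, (c j i : ℂ) * a (.inr j)
  let s' : ι' → ℂ := fun j => a (.inr j) + ∑ i, (d i j : ℂ) * a (.inl i)
  have hs : Gen s := by
    have := ha.subst (fun i => X (.inl i) + ∑ j, C (c j i) * X (.inr j))
      (Sum.elim (fun i => X i) (fun _ => 0)) (fun i => by simp)
    simpa [s] using this
  have hs' : Gen s' := by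
    have := ha.subst (fun i => X (.inr i) + ∑ j, C (d j i) * X (.inl j))
      (Sum.elim (fun _ => 0) (fun i => X i)) (fun i => by simp)
    simpa [s'] using this
  have key : ∀ z, P z → ∑ i, s i * dl (ev z (f i)) = ∑ i, s' i * dl (ev (Θ z) (f' i)) := by
    intro z hz
    have e1 : ∀ i, dl (ev z (f i)) = ∑ j, (d i j : ℂ) * dl (ev (Θ z) (f' j)) := by
      intro i
      have := (hd i _ (hI.fwd z hz)).2
      simp only [hI.inv1 z hz] at this
      exact this
    have e2 := fun j => (hc j z hz).2
    simp only [s, s', add_mul, sAd]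
    have t1 : ∑ i, (∑ j, (c j i : ℂ) * a (.inr j)) * dl (ev z (f i)) =
        ∑ j, a (.inr j) * dl (ev (Θ z) (f' j)) := by
      simp only [e2, Finset.sum_mul, mSm]
      rw [Finset.sum_comm]
      exact sCg rfl fun _ _ => sCg rfl fun _ _ => by ring
    have t2 : ∑ j, (∑ i, (d i j : ℂ) * a (.inl i)) * dl (ev (Θ z) (f' j)) =
        ∑ i, a (.inl i) * dl (ev z (f i)) := by
      simp only [e1, Finset.sum_mul, mSm]
      rw [Finset.sum_comm]
      exact sCg rfl fun _ _ => sCg rfl fun _ _ => by ring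
    rw [t1, t2, add_comm]
  refine ⟨s, s', hs, hs', le_antisymm (crit_iso_aux hI key) (crit_iso_aux hI.symm fun w hw => ?_)⟩
  rw [key _ (hI.bwd w hw), hI.inv2 w hw]
variable [Fintype σ] [Fintype σ']
theorem NNf_iso {f : ι → Zp σ} {f' : ι' → Zp σ'} {ξ ξ'}
    (hG : Good f ξ) (hG' : Good f' ξ') (hI : Iso (Pt f) (Pt f') Θ Θ')
    (m1 : ∀ i, Mono (Pt f') f' (fun w => ev (Θ' w) (f i)))
    (m2 : ∀ j, Mono (Pt f) f (fun z => ev (Θ z) (f' j))) : NNf f = NNf f' := by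
  obtain ⟨s, s', hs, hs', h⟩ := transfer hI m1 m2
  rw [← NNf_eq hG hs, ← NNf_eq hG' hs', crit_eq, crit_eq, h]
theorem NNf_add {f : ι → Zp σ} {f' : ι' → Zp σ'} {ξ ξ'}
    (hG : Good f ξ) (hG' : Good f' ξ') (h : Zp σ)
    (hsm : ∀ z : σ → ℂ, (∀ i, ev z (f i) ≠ 0) → ev z h = 0 → ∃ k, ev z (pderiv k h) ≠ 0)
    (hI : Iso (fun y => Pt f y ∧ ev y h = 0) (Pt f') Θ Θ')
    (m1 : ∀ i, Mono (Pt f') f' (fun w => ev (Θ' w) (f i)))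
    (m2 : ∀ j, Mono (fun y => Pt f y ∧ ev y h = 0) f (fun z => ev (Θ z) (f' j))) :
    NNf (addf f h) = NNf f + NNf f' := by
  obtain ⟨s, s', hs, hs', h⟩ := transfer hI m1 m2
  rw [add_HC hG hsm hs, HC_eq hsm, h, ← crit_eq, NNf_eq hG' hs']
end transfer
abbrev fl (L : List (Zp σ)) : Fin L.length → Zp σ := fun i => L.get i
def NN (L : List (Zp σ)) : ℕ∞ := NNf (fl L)
def PL (L : List (Zp σ)) (z : σ → E) : Prop := ∀ p ∈ L, (ev z p).fst ≠ 0
abbrev MonoL (P : (σ → E) → Prop) (L : List (Zp σ)) (φ : (σ → E) → E) : Prop :=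
  Mono P (fl L) φ
def LGood (L : List (Zp σ)) : Prop := ∀ k, X k ∈ L
def Un (L : List (Zp σ)) (p : Zp σ) : Prop :=
  MonoL (PL L) L (fun z => ev z p)
section basic
variable {L L' : List (Zp σ)} {p q r : Zp σ}
  {P : (σ → E) → Prop} {φ ψ χ : (σ → E) → E}
lemma pli : Pt (fl L) = PL L := by
  funext z
  apply propext
  constructor
  · intro h p hp
    obtain ⟨i, rfl⟩ := gOM hp
    exact h i
  · intro h i
    exact h _ (gM _ _)
lemma LGood.good (h : LGood L) : ∃ ξ, Good (fl L) ξ := by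
  have : ∀ k, ∃ i, fl L i = X k := fun k => gOM (h k)
  choose ξ hξ using this
  exact ⟨ξ, fun a b hab => X_injective ((hξ a).symm.trans ((congrArg _ hab).trans (hξ b))), hξ⟩
lemma LGood.mono (h : LGood L) (hs : ∀ p ∈ L, p ∈ L') : LGood L' := fun k => hs _ (h k)
lemma Mono.div {f : ι → Zp σ} [Fintype ι] (foo : Mono P f φ) (bar : Mono P f ψ)
    (h : ∀ z, P z → φ z = ψ z * χ z) :
    Mono P f χ :=
  (foo.mul bar.inv).congr fun z hz => by
    have := mul_inv' (bar.ne hz)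
    rw [h z hz]
    linear_combination (-(χ z)) * this
lemma MonoL.mem (hp : p ∈ L) (h : ∀ z, P z → PL L z) : MonoL P L (fun z => ev z p) := by
  obtain ⟨i, rfl⟩ := gOM hp
  exact Mono.fn (f := fl L) i (fun z hz => h z hz _ hp)
lemma compL {L' : List (Zp σ')} {χ : (σ' → E) → E} (foo : MonoL (PL L') L' χ)
    (Θ : (σ → E) → (σ' → E)) (bar : ∀ p ∈ L', MonoL P L (fun z => ev (Θ z) p)) :
    MonoL P L (fun z => χ (Θ z)) :=
  Mono.comp foo Θ (fun _ hz p hp => (bar p hp).ne hz) (fun _ => bar _ (gM _ _))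
lemma Un.mem (hp : p ∈ L) : Un L p := MonoL.mem hp fun _ h => h
lemma Un.mul (foo : Un L p) (bar : Un L q) : Un L (p * q) :=
  (Mono.mul foo bar).congr fun z _ => by simp
lemma Un.neg (foo : Un L p) : Un L (-p) := (Mono.neg foo).congr fun z _ => by simp
lemma Un.const {n : ℤ} (hn : n ≠ 0) : Un L (C n) :=
  (Mono.const (n : ℂ) (by exact_mod_cast hn)).congr fun z _ => by
    apply dn_ext <;> simp
lemma Un.one : Un L 1 := by
  have := Un.const (L := L) one_ne_zero
  rwa [map_one] at this
lemma Un.div (foo : Un L r) (bar : Un L p) (h : r = p * q) : Un L q :=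
  Mono.div foo bar fun z _ => by simp [h]
lemma Un.trans (foo : Un L' p) (h : ∀ g ∈ L', Un L g) : Un L p := compL foo id h
lemma Un.mono (foo : Un L' p) (h : ∀ g ∈ L', g ∈ L) : Un L p := foo.trans fun g hg => Un.mem (h g hg)
lemma Un.of (foo : Un L p) (h : q = p ∨ q = -p) : Un L q := by
  rcases h with rfl | rfl
  · exact foo
  · exact foo.neg
lemma Un.congr (foo : Un L p) (h : q = p) : Un L q := h ▸ foo
lemma Un.renm {B : List (Zp τ)} {p : Zp τ} (g : τ → σ) (h : Un B p)
    (hL : ∀ b ∈ B, Un L (rename g b)) : Un L (rename g p) := by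
  refine (compL h (fun z k => z (g k)) fun b hb => ?_).congr fun z _ => ev_rename _ _ _
  exact Mono.congr (hL b hb) fun z _ => (ev_rename _ _ _).symm
end basic
section fin
variable [Fintype σ] [Fintype σ'] {L : List (Zp σ)} {L' : List (Zp σ')}
theorem NN_iso (hG : LGood L) (hG' : LGood L') (Θ : (σ → E) → (σ' → E)) (Θ' : (σ' → E) → (σ → E))
    (m1 : ∀ p ∈ L, MonoL (PL L') L' (fun w => ev (Θ' w) p))
    (m2 : ∀ p ∈ L', MonoL (PL L) L (fun z => ev (Θ z) p))
    (inv1 : ∀ z, PL L z → Θ' (Θ z) = z) (inv2 : ∀ w, PL L' w → Θ (Θ' w) = w)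
    (fst1 : ∀ z z', (∀ k, (z k).fst = (z' k).fst) → ∀ k, (Θ z k).fst = (Θ z' k).fst)
    (fst2 : ∀ z z', (∀ k, (z k).fst = (z' k).fst) → ∀ k, (Θ' z k).fst = (Θ' z' k).fst) :
    NN L = NN L' := by
  obtain ⟨ξ, hξ⟩ := hG.good
  obtain ⟨ξ', hξ'⟩ := hG'.good
  refine NNf_iso hξ hξ' (Θ := Θ) (Θ' := Θ') ?_ ?_ ?_
  · rw [pli, pli]
    exact ⟨fun z hz p hp => (m2 p hp).ne hz, fun z hz p hp => (m1 p hp).ne hz, inv1, inv2,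
      fun z z' _ _ => fst1 z z', fun z z' _ _ => fst2 z z'⟩
  · rw [pli]; exact fun i => m1 _ (gM _ _)
  · rw [pli]; exact fun i => m2 _ (gM _ _)
theorem NN_congr {L L' : List (Zp σ)} (hG : LGood L) (hG' : LGood L')
    (m1 : ∀ p ∈ L, Un L' p) (m2 : ∀ p ∈ L', Un L p) : NN L = NN L' :=
  NN_iso hG hG' id id m1 m2 (fun _ _ => rfl) (fun _ _ => rfl) (fun _ _ h => h) (fun _ _ h => h)
theorem NN_perm {L L' : List (Zp σ)} (hG : LGood L) (h : ∀ p, p ∈ L ↔ p ∈ L') :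
    NN L = NN L' :=
  NN_congr hG (hG.mono fun p => (h p).1) (fun p hp => Un.mem ((h p).1 hp))
    (fun p hp => Un.mem ((h p).2 hp))
theorem NN_drop {L L' : List (Zp σ)} (hG : LGood L) (h : ∀ p ∈ L', Un L p) :
    NN (L ++ L') = NN L := by
  refine NN_congr (hG.mono fun p hp => mL _ hp) hG (fun p hp => ?_)
    fun p hp => Un.mem (mL _ hp)
  rcases mA.1 hp with hp | hp
  · exact Un.mem hp
  · exact h p hp
lemma NN_cons {h : Zp σ} (hG : LGood L) : NN (h :: L) = NNf (addf (fl L) h) := by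
  classical
  obtain ⟨ξ, hξ⟩ := hG.good
  obtain ⟨ξ', hξ'⟩ := (hG.mono (L' := h :: L) fun p hp => mCC _ hp).good
  have hP : Pt (addf (fl L) h) = PL (h :: L) := by
    funext z; apply propext
    constructor
    · intro H p hp
      rcases mC.1 hp with rfl | hp
      · exact H none
      · obtain ⟨i, rfl⟩ := gOM hp
        exact H (some i)
    · rintro H (_ | i)
      · exact H _ mCS
      · exact H _ (mCC _ (gM _ _))
  refine NNf_iso hξ' (addf_good hξ) (Θ := id) (Θ' := id) ?_ ?_ ?_
  · rw [pli, hP]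
    exact ⟨fun _ h => h, fun _ h => h, fun _ _ => rfl, fun _ _ => rfl, fun _ _ _ _ h => h,
      fun _ _ _ _ h => h⟩
  · intro i
    have : ∃ o, addf (fl L) h o = fl (h :: L) i := by
      rcases mC.1 (gM (h :: L) i) with e | e
      · exact ⟨none, e.symm⟩
      · obtain ⟨j, hj⟩ := gOM e
        exact ⟨some j, hj⟩
    obtain ⟨o, ho⟩ := this
    rw [← ho]
    exact Mono.fn o fun z hz => hz o
  · rw [pli]
    rintro (_ | i)
    · exact MonoL.mem (L := h :: L) mCS fun _ h => h
    · exact MonoL.mem (L := h :: L) (mCC _ (gM L i)) fun _ h => h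
theorem NN_add (hG : LGood L) (hG' : LGood L') (h : Zp σ)
    (Θ : (σ → E) → (σ' → E)) (Θ' : (σ' → E) → (σ → E))
    (hsm : ∀ z : σ → E, PL L z → ev z h = 0 → ∃ k, (ev z (pderiv k h)).fst ≠ 0)
    (m1 : ∀ p ∈ L, MonoL (PL L') L' (fun w => ev (Θ' w) p))
    (foo : ∀ w, PL L' w → ev (Θ' w) h = 0)
    (m2 : ∀ p ∈ L', MonoL (fun y => PL L y ∧ ev y h = 0) L (fun z => ev (Θ z) p))
    (inv1 : ∀ z, PL L z → ev z h = 0 → Θ' (Θ z) = z) (inv2 : ∀ w, PL L' w → Θ (Θ' w) = w)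
    (fst1 : ∀ z z', (∀ k, (z k).fst = (z' k).fst) → ∀ k, (Θ z k).fst = (Θ z' k).fst)
    (fst2 : ∀ z z', (∀ k, (z k).fst = (z' k).fst) → ∀ k, (Θ' z k).fst = (Θ' z' k).fst) :
    NN (h :: L) = NN L + NN L' := by
  obtain ⟨ξ, hξ⟩ := hG.good
  obtain ⟨ξ', hξ'⟩ := hG'.good
  rw [NN_cons hG]
  refine NNf_add hξ hξ' h ?_ (Θ := Θ) (Θ' := Θ') ?_ ?_ ?_
  · intro z hz hzh
    have e : ∀ p, (ev (fun k => (tl0 (z k) : E)) p).fst = ev z p := fun p => by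
      rw [fev]; simp
    obtain ⟨k, hk⟩ := hsm (fun k => tl0 (z k)) (fun p hp => by
      obtain ⟨i, rfl⟩ := gOM hp
      rw [e]; exact hz i) (by
        apply dn_ext
        · rw [e, hzh]; rfl
        · rw [snd_ev]; simp)
    exact ⟨k, by rwa [e] at hk⟩
  · rw [pli, pli]
    exact ⟨fun z hz p hp => (m2 p hp).ne hz, fun z hz => ⟨fun p hp => (m1 p hp).ne hz, foo z hz⟩,
      fun z hz => inv1 z hz.1 hz.2, inv2,
      fun z z' _ _ => fst1 z z', fun z z' _ _ => fst2 z z'⟩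
  · rw [pli]; exact fun i => m1 _ (gM _ _)
  · rw [pli]; exact fun i => m2 _ (gM _ _)
end fin
lemma NN_empty [IsEmpty σ] [Fintype σ] (L : List (Zp σ)) (h : ∀ p ∈ L, Un [] p) :
    NN L = 1 := by
  have hG : LGood ([] : List (Zp σ)) := fun k => isEmptyElim k
  have : NN ([] ++ L) = NN ([] : List (Zp σ)) := NN_drop hG h
  rw [nA] at this
  rw [this, NN, NNf, encard_eq_one]
  refine ⟨fun k => isEmptyElim k, ?_⟩
  ext z
  simp only [Crit, mem_ofPred_eq, mem_singleton_iff]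
  exact ⟨fun _ => funext fun k => isEmptyElim k, fun _ => ⟨fun i => i.elim0, fun k => isEmptyElim k⟩⟩
lemma NN_zero (L : List (Zp σ)) (h : 0 ∈ L) : NN L = 0 := by
  rw [NN, NNf, encard_eq_zero, eq_empty_iff_forall_notMem]
  rintro z ⟨hz, -⟩
  obtain ⟨i, hi⟩ := gOM h
  apply hz i
  simp only [fl, hi, map_zero]
section graph
variable (e : Option τ ≃ σ) (b c : Zp τ)
def rho : Zp τ →ₐ[ℤ] Zp σ := rename (fun t => e (some t))
def gpoly : Zp σ := rho e c * X (e none) - rho e b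
def gsec (w : τ → E) (k : σ) : E := (e.symm k).elim (ev w b * (ev w c)⁻¹) w
lemma ev_rho {R : Type} [CommRing R] (z : σ → R) (p : Zp τ) :
    ev z (rho e p) = ev (fun t => z (e (some t))) p := ev_rename _ _ _
lemma ev_gsec_rho (w : τ → E) (p : Zp τ) : ev (gsec e b c w) (rho e p) = ev w p := by
  rw [ev_rho]
  congr 2
  funext t
  simp [gsec]
variable {e b c}
lemma ev_gsec_gpoly {w : τ → E} (hc : (ev w c).fst ≠ 0) : ev (gsec e b c w) (gpoly e b c) = 0 := by
  rw [gpoly, map_sub, map_mul, ev_gsec_rho, ev_gsec_rho, ev_X]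
  have : gsec e b c w (e none) = ev w b * (ev w c)⁻¹ := by simp [gsec]
  rw [this]
  linear_combination (ev w b) * mul_inv' hc
lemma fst_ev_congr [Fintype σ] {z z' : σ → E} (h : ∀ k, (z k).fst = (z' k).fst) (p : Zp σ) :
    (ev z p).fst = (ev z' p).fst := by
  rw [fev, fev]; simp only [h]
theorem graph_add [Fintype τ] [Fintype σ] {L : List (Zp σ)}
    {L' : List (Zp τ)} (hG : LGood L) (hG' : LGood L') (hc : Un L' c)
    (m1 : ∀ p ∈ L, ∃ (N : ℕ) (g : _) (u : _), Un L' g ∧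
      (rho e c) ^ N * p = rho e g + u * gpoly e b c)
    (m2 : ∀ p ∈ L', ∃ v g u, Un L v ∧ Un L g ∧ v * rho e p = g + u * gpoly e b c) :
    NN (gpoly e b c :: L) = NN L + NN L' := by
  classical
  have M2 : ∀ p ∈ L', MonoL (fun y => PL L y ∧ ev y (gpoly e b c) = 0) L
      (fun z => ev (fun t => z (e (some t))) p) := by
    intro p hp
    obtain ⟨v, g, u, hv, hg, h⟩ := m2 p hp
    refine Mono.div (Mono.mono hg fun z hz => hz.1) (Mono.mono hv fun z hz => hz.1) fun z hz => ?_
    have := congrArg (ev z) h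
    simp only [map_mul, map_add, hz.2, mul_zero, add_zero, ev_rho] at this
    exact this.symm
  refine NN_add hG hG' _ (fun z t => z (e (some t))) (gsec e b c) ?_ ?_ ?_ M2 ?_ ?_ ?_ ?_
  · intro z hz hzh
    refine ⟨e none, ?_⟩
    have : pderiv (e none) (gpoly e b c) = rho e c := by
      have hz : ∀ p : Zp τ, pderiv (e none) (rho e p) = 0 := by
        intro p
        apply pderiv_eq_zero_of_notMem_vars
        intro hv
        have := vars_rename _ _ hv
        simp at this
      simp [gpoly, hz]
    rw [this, ev_rho]
    exact hc.ne fun p hp => (M2 p hp).ne ⟨hz, hzh⟩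
  · intro p hp
    obtain ⟨N, g, u, hg, h⟩ := m1 p hp
    have hp : ∀ N : ℕ, MonoL (PL L') L' (fun w => (ev w c) ^ N) := by
      intro N
      induction N with
      | zero => simpa using Mono.one
      | succ n ih => exact (ih.mul hc).congr fun z _ => pow_succ _ _
    refine Mono.div hg (hp N) fun w hw => ?_
    have := congrArg (ev (gsec e b c w)) h
    simp only [map_mul, map_add, map_pow, ev_gsec_gpoly (hc.ne hw), mul_zero, add_zero,
      ev_gsec_rho] at this
    exact this.symm
  · exact fun w hw => ev_gsec_gpoly (hc.ne hw)
  · intro z hz hzh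
    funext k
    obtain ⟨o, rfl⟩ := e.surjective k
    cases o with
    | some t => simp [gsec]
    | none =>
      have hcn : (ev (fun t => z (e (some t))) c).fst ≠ 0 :=
        hc.ne fun p hp => (M2 p hp).ne ⟨hz, hzh⟩
      rw [gpoly, map_sub, map_mul, ev_rho, ev_rho, ev_X] at hzh
      have : gsec e b c (fun t => z (e (some t))) (e none) = ev (fun t => z (e (some t))) b *
        (ev (fun t => z (e (some t))) c)⁻¹ := by simp [gsec]
      rw [this]
      linear_combination (z (e none)) * mul_inv' hcn -
        (ev (fun t => z (e (some t))) c)⁻¹ * hzh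
  · intro w _; funext t; simp [gsec]
  · intro z z' h t; exact h _
  · intro z z' h k
    obtain ⟨o, rfl⟩ := e.surjective k
    cases o with
    | some t => simpa [gsec] using h t
    | none => simp [gsec, fst_ev_congr h]
end graph
/-! ### Sections -/
abbrev Sec (τ : Type) := Zp τ × Zp τ
abbrev up : Zp τ →ₐ[ℤ] Zp (Option τ) := rename some
def sp (s : Sec τ) : Zp (Option τ) := up s.1 * X none - up s.2
def rs (t s : Sec τ) : Zp τ := t.1 * s.2 - s.1 * t.2
def NS (B : List (Zp τ)) (S : List (Sec τ)) : List (Zp (Option τ)) :=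
  B.map up ++ S.map sp
lemma sp_eq (s : Sec τ) : sp s = gpoly (Equiv.refl _) s.2 s.1 := rfl
section sec
variable {B : List (Zp τ)} {S : List (Sec τ)} {s : Sec τ}
lemma NS_good (hB : LGood B) (foo : (1, 0) ∈ S) : LGood (NS B S) := by
  rintro (_ | k)
  · refine mR _ (mM.2 ⟨_, foo, ?_⟩)
    simp [sp]
  · refine mL _ (mM.2 ⟨_, hB k, ?_⟩)
    simp [up]
lemma Un.up {p : Zp τ} (h : Un B p) {L : List (Zp (Option τ))}
    (hL : ∀ q ∈ B.map ML.up, q ∈ L) : Un L (ML.up p) :=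
  Un.renm _ h fun _ hb => Un.mem (hL _ (mMM hb))
theorem NS_add [Fintype τ] (hB : LGood B) (h0 : (0, -1) ∈ S) (foo : (1, 0) ∈ S)
    (hs : ∃ t ∈ S, Un B (rs t s)) :
    NN (NS B (S ++ [s])) = NN (NS B S) + NN (B ++ S.map (fun t => rs t s)) := by
  have hG := NS_good hB foo
  have e1 : NN (NS B (S ++ [s])) = NN (sp s :: NS B S) := by
    refine NN_perm (NS_good hB (mL _ foo)) fun p => ?_
    simp only [NS, mpA, mA, mpC, mpN, mC,
      nmn, or_false]
    tauto
  have hr : ∀ t ∈ S, Un (B ++ S.map (fun t => rs t s)) (rs t s) := fun t ht =>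
    Un.mem (mR _ (mM.2 ⟨t, ht, rfl⟩))
  have hc : Un (B ++ S.map (fun t => rs t s)) s.1 := (hr _ h0).congr (by simp [rs])
  rw [e1, sp_eq]
  refine graph_add hG (hB.mono fun p hp => mL _ hp) hc ?_ ?_
  · intro p hp
    rcases mA.1 hp with hp | hp
    · obtain ⟨b, hb, rfl⟩ := mM.1 hp
      exact ⟨0, b, 0, Un.mem (mL _ hb), by simp [rho, up]⟩
    · obtain ⟨t, ht, rfl⟩ := mM.1 hp
      refine ⟨1, rs t s, up t.1, hr t ht, ?_⟩
      simp only [rho, up, Equiv.refl_apply, sp, gpoly, rs, map_sub, map_mul]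
      ring
  · intro p hp
    rcases mA.1 hp with hp | hp
    · refine ⟨1, up p, 0, Un.one, Un.mem (mL _ (mMM hp)), ?_⟩
      simp [rho, up]
    · obtain ⟨t, ht, rfl⟩ := mM.1 hp
      obtain ⟨j, hj, hu⟩ := hs
      refine ⟨sp j, up (rs j s) * sp t, up j.1 * sp t - up t.1 * sp j,
        Un.mem (mR _ (mMM hj)),
        (hu.up fun q hq => mL _ hq).mul
          (Un.mem (mR _ (mMM ht))), ?_⟩
      simp only [rho, up, Equiv.refl_apply, sp, gpoly, rs, map_sub, map_mul]
      ring
def secSum (B : List (Zp τ)) : List (Sec τ) → List (Sec τ) → ℕ∞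
  | _, [] => 0
  | S, s :: R => NN (B ++ S.map (fun t => rs t s)) + secSum B (S ++ [s]) R
def secOK (B : List (Zp τ)) : List (Sec τ) → List (Sec τ) → Prop
  | _, [] => True
  | S, s :: R => (∃ t ∈ S, Un B (rs t s)) ∧ secOK B (S ++ [s]) R
lemma NS_sum [Fintype τ] (hB : LGood B) (R : List (Sec τ)) : ∀ {S : List (Sec τ)},
    (0, -1) ∈ S → (1, 0) ∈ S →
    secOK B S R → NN (NS B (S ++ R)) = NN (NS B S) + secSum B S R := by
  induction R with
  | nil => intro S _ _ _; simp [secSum]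
  | cons s R ih =>
    intro S h0 foo h
    have := ih (S := S ++ [s]) (mL _ h0) (mL _ foo) h.2
    rw [List.append_assoc, List.singleton_append] at this
    rw [this, NS_add hB h0 foo h.1, secSum, add_assoc]
lemma NS_base [Fintype τ] (hB : LGood B) : NN (NS B S2) = 0 := by
  have foo : NN (NS B S2) = NN (B.map up ++ [(X none : Zp (Option τ))]) := by
    have hg : LGood (B.map up ++ [(X none : Zp (Option τ))]) := by
      rintro (_ | k)
      · simp
      · exact mL _ (mM.2 ⟨_, hB k, by simp [up]⟩)
    refine NN_congr (NS_good hB sm) hg ?_ ?_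
    · intro p hp
      rcases mA.1 hp with hp | hp
      · exact Un.mem (mL _ hp)
      · simp only [mpC, mpN, mC, nmn, or_false] at hp
        rcases hp with rfl | rfl
        · exact Un.one.congr (by simp [sp])
        · exact (Un.mem (mR _ (mS.2 rfl))).congr (by simp [sp])
    · intro p hp
      rcases mA.1 hp with hp | hp
      · exact Un.mem (mL _ hp)
      · refine Un.mem (mR _ (mM.2 ⟨(1, 0), by simp, ?_⟩))
        rw [mS.1 hp]; simp [sp]
  classical
  obtain ⟨L, hL⟩ : ∃ L, L = B.map up ++ [(X none : Zp (Option τ))] := ⟨_, rfl⟩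
  rw [foo, ← hL, NN, NNf, encard_eq_zero, eq_empty_iff_forall_notMem]
  rintro z ⟨hz, he⟩
  have bar := he none
  obtain ⟨i, hi⟩ := gOM (show (X none : Zp (Option τ)) ∈ L by simp [hL])
  have hlen : ∀ j : Fin L.length, j ≠ i → pderiv none (L.get j) = 0 := by
    intro j hj
    have hll : L.length = B.length + 1 := by simp [hL]
    have key : ∀ k : Fin L.length, (k : ℕ) < B.length → L.get k ∈ B.map (up (τ := τ)) := by
      intro k hk
      subst hL
      rw [List.get_eq_getElem]
      rw [List.getElem_append_left (by simpa using hk)]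
      exact List.getElem_mem _
    have hup : ∀ b : Zp τ, pderiv none (up b) = 0 := by
      intro b
      apply pderiv_eq_zero_of_notMem_vars
      intro hv
      have := vars_rename _ _ hv
      simp at this
    have hiB : ¬ (i : ℕ) < B.length := by
      intro hlt
      obtain ⟨b, _, hb⟩ := mM.1 (key i hlt)
      have baz := hup b
      rw [hb, hi] at baz
      simp at baz
    have hjB : (j : ℕ) < B.length := by
      have := i.2; have := j.2
      have : (j : ℕ) ≠ i := fun h => hj (Fin.ext h)
      omega
    obtain ⟨b, _, hb⟩ := mM.1 (key j hjB)
    rw [← hb, hup]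
  rw [Finset.sum_eq_single i (fun j _ hj => by
    change _ * (_ * ev z (pderiv none (L.get j))) = 0
    rw [hlen j hj]; simp) sm] at bar
  have baz := hz i
  simp only [fl, hi, pderiv_X_self, map_one, mul_one] at bar baz
  rcases mul_eq_zero.1 bar with h | h
  · exact (gen_gen0 (ι := Fin L.length)).ne_zero (X_ne_zero i) (by simpa using h)
  · exact inv_ne_zero baz h
end sec
def dt {R : Type} [CommRing R] (a b c : Fin 3 → R) : R :=
  a 0 * (b 1 * c 2 - b 2 * c 1) - a 1 * (b 0 * c 2 - b 2 * c 0) + a 2 * (b 0 * c 1 - b 1 * c 0)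
abbrev Pts (τ : Type) := ℕ → Fin 3 → Zp τ
abbrev Ln := ℕ × ℕ
abbrev T3 := Ln × Ln × Ln
def br (q : Pts τ) (a b c : ℕ) : Zp τ := dt (q a) (q b) (q c)
def Dl (q : Pts τ) (T : T3) : Zp τ :=
  br q T.1.1 T.2.1.1 T.2.1.2 * br q T.1.2 T.2.2.1 T.2.2.2 -
    br q T.1.2 T.2.1.1 T.2.1.2 * br q T.1.1 T.2.2.1 T.2.2.2
def dj (p q : Ln) : Bool := p.1 != q.1 && p.1 != q.2 && p.2 != q.1 && p.2 != q.2
def djs (l i' i : Ln) : Bool := dj i i' && dj l i' && dj l i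
def inn (l : Ln) : List Ln → List Ln → List (List T3)
  | _, [] => []
  | P, i :: R => ((P.filter (fun i' => djs l i' i)).map (fun i' => (l, i', i))) :: inn l (P ++ [i]) R
def zl (M : ℕ) : List Ln := (List.range' 3 (M - 3)).map (fun c => (0, c))
def out (M : ℕ) : List Ln → List Ln → List (List T3)
  | _, [] => []
  | P, l :: R => inn l [(0, 1), (0, 2)] (zl M ++ P.filter (dj l)) ++ out M (P ++ [l]) R
def rl (M : ℕ) : List Ln := ((List.range M) ×ˢ (List.range M)).filter
  (fun p => 1 ≤ p.1 ∧ p.1 < p.2 ∧ p ≠ (1, 2))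
def fibT (M : ℕ) : List (List T3) := out M [(1, 2)] (rl M)
structure Std (q : Pts τ) : Prop where
  q0 : q 0 = ![0, 0, 1]
  q1 : q 1 = ![0, -1, 0]
  q2 : q 2 = ![1, 0, 0]
def BrU (q : Pts τ) (M : ℕ) (B : List (Zp τ)) : Prop :=
  ∀ a b c, a < M → b < M → c < M → a ≠ b → a ≠ c → b ≠ c → Un B (br q a b c)
def xs (q : Pts τ) (l i : Ln) : Sec τ := (Dl q ((0, 1), i, l), Dl q ((0, 2), i, l))
def xz (q : Pts τ) (i : Ln) : Sec τ := (br q 0 1 i.2, br q 0 2 i.2)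
def xq (q : Pts τ) (l i : Ln) : Sec τ := if i.1 = 0 then xz q i else xs q l i
def LV (M : ℕ) (i : Ln) : Prop := i.1 < i.2 ∧ i.2 < M
section ident
variable {q : Pts τ} (hq : Std q) {M : ℕ} {B : List (Zp τ)} (hU : BrU q M B)
include hq
lemma br012 : br q 0 1 2 = 1 := by simp [br, dt, hq.q0, hq.q1, hq.q2]
lemma br_lin (a c d : ℕ) :
    br q a c d = q a 0 * br q 2 c d - q a 1 * br q 1 c d + q a 2 * br q 0 c d := by
  simp only [br, dt, hq.q0, hq.q1, hq.q2, cv0, cv1,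
    cv]
  ring
lemma rs_zz (a b : Ln) : rs (xz q a) (xz q b) = br q 0 a.2 b.2 := by
  simp only [rs, xz, br, dt, hq.q0, hq.q1, hq.q2, cv0, cv1,
    cv]
  ring
lemma rs_zs (a l i : Ln) : rs (xz q a) (xs q l i) = Dl q ((0, a.2), i, l) := by
  simp only [rs, xz, xs, Dl]
  rw [br_lin hq a.2 i.1 i.2, br_lin hq a.2 l.1 l.2]
  simp only [br, dt, hq.q0, hq.q1, hq.q2, cv0, cv1,
    cv]
  ring
lemma rs_ss (l i' i : Ln) : rs (xs q l i') (xs q l i) = br q 0 l.1 l.2 * Dl q (l, i', i) := by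
  simp only [rs, xs, Dl]
  rw [br_lin hq l.1 i.1 i.2, br_lin hq l.1 i'.1 i'.2, br_lin hq l.2 i.1 i.2,
    br_lin hq l.2 i'.1 i'.2]
  have h0 : br q 0 l.1 l.2 = q l.1 0 * q l.2 1 - q l.1 1 * q l.2 0 := by
    simp [br, dt, hq.q0]
  have foo : br q 1 l.1 l.2 = q l.1 0 * q l.2 2 - q l.1 2 * q l.2 0 := by
    simp [br, dt, hq.q1]
  have bar : br q 2 l.1 l.2 = q l.1 1 * q l.2 2 - q l.1 2 * q l.2 1 := by
    simp [br, dt, hq.q2]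
  rw [h0, foo, bar]
  ring
omit hq
lemma Dl_rot (l i j : Ln) : Dl q (i, j, l) = Dl q (l, i, j) := by
  simp only [Dl, br, dt]
  ring
lemma Dl_swap (l i j : Ln) : Dl q (l, j, i) = - Dl q (l, i, j) := by
  simp only [Dl]; ring
lemma pl1 (a b c d e : ℕ) : Dl q ((a, b), (c, d), (c, e)) = br q a b c * br q c d e := by
  simp only [Dl, br, dt]; ring
lemma br_swap1 (a b c : ℕ) : br q b a c = - br q a b c := by simp only [br, dt]; ring
lemma br_swap2 (a b c : ℕ) : br q a c b = - br q a b c := by simp only [br, dt]; ring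
lemma br_aab (a b : ℕ) : br q a a b = 0 := by simp only [br, dt]; ring
lemma br_aba (a b : ℕ) : br q a b a = 0 := by simp only [br, dt]; ring
lemma Dl_flip2 (l i j : Ln) : Dl q (l, (i.2, i.1), j) = - Dl q (l, i, j) := by
  simp only [Dl, br, dt]; ring
lemma Dl_flip3 (l i j : Ln) : Dl q (l, i, (j.2, j.1)) = - Dl q (l, i, j) := by
  simp only [Dl, br, dt]; ring
lemma Dl_sh {i j : Ln} (h : dj i j = false) (hij : i ≠ j) (hi : i.1 < i.2) (hj : j.1 < j.2) :
    ∃ c d e, (c = i.1 ∨ c = i.2) ∧ (d = i.1 ∨ d = i.2) ∧ (c = j.1 ∨ c = j.2) ∧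
      (e = j.1 ∨ e = j.2) ∧ c ≠ d ∧ c ≠ e ∧ d ≠ e ∧
      ((∀ l : Ln, Dl q (l, i, j) = br q l.1 l.2 c * br q c d e) ∨
      (∀ l : Ln, Dl q (l, i, j) = - (br q l.1 l.2 c * br q c d e))) := by
  obtain ⟨a, b⟩ := i
  obtain ⟨c, d⟩ := j
  simp only [dj, bne, Bool.and_eq_false_iff, Bool.not_eq_false', beq_iff_eq] at h
  simp only at hi hj
  have hne : a = c → b ≠ d := fun foo bar => hij (by rw [foo, bar])
  rcases h with ((rfl | rfl) | rfl) | rfl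
  · exact ⟨a, b, d, by simp, by simp, by simp, by simp, by omega, by omega, hne rfl,
      Or.inl fun l => pl1 _ _ _ _ _⟩
  · refine ⟨a, b, c, by simp, by simp, by simp, by simp, by omega, by omega, by omega,
      Or.inr fun l => ?_⟩
    rw [← pl1, ← Dl_flip3]
  · refine ⟨b, a, d, by simp, by simp, by simp, by simp, by omega, by omega, by omega,
      Or.inr fun l => ?_⟩
    rw [← pl1, ← Dl_flip2]
  · refine ⟨b, a, c, by simp, by simp, by simp, by simp, by omega, by omega,
      fun h => hne h rfl, Or.inl fun l => ?_⟩
    rw [← pl1]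
    have := Dl_flip2 (q := q) l (a, b) (c, b)
    have bar := Dl_flip3 (q := q) l (b, a) (c, b)
    simp only at this bar
    rw [bar, this, neg_neg]
lemma dj_iff {i j : Ln} : dj i j = true ↔ i.1 ≠ j.1 ∧ i.1 ≠ j.2 ∧ i.2 ≠ j.1 ∧ i.2 ≠ j.2 := by
  simp [dj, and_assoc]
include hq hU
lemma rs_xq {l i' i : Ln} (hl : LV M l) (hi' : LV M i') (hi : LV M i) (hl0 : l.1 ≠ 0)
    (hd' : i'.1 = 0 ∨ dj l i' = true) (hd : i.1 = 0 ∨ dj l i = true) (hne : i' ≠ i) :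
    (djs l i' i = false → Un B (rs (xq q l i') (xq q l i))) ∧
    (djs l i' i = true → ∃ u, Un B u ∧ rs (xq q l i') (xq q l i) = u * Dl q (l, i', i)) := by
  obtain ⟨hl1, hl2⟩ := hl
  obtain ⟨hi1, hi2⟩ := hi
  obtain ⟨hi1', hi2'⟩ := hi'
  have key0 : ∀ c : ℕ, ∀ j : Ln, c ≠ 0 → c < M → j.1 < j.2 → j.2 < M → j.1 ≠ 0 → dj l j = true →
      (dj l (0, c) = false ∨ dj j (0, c) = false) → Un B (Dl q ((0, c), j, l)) := by
    intro c j hc hcM hj1 hj2 hj0 hlj h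
    rw [dj_iff] at hlj
    have hor : (c = l.1 ∨ c = l.2) ∨ (c = j.1 ∨ c = j.2) := by
      by_contra hcon
      push Not at hcon
      rcases h with h | h <;> rw [← Bool.not_eq_true, dj_iff] at h <;> apply h <;> simp only <;>
        omega
    rcases hor with h | h
    · have : br q c l.1 l.2 = 0 := by
        rcases h with rfl | rfl
        · exact br_aab _ _
        · exact br_aba _ _
      have hh : Un B (br q c j.1 j.2 * br q 0 l.1 l.2) :=
        (hU _ _ _ om om om om om om).mul
          (hU _ _ _ om om om om om om)
      refine hh.neg.congr ?_
      simp [Dl, this]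
    · have : br q c j.1 j.2 = 0 := by
        rcases h with rfl | rfl
        · exact br_aab _ _
        · exact br_aba _ _
      have hh : Un B (br q 0 j.1 j.2 * br q c l.1 l.2) :=
        (hU _ _ _ om om om om om om).mul
          (hU _ _ _ om om om om om om)
      refine hh.congr ?_
      simp [Dl, this]
  by_cases foo : i'.1 = 0 <;> by_cases bar : i.1 = 0
  · simp only [xq, foo, bar, if_true, rs_zz hq]
    refine ⟨fun _ => hU _ _ _ om om om om om ?_, fun h => ?_⟩
    · intro h; exact hne (Prod.ext (foo.trans bar.symm) h)
    · simp only [djs, Bool.and_eq_true, dj_iff] at h; omega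
  · have hd := hd.resolve_left bar
    simp only [xq, foo, bar, if_true, if_false, rs_zs hq]
    constructor
    · intro h
      refine key0 _ _ om om hi1 hi2 bar hd ?_
      simp only [djs, hd, Bool.and_true, Bool.and_eq_false_iff] at h
      rw [show i' = (0, i'.2) from Prod.ext foo rfl] at h
      exact h.symm
    · intro h
      refine ⟨1, Un.one, ?_⟩
      rw [one_mul, show ((0 : ℕ), i'.2) = i' from Prod.ext foo.symm rfl, Dl_rot]
  · have hd' := hd'.resolve_left foo
    have : rs (xq q l i') (xq q l i) = - rs (xq q l i) (xq q l i') := by simp only [rs]; ring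
    rw [this]
    simp only [xq, foo, bar, if_true, if_false, rs_zs hq]
    constructor
    · intro h
      refine Un.neg (key0 _ _ om om hi1' hi2' foo hd' ?_)
      simp only [djs, hd', Bool.and_true, Bool.and_eq_false_iff] at h
      rw [show i = (0, i.2) from Prod.ext bar rfl] at h
      rcases h with h | h
      · right
        rw [← Bool.not_eq_true, dj_iff] at h ⊢
        exact fun hh => h ⟨hh.1.symm, hh.2.2.1.symm, hh.2.1.symm, hh.2.2.2.symm⟩
      · exact Or.inl h
    · intro h
      refine ⟨1, Un.one, ?_⟩
      rw [one_mul, show ((0 : ℕ), i.2) = i from Prod.ext bar.symm rfl, Dl_rot, Dl_swap, neg_neg]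
  · have hd := hd.resolve_left bar
    have hd' := hd'.resolve_left foo
    have hu : Un B (br q 0 l.1 l.2) :=
      hU _ _ _ om om om om om om
    simp only [xq, foo, bar, if_false, rs_ss hq]
    constructor
    · intro h
      refine hu.mul ?_
      simp only [djs, hd, hd', Bool.and_true] at h
      have h' : dj i' i = false := by
        rw [← Bool.not_eq_true, dj_iff] at h ⊢
        exact fun hh => h ⟨hh.1.symm, hh.2.2.1.symm, hh.2.1.symm, hh.2.2.2.symm⟩
      obtain ⟨c, d, e, hc, hdd, hc', he, n1, n2, n3, hl⟩ := Dl_sh (q := q) h' hne hi1' hi1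
      rw [dj_iff] at hd hd'
      have : Un B (br q l.1 l.2 c * br q c d e) :=
        (hU _ _ _ om om om om om om).mul
          (hU _ _ _ om om om n1 n2 n3)
      exact this.of (hl.imp (fun h => h l) (fun h => h l))
    · intro h
      exact ⟨_, hu, rfl⟩
end ident
lemma secOK_of {B : List (Zp τ)} (R : List (Sec τ)) : ∀ {S : List (Sec τ)},
    (∀ s ∈ R, ∃ t ∈ S, Un B (rs t s)) → secOK B S R := by
  induction R with
  | nil => intro S _; trivial
  | cons s R ih =>
    intro S h
    refine ⟨h s mCS, ih fun s' hs' => ?_⟩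
    obtain ⟨t, ht, hu⟩ := h s' (mCC _ hs')
    exact ⟨t, mL _ ht, hu⟩
lemma secOK_append {B : List (Zp τ)} (R R' : List (Sec τ)) : ∀ {S : List (Sec τ)},
    secOK B S R → secOK B (S ++ R) R' → secOK B S (R ++ R') := by
  induction R with
  | nil => intro S _ h; simpa using h
  | cons s R ih =>
    intro S h h'
    exact ⟨h.1, ih h.2 (by simpa using h')⟩
def ext (q : Pts τ) (M : ℕ) : Pts (Option (Option τ)) := fun a =>
  if a = M then ![1, X (some none), X none] else fun i => up (up (q a i))
def pairs (M : ℕ) : List Ln := ((List.range M) ×ˢ (List.range M)).filter (fun p => p.1 < p.2)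
def VV (q : Pts τ) (M : ℕ) (B : List (Zp τ)) : List (MvPolynomial (Option (Option τ)) ℤ) :=
  (B.map up).map up ++ (pairs M).map (fun p => br (ext q M) p.1 p.2 M)
def yl (q : Pts τ) (l : Ln) : Sec (Option τ) :=
  (up (br q 0 l.1 l.2), up (br q 1 l.1 l.2) * X none - up (br q 2 l.1 l.2))
def zs (M : ℕ) : List Ln := [(0, 1), (0, 2)] ++ zl M
def WW (q : Pts τ) (M : ℕ) (B : List (Zp τ)) : List (Zp (Option τ)) :=
  NS B ((zs M).map (xz q))
lemma mem_zs {M : ℕ} {i : Ln} (hM : 3 ≤ M) : i ∈ zs M ↔ i.1 = 0 ∧ 1 ≤ i.2 ∧ i.2 < M := by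
  obtain ⟨a, b⟩ := i
  simp only [zs, zl, cA, nA, mC, Prod.mk.injEq, mM,
    List.mem_range'_1]
  constructor
  · rintro (h | h | ⟨c, h, foo, bar⟩) <;> omega
  · rintro ⟨rfl, foo, bar⟩
    by_cases hb : b < 3
    · have : b = 1 ∨ b = 2 := by omega
      rcases this with h | h <;> simp [h]
    · right; right; exact ⟨b, by omega, rfl, rfl⟩
lemma zs_nodup (M : ℕ) : (zs M).Nodup := by
  have h : zs M = (1 :: 2 :: List.range' 3 (M - 3)).map (fun c => ((0 : ℕ), c)) := by simp [zs, zl]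
  rw [h]
  refine List.Nodup.map (fun a b hab => (Prod.mk.inj hab).2) ?_
  simp [List.nodup_cons, List.mem_range'_1, List.nodup_range']
section fib
variable {q : Pts τ} (hq : Std q) {M : ℕ} {B : List (Zp τ)} (hU : BrU q M B)
  (hB : LGood B) [Fintype τ]
include hq hU hB
lemma inn_sum {l : Ln} (hl : LV M l) (hl0 : l.1 ≠ 0) (R : List Ln) : ∀ P : List Ln,
    (∀ i ∈ P ++ R, LV M i ∧ (i.1 = 0 ∨ dj l i = true)) → (P ++ R).Nodup →
    secSum B (P.map (xq q l)) (R.map (xq q l)) =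
      ((inn l P R).map (fun Ds => NN (B ++ Ds.map (Dl q)))).sum := by
  induction R with
  | nil => intro P _ _; simp [secSum, inn]
  | cons i R ih =>
    intro P hv hn
    have hi := hv i sm
    have ih' := ih (P ++ [i]) (by simpa using hv) (by simpa using hn)
    simp only [mpC, secSum, inn, List.sum_cons]
    rw [mpA, List.map_singleton] at ih'
    rw [ih']
    congr 1
    have hne : ∀ i' ∈ P, i' ≠ i := by
      rintro i' hi' rfl
      rw [List.nodup_append] at hn
      exact hn.2.2 i' hi' i' sm rfl
    have hk : ∀ i' ∈ P, _ := fun i' hi' =>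
      rs_xq hq hU hl (hv i' (by simp [hi'])).1 hi.1 hl0 (hv i' (by simp [hi'])).2 hi.2 (hne i' hi')
    refine NN_congr (hB.mono fun p hp => mL _ hp)
      (hB.mono fun p hp => mL _ hp) ?_ ?_
    · intro p hp
      rcases mA.1 hp with hp | hp
      · exact Un.mem (mL _ hp)
      · rw [List.map_map] at hp
        obtain ⟨i', hi', rfl⟩ := mM.1 hp
        simp only [Function.comp_apply]
        cases hd : djs l i' i with
        | false => exact ((hk i' hi').1 hd).mono fun g hg => mL _ hg
        | true =>
          obtain ⟨u, hu, he⟩ := (hk i' hi').2 hd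
          rw [he]
          refine (hu.mono fun g hg => mL _ hg).mul
            (Un.mem (mR _ (mMM (mM.2 ⟨i', ?_, rfl⟩))))
          exact mF.2 ⟨hi', hd⟩
    · intro p hp
      rcases mA.1 hp with hp | hp
      · exact Un.mem (mL _ hp)
      · rw [List.map_map] at hp
        obtain ⟨i', hi', rfl⟩ := mM.1 hp
        obtain ⟨hi', hd⟩ := mF.1 hi'
        obtain ⟨u, hu, he⟩ := (hk i' hi').2 hd
        simp only [Function.comp_apply]
        refine Un.div (r := rs (xq q l i') (xq q l i)) (Un.mem (mR _ ?_))
          (hu.mono fun g hg => mL _ hg) he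
        rw [List.map_map]
        exact mM.2 ⟨i', hi', rfl⟩
omit hU hB in
lemma xz01 : xz q (0, 1) = (0, -1) := by
  simp [xz, br, dt, hq.q0, hq.q1, hq.q2]
omit hU hB in
lemma xz02 : xz q (0, 2) = (1, 0) := by
  simp [xz, br, dt, hq.q0, hq.q1, hq.q2]
omit hU hB in
lemma yl12 : yl q (1, 2) = (1, 0) := by
  simp [yl, br, dt, hq.q0, hq.q1, hq.q2]
lemma line_sum (hM : 3 ≤ M) {l : Ln} (hl : LV M l) (hl0 : l.1 ≠ 0) (P : List Ln)
    (hP : ∀ i ∈ P, LV M i ∧ i.1 ≠ 0) (hn : P.Nodup) :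
    NN (NS B ((zs M ++ P.filter (dj l)).map (xq q l))) =
      ((inn l [(0, 1), (0, 2)] (zl M ++ P.filter (dj l))).map
        (fun Ds => NN (B ++ Ds.map (Dl q)))).sum := by
  have hz : ∀ i ∈ zs M, LV M i ∧ i.1 = 0 := by
    intro i hi
    rw [mem_zs hM] at hi
    exact ⟨⟨by omega, by omega⟩, by omega⟩
  have hv : ∀ i ∈ zs M ++ P.filter (dj l), LV M i ∧ (i.1 = 0 ∨ dj l i = true) := by
    intro i hi
    rcases mA.1 hi with hi | hi
    · exact ⟨(hz i hi).1, Or.inl (hz i hi).2⟩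
    · obtain ⟨foo, bar⟩ := mF.1 hi
      exact ⟨(hP i foo).1, Or.inr bar⟩
  have hnd : (zs M ++ P.filter (dj l)).Nodup := by
    rw [List.nodup_append]
    refine ⟨zs_nodup M, hn.filter _, fun a ha b hb hab => ?_⟩
    exact (hP b (mF.1 hb).1).2 (hab ▸ (hz a ha).2)
  have e1 : (0, 1) ∈ zs M := by simp [zs]
  have e2 : (0, 2) ∈ zs M := by simp [zs]
  have x1 : xq q l (0, 1) = (0, -1) := by simp only [xq, if_true]; exact xz01 hq
  have x2 : xq q l (0, 2) = (1, 0) := by simp only [xq, if_true]; exact xz02 hq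
  have hm : [((0 : ℕ), 1), (0, 2)].map (xq q l) = S2 := by simp [x1, x2]
  rw [← inn_sum hq hU hB hl hl0 _ _ (by rw [← List.append_assoc]; exact hv)
    (by rw [← List.append_assoc]; exact hnd), hm, zs, List.append_assoc, mpA, hm,
    NS_sum hB, NS_base hB, zero_add]
  · simp
  · simp
  · rw [← hm, mpA]
    refine secOK_append _ _ (secOK_of _ ?_) (secOK_of _ ?_)
    · intro s hs
      obtain ⟨i, hi, rfl⟩ := mM.1 hs
      have hi' : i ∈ zs M := mR _ hi
      refine ⟨xq q l (0, 1), by simp, ?_⟩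
      have hi0 := (hz i hi').2
      refine (rs_xq hq hU hl (hz _ e1).1 (hz i hi').1 hl0 (Or.inl rfl) (Or.inl hi0) ?_).1 ?_
      · rintro rfl
        simp [zl, List.mem_range'_1] at hi
      · simp [djs, dj, hi0]
    · intro s hs
      obtain ⟨i, hi, rfl⟩ := mM.1 hs
      obtain ⟨hi, hd⟩ := mF.1 hi
      have hlz : (0, l.1) ∈ zs M := (mem_zs hM).2 ⟨rfl, by simp only; omega, by
        have := hl.1; have := hl.2; simp only; omega⟩
      refine ⟨xq q l (0, l.1), ?_, ?_⟩
      · rw [← mpA]; exact mMM hlz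
      refine (rs_xq hq hU hl (hz _ hlz).1 (hP i hi).1 hl0 (Or.inl rfl) (Or.inr hd) ?_).1 ?_
      · rintro rfl; exact (hP _ hi).2 rfl
      · simp [djs, dj]
omit hB hq [Fintype τ] in
lemma xs_sh (hM : 3 ≤ M) {l i : Ln} (hl : LV M l) (hi : LV M i) (hne : i ≠ l) (hl0 : l.1 ≠ 0)
    (h : dj l i = false) :
    ∃ c ∈ zs M, ∃ u, Un B u ∧ sp (xs q l i) = up u * sp (xz q c) := by
  have h' : dj i l = false := by
    rw [← Bool.not_eq_true, dj_iff] at h ⊢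
    exact fun hh => h ⟨hh.1.symm, hh.2.2.1.symm, hh.2.1.symm, hh.2.2.2.symm⟩
  obtain ⟨c, d, e, hc, hd, hc', he, n1, n2, n3, hD⟩ := Dl_sh (q := q) h' hne hi.1 hl.1
  have := hl.1; have := hl.2; have := hi.1; have := hi.2
  have hu : Un B (br q c d e) := hU _ _ _ om om om n1 n2 n3
  refine ⟨(0, c), (mem_zs hM).2 ⟨rfl, by simp only; omega, by simp only; omega⟩, ?_⟩
  rcases hD with hD | hD
  · refine ⟨_, hu, ?_⟩
    simp only [sp, xs, xz, hD, map_mul]; ring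
  · refine ⟨_, hu.neg, ?_⟩
    simp only [sp, xs, xz, hD, map_mul, map_neg]; ring
omit hq hU hB [Fintype τ] in
lemma rs_yl (i l : Ln) : rs (yl q i) (yl q l) = sp (xs q l i) := by
  simp only [rs, yl, sp, xs, Dl, map_sub, map_mul]
  ring
omit hU hB [Fintype τ] in
lemma sp_yl {a b : ℕ} (ha : a < M) (hb : b < M) : sp (yl q (a, b)) = br (ext q M) a b M := by
  simp only [sp, yl, br, dt, ext, if_true, ha.ne, hb.ne, if_false, hq.q0, hq.q1, hq.q2,
    cv0, cv1, cv, map_sub, map_mul, map_add,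
    map_zero, map_one, map_neg, rename_X]
  ring
omit hU hB [Fintype τ] in
lemma sp_xz {b : ℕ} (hM : 3 ≤ M) (hb : b < M) : up (sp (xz q (0, b))) = br (ext q M) 0 b M := by
  simp only [sp, xz, br, dt, ext, if_true, (show (0 : ℕ) ≠ M by omega), hb.ne, if_false, hq.q0,
    hq.q1, hq.q2,
    cv0, cv1, cv, map_sub, map_mul, map_add,
    map_zero, map_one, map_neg, rename_X]
  ring
lemma WW_good (hM : 3 ≤ M) : LGood (WW q M B) :=
  NS_good hB (mM.2 ⟨(0, 2), (mem_zs hM).2 (by simp; omega), xz02 hq⟩)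
lemma out_sum (hM : 3 ≤ M) (R : List Ln) : ∀ P : List Ln,
    (∀ i ∈ P ++ R, LV M i ∧ i.1 ≠ 0) → (P ++ R).Nodup →
    secSum (WW q M B) ((0, -1) :: P.map (yl q)) (R.map (yl q)) =
      ((out M P R).map (fun Ds => NN (B ++ Ds.map (Dl q)))).sum := by
  induction R with
  | nil => intro P _ _; simp [secSum, out]
  | cons l R ih =>
    intro P hv hn
    have hl := hv l sm
    have ih' := ih (P ++ [l]) (by simpa using hv) (by simpa using hn)
    simp only [mpC, secSum, out, mpA, List.sum_append]
    rw [mpA, List.map_singleton] at ih'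
    rw [cA, ih']
    congr 1
    have hPn : P.Nodup := (List.nodup_append.1 hn).1
    have hPv : ∀ i ∈ P, LV M i ∧ i.1 ≠ 0 := fun i hi => hv i (by simp [hi])
    have hne : ∀ i' ∈ P, i' ≠ l := by
      rintro i' hi' rfl
      rw [List.nodup_append] at hn
      exact hn.2.2 i' hi' i' sm rfl
    rw [← line_sum hq hU hB hM hl.1 hl.2 P hPv hPn]
    change NN (WW q M B ++ List.map (fun t => rs t (yl q l)) ((0, -1) :: P.map (yl q))) = _
    have hW : ∀ p ∈ WW q M B, p ∈ NS B ((zs M ++ P.filter (dj l)).map (xq q l)) := by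
      intro p hp
      rcases mA.1 hp with hp | hp
      · exact mL _ hp
      · refine mR _ ?_
        obtain ⟨s, hs, rfl⟩ := mM.1 hp
        obtain ⟨i, hi, rfl⟩ := mM.1 hs
        have hi0 := ((mem_zs hM).1 hi).1
        refine mMM (mM.2 ⟨i, mL _ hi, ?_⟩)
        simp [xq, hi0]
    have hWg := WW_good hq hU hB hM
    refine NN_congr (hWg.mono fun p hp => mL _ hp) (hWg.mono hW) ?_ ?_
    · intro p hp
      rcases mA.1 hp with hp | hp
      · exact Un.mem (hW p hp)
      · obtain ⟨s, hs, rfl⟩ := mM.1 hp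
        rcases mC.1 hs with rfl | hs
        · have := hl.1.1; have := hl.1.2; have := hl.2
          have hu : Un B (br q 0 l.1 l.2) :=
            hU _ _ _ om om om om om om
          refine (hu.up fun q hq => mL _ hq).congr ?_
          simp [rs, yl]
        · obtain ⟨i, hi, rfl⟩ := mM.1 hs
          rw [rs_yl]
          cases hd : dj l i with
          | true =>
            refine Un.mem (mR _ (mMM (mM.2 ⟨i,
              mR _ (mF.2 ⟨hi, hd⟩), ?_⟩)))
            simp [xq, (hPv i hi).2]
          | false =>
            obtain ⟨c, hc, u, hu, he⟩ := xs_sh hU hM hl.1 (hPv i hi).1 (hne i hi) hl.2 hd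
            rw [he]
            refine (hu.up fun q hq => mL _ hq).mul (Un.mem (hW _ ?_))
            exact mR _ (mMM (mMM hc))
    · intro p hp
      rcases mA.1 hp with hp | hp
      · exact Un.mem (mL _ (mL _ hp))
      · obtain ⟨s, hs, rfl⟩ := mM.1 hp
        obtain ⟨i, hi, rfl⟩ := mM.1 hs
        rcases mA.1 hi with hi | hi
        · have hi0 := ((mem_zs hM).1 hi).1
          refine Un.mem (mL _ (mR _ (mMM
            (mM.2 ⟨i, hi, ?_⟩))))
          simp [xq, hi0]
        · obtain ⟨hi, hd⟩ := mF.1 hi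
          refine Un.mem (mR _ (mM.2 ⟨yl q i,
            mCC _ (mMM hi), ?_⟩))
          rw [rs_yl]
          simp [xq, (hPv i hi).2]
lemma VV_good (hM : 3 ≤ M) : LGood (VV q M B) := by
  have key : ∀ a b : ℕ, a < b → b < M → br (ext q M) a b M ∈ VV q M B := by
    intro a b foo bar
    refine mR _ (mM.2 ⟨(a, b), ?_, rfl⟩)
    simp only [pairs, mF, mPr, mRg, decide_eq_true_eq]
    omega
  rintro (_ | _ | k)
  · have := key 1 2 om om
    rwa [← sp_yl hq om om, yl12 hq, show sp ((1, 0) : Sec (Option τ)) = X none by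
      simp [sp]] at this
  · have := key 0 2 om om
    rwa [← sp_xz hq hM om, xz02 hq, show up (sp ((1, 0) : Sec τ)) = X (some none) by
      simp [sp]] at this
  · exact mL _ (mM.2 ⟨X (some k), mM.2 ⟨_, hB k, by simp⟩,
      by simp⟩)
theorem fib (hM : 3 ≤ M) : NN (VV q M B) =
    ((fibT M).map (fun Ds => NN (B ++ Ds.map (Dl q)))).sum := by
  have hr : ∀ i, i ∈ (1, 2) :: rl M ↔ LV M i ∧ i.1 ≠ 0 := by
    rintro ⟨a, b⟩
    simp only [rl, mC, mF, mPr, mRg, LV,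
      Prod.mk.injEq, decide_eq_true_eq, ne_eq]
    omega
  have hn : ((1, 2) :: rl M).Nodup := by
    rw [List.nodup_cons]
    refine ⟨by simp [rl], List.Nodup.filter _ (List.Nodup.product List.nodup_range List.nodup_range)⟩
  have hWg := WW_good hq hU hB hM
  have hu : ∀ i ∈ (1, 2) :: rl M, Un B (br q 0 i.1 i.2) := by
    intro i hi
    obtain ⟨⟨foo, bar⟩, baz⟩ := (hr i).1 hi
    exact hU _ _ _ om om om om om om
  have e := out_sum hq hU hB hM (rl M) [(1, 2)] (fun i hi => (hr i).1 hi) hn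
  rw [fibT, ← e, List.map_singleton, yl12 hq]
  have e2 := NS_sum hWg ((rl M).map (yl q)) (S := S2) sm sm
    (secOK_of _ ?_)
  · rw [NS_base hWg, zero_add] at e2
    rw [← e2]
    refine NN_congr (VV_good hq hU hB hM) (NS_good hWg sm) ?_ ?_
    · intro p hp
      rcases mA.1 hp with hp | hp
      · obtain ⟨p', hp', rfl⟩ := mM.1 hp
        exact Un.mem (mL _ (mMM (mL _ hp')))
      · obtain ⟨⟨a, b⟩, hi, rfl⟩ := mM.1 hp
        simp only [pairs, mF, mPr, mRg, decide_eq_true_eq] at hi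
        simp only
        by_cases ha : a = 0
        · subst ha
          rw [← sp_xz hq hM om]
          exact Un.mem (mL _ (mMM (mR _
            (mMM (mMM ((mem_zs hM).2 ⟨rfl, by simp only; omega, by simp only; omega⟩))))))
        · rw [← sp_yl hq om om]
          have := (hr (a, b)).2 ⟨⟨by simp only; omega, by simp only; omega⟩, ha⟩
          rcases mC.1 this with h | h
          · rw [h, yl12 hq]
            exact Un.mem (mR _ (mMM sm))
          · exact Un.mem (mR _ (mMM (mR _
              (mMM h))))
    · have key : ∀ a b : ℕ, a < b → b < M → Un (VV q M B) (br (ext q M) a b M) := by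
        intro a b foo bar
        refine Un.mem (mR _ (mM.2 ⟨(a, b), ?_, rfl⟩))
        simp only [pairs, mF, mPr, mRg, decide_eq_true_eq]
        omega
      intro p hp
      rcases mA.1 hp with hp | hp
      · obtain ⟨p', hp', rfl⟩ := mM.1 hp
        rcases mA.1 hp' with hp' | hp'
        · exact Un.mem (mL _ (mMM hp'))
        · obtain ⟨s, hs, rfl⟩ := mM.1 hp'
          obtain ⟨⟨a, b⟩, hi, rfl⟩ := mM.1 hs
          obtain ⟨foo, bar, baz⟩ := (mem_zs hM).1 hi
          simp only at foo bar baz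
          subst foo
          rw [sp_xz hq hM baz]
          exact key _ _ om baz
      · obtain ⟨s, hs, rfl⟩ := mM.1 hp
        have h12 : (S2 : List (Sec (Option τ))) = (0, -1) :: [(1, 2)].map (yl q) := by
          rw [List.map_singleton, yl12 hq]
        rw [h12, cA, ← mpA] at hs
        rcases mC.1 hs with rfl | hs
        · exact Un.one.congr (by simp [sp])
        · obtain ⟨⟨a, b⟩, hi, rfl⟩ := mM.1 hs
          obtain ⟨⟨foo, bar⟩, baz⟩ := (hr _).1 hi
          simp only at foo bar baz
          rw [sp_yl hq (by omega : a < M) bar]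
          exact key _ _ foo bar
  · intro s hs
    obtain ⟨i, hi, rfl⟩ := mM.1 hs
    refine ⟨(0, -1), by simp, ?_⟩
    refine ((hu i (mCC _ hi)).up fun q hq => mL _ hq).congr ?_
    simp [rs, yl]
end fib
lemma d3_map {R S : Type} [CommRing R] [CommRing S] (φ : R →+* S) (a b c : Fin 3 → R) :
    φ (dt a b c) = dt (fun i => φ (a i)) (fun i => φ (b i)) (fun i => φ (c i)) := by
  simp only [dt, map_add, map_sub, map_mul]
lemma br_ext (q : Pts τ) {M a b c : ℕ} (ha : a < M) (hb : b < M) (hc : c < M) :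
    br (ext q M) a b c = up (up (br q a b c)) := by
  simp only [br, ext, if_neg ha.ne, if_neg hb.ne, if_neg hc.ne]
  simp only [dt, map_add, map_sub, map_mul]
lemma Dl_ext (q : Pts τ) {M : ℕ} {T : T3} (h : T.1.1 < M ∧ T.1.2 < M ∧ T.2.1.1 < M ∧ T.2.1.2 < M ∧
    T.2.2.1 < M ∧ T.2.2.2 < M) : Dl (ext q M) T = up (up (Dl q T)) := by
  obtain ⟨foo, bar, baz, box, h5, h6⟩ := h
  simp only [Dl, br_ext q foo baz box, br_ext q bar h5 h6, br_ext q bar baz box, br_ext q foo h5 h6,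
    map_sub, map_mul]
lemma Std.ext {q : Pts τ} (hq : Std q) {M : ℕ} (hM : 3 ≤ M) : Std (ext q M) := by
  refine ⟨?_, ?_, ?_⟩ <;>
  · funext i
    simp only [ML.ext, hq.q0, hq.q1, hq.q2]
    rw [if_neg om]
    fin_cases i <;> simp
lemma BrU_ext {q : Pts τ} {M : ℕ} {B : List (Zp τ)} (hU : BrU q M B) :
    BrU (ext q M) (M + 1) (VV q M B) := by
  have old : ∀ p, Un B p → Un (VV q M B) (up (up p)) := by
    intro p hp
    have : Un (B.map up) (up p) := hp.up fun q hq => hq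
    exact this.up fun q hq => mL _ hq
  have key : ∀ a b : ℕ, a < M → b < M → a ≠ b → Un (VV q M B) (br (ext q M) a b M) := by
    have key' : ∀ a b : ℕ, a < b → b < M → Un (VV q M B) (br (ext q M) a b M) := by
      intro a b foo bar
      refine Un.mem (mR _ (mM.2 ⟨(a, b), ?_, rfl⟩))
      simp only [pairs, mF, mPr, mRg, decide_eq_true_eq]
      omega
    intro a b foo bar baz
    rcases lt_or_gt_of_ne baz with h | h
    · exact key' a b h bar
    · rw [br_swap1]; exact (key' b a h foo).neg
  intro a b c ha hb hc foo bar baz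
  by_cases hcM : c = M
  · subst hcM; exact key _ _ om om foo
  by_cases hbM : b = M
  · subst hbM; rw [br_swap2]; exact (key _ _ om om bar).neg
  by_cases haM : a = M
  · subst haM; rw [br_swap1, br_swap2, neg_neg]; exact key _ _ om om baz
  rw [br_ext q om om om]
  exact old _ (hU _ _ _ om om om foo bar baz)
structure Twr (q : Pts τ) (M : ℕ) (B : List (Zp τ)) (c : τ → ℕ × Bool) : Prop where
  hM : 4 ≤ M
  std : Std q
  q3 : q 3 = ![1, 1, 1]
  hU : BrU q M B
  hB : LGood B
  mem : ∀ p ∈ B, ∃ a b c, a < M ∧ b < M ∧ c < M ∧ a ≠ b ∧ a ≠ c ∧ b ≠ c ∧ p = br q a b c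
  co : ∀ j, 4 ≤ j → j < M → ∃ k k', c k = (j, false) ∧ c k' = (j, true) ∧ q j = ![1, X k, X k']
  cX : ∀ k, 4 ≤ (c k).1 ∧ (c k).1 < M
  cX' : ∀ k, X k = q (c k).1 (if (c k).2 then 2 else 1)
def cext (c : τ → ℕ × Bool) (M : ℕ) : Option (Option τ) → ℕ × Bool
  | none => (M, true)
  | some none => (M, false)
  | some (some k) => c k
lemma Twr.ext [Fintype τ] {q : Pts τ} {M : ℕ} {B : List (Zp τ)} {c : τ → ℕ × Bool}
    (h : Twr q M B c) : Twr (ext q M) (M + 1) (VV q M B) (cext c M) := by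
  have hM := h.hM
  refine ⟨by omega, h.std.ext om, ?_, BrU_ext h.hU, VV_good h.std h.hU h.hB om,
    ?_, ?_, ?_, ?_⟩
  · funext i
    simp only [ML.ext, h.q3]
    rw [if_neg om]
    fin_cases i <;> simp
  · intro p hp
    rcases mA.1 hp with hp | hp
    · obtain ⟨p', hp', rfl⟩ := mM.1 hp
      obtain ⟨p'', hp'', rfl⟩ := mM.1 hp'
      obtain ⟨a, b, c, ha, hb, hc, foo, bar, baz, rfl⟩ := h.mem _ hp''
      exact ⟨a, b, c, by omega, by omega, by omega, foo, bar, baz, (br_ext q ha hb hc).symm⟩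
    · obtain ⟨⟨a, b⟩, hi, rfl⟩ := mM.1 hp
      simp only [pairs, mF, mPr, mRg, decide_eq_true_eq] at hi
      exact ⟨a, b, M, by omega, by omega, by omega, by omega, by omega, by omega, rfl⟩
  · intro j foo bar
    by_cases hj : j = M
    · subst hj
      exact ⟨some none, none, rfl, rfl, by simp [ML.ext]⟩
    · obtain ⟨k, k', hk, hk', e⟩ := h.co j foo om
      refine ⟨some (some k), some (some k'), hk, hk', ?_⟩
      funext i
      simp only [ML.ext, if_neg hj, e]
      fin_cases i <;> simp
  · rintro (_ | _ | k)
    · simp only [cext]; omega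
    · simp only [cext]; omega
    · have := h.cX k
      simp only [cext]; omega
  · rintro (_ | _ | k)
    · simp [cext, ML.ext]
    · simp [cext, ML.ext]
    · have foo := (h.cX k).2
      have bar : ML.ext q M (c k).1 = fun i => up (up (q (c k).1 i)) := by
        simp only [ML.ext]; rw [if_neg om]
      change X (some (some k)) = ML.ext q M (c k).1 (if (c k).2 then 2 else 1)
      rw [bar]
      simp only
      rw [← h.cX' k]
      simp
abbrev τ1 := Option (Option Empty)
abbrev τ2 := Option (Option τ1)
abbrev τ3 := Option (Option τ2)
abbrev τ4 := Option (Option τ3)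
def q4 : Pts Empty := fun a =>
  if a = 0 then ![0, 0, 1] else if a = 1 then ![0, -1, 0] else if a = 2 then ![1, 0, 0]
  else ![1, 1, 1]
def q5 : Pts τ1 := ext q4 4
def q6 : Pts τ2 := ext q5 5
def q7 : Pts τ3 := ext q6 6
def q8 : Pts τ4 := ext q7 7
def X4 : List (Zp Empty) := []
def X5 := VV q4 4 X4
def X6 := VV q5 5 X5
def X7 := VV q6 6 X6
def X8 := VV q7 7 X7
def c4 : Empty → ℕ × Bool := fun k => k.elim
def c5 := cext c4 4
def c6 := cext c5 5
def c7 := cext c6 6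
def c8 := cext c7 7
lemma tw4 : Twr q4 4 X4 c4 := by
  refine ⟨le_rfl, ⟨by simp [q4], by simp [q4], by simp [q4]⟩, by simp [q4], ?_, fun k => k.elim,
    by simp [X4], by intros; omega, fun k => k.elim, fun k => k.elim⟩
  intro a b c ha hb hc foo bar baz
  refine Un.of Un.one ?_
  interval_cases a <;> interval_cases b <;> first | omega | skip
  all_goals interval_cases c <;> first | omega | skip
  all_goals simp [br, dt, q4]
lemma tw5 : Twr q5 5 X5 c5 := tw4.ext
lemma tw6 : Twr q6 6 X6 c6 := tw5.ext
lemma tw7 : Twr q7 7 X7 c7 := tw6.ext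
lemma tw8 : Twr q8 8 X8 c8 := tw7.ext
lemma NN_X4 (L : List (Zp Empty)) (h : ∀ p ∈ L, Un [] p) : NN L = 1 := NN_empty L h
lemma NN_X5 : NN X5 = 2 := by
  have h := fib tw4.std tw4.hU tw4.hB om
  have e : fibT 4 = [[], []] := by decide
  rw [X5, h, show fibT 4 = List.replicate 2 [] from e]
  have : NN (X4 ++ ([] : List T3).map (Dl q4)) = 1 := NN_X4 _ (by simp [X4])
  simp only [List.map_replicate, this, List.sum_replicate]
  rfl
lemma NN_X6 : NN X6 = 26 := by
  have h := fib tw5.std tw5.hU tw5.hB om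
  have e : fibT 5 = List.replicate 13 [] := by decide
  rw [X6, h, e]
  have : NN (X5 ++ ([] : List T3).map (Dl q5)) = 2 := by simpa using NN_X5
  simp only [List.map_replicate, this, List.sum_replicate]
  rfl
def pT (π : Equiv.Perm ℕ) (T : T3) : T3 :=
  ((π T.1.1, π T.1.2), (π T.2.1.1, π T.2.1.2), (π T.2.2.1, π T.2.2.2))
def lab (M : ℕ) (T : T3) : Prop := T.1.1 < M ∧ T.1.2 < M ∧ T.2.1.1 < M ∧ T.2.1.2 < M ∧
    T.2.2.1 < M ∧ T.2.2.2 < M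
def eb (q : Pts τ) (z : τ → E) (a b c : ℕ) : E := ev z (br q a b c)
lemma eb_d3 (q : Pts τ) (z : τ → E) (a b c : ℕ) :
    eb q z a b c = dt (fun i => ev z (q a i)) (fun i => ev z (q b i)) (fun i => ev z (q c i)) :=
  d3_map (ev z) _ _ _
def ccA (q : Pts τ) (π : Equiv.Perm ℕ) (z : τ → E) : E := (eb q z (π 0) (π 1) (π 3))⁻¹
def ccB (q : Pts τ) (π : Equiv.Perm ℕ) (z : τ → E) : E := (eb q z (π 0) (π 2) (π 3))⁻¹
def ccC (q : Pts τ) (π : Equiv.Perm ℕ) (z : τ → E) : E := (eb q z (π 1) (π 2) (π 3))⁻¹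
def Th (q : Pts τ) (c : τ → ℕ × Bool) (π : Equiv.Perm ℕ) (z : τ → E) (k : τ) : E :=
  if (c k).2 then eb q z (π 1) (π 2) (π (c k).1) * ccC q π z *
    (eb q z (π 0) (π 1) (π (c k).1) * ccA q π z)⁻¹
  else eb q z (π 0) (π 2) (π (c k).1) * ccB q π z *
    (eb q z (π 0) (π 1) (π (c k).1) * ccA q π z)⁻¹
def tt (q : Pts τ) (π : Equiv.Perm ℕ) (z : τ → E) (a : ℕ) : E :=
  if a = 0 then eb q z (π 0) (π 1) (π 2) * ccC q π z
  else if a = 1 then eb q z (π 0) (π 1) (π 2) * ccB q π z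
  else if a = 2 then eb q z (π 0) (π 1) (π 2) * ccA q π z
  else eb q z (π 0) (π 1) (π a) * ccA q π z
def DD (q : Pts τ) (π : Equiv.Perm ℕ) (z : τ → E) : E :=
  ccA q π z * ccB q π z * ccC q π z * eb q z (π 0) (π 1) (π 2) ^ 2
lemma d3_gg {R : Type} [CommRing R] (α β γ u v w : Fin 3 → R) (A B C : R) :
    dt ![dt α β u * A, dt α γ u * B, dt β γ u * C] ![dt α β v * A, dt α γ v * B, dt β γ v * C]
      ![dt α β w * A, dt α γ w * B, dt β γ w * C] = A * B * C * dt α β γ ^ 2 * dt u v w := by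
  have key : dt ![dt α β u, dt α γ u, dt β γ u] ![dt α β v, dt α γ v, dt β γ v]
      ![dt α β w, dt α γ w, dt β γ w] = dt α β γ ^ 2 * dt u v w := by
    simp only [dt, cv0, cv1, cv]
    ring
  have : ∀ p q r : Fin 3 → R, dt ![p 0 * A, p 1 * B, p 2 * C] ![q 0 * A, q 1 * B, q 2 * C]
      ![r 0 * A, r 1 * B, r 2 * C] = A * B * C * dt p q r := by
    intro p q r
    simp only [dt, cv0, cv1, cv]
    ring
  have bar := this ![dt α β u, dt α γ u, dt β γ u] ![dt α β v, dt α γ v, dt β γ v]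
      ![dt α β w, dt α γ w, dt β γ w]
  rw [key] at bar
  simp only [cv0, cv1, cv] at bar
  rw [bar]; ring
lemma d3_smul {R : Type} [CommRing R] (a b c : Fin 3 → R) (x y w : R) :
    dt (fun i => x * a i) (fun i => y * b i) (fun i => w * c i) = x * y * w * dt a b c := by
  simp only [dt]; ring
section sym
variable {q : Pts τ} {M : ℕ} {B : List (Zp τ)} {c : τ → ℕ × Bool} (h : Twr q M B c)
  (π : Equiv.Perm ℕ) (hπ : ∀ a, a < M → π a < M)
include h hπ
lemma ueb {L : List (Zp τ)} (hL : ∀ p ∈ B, p ∈ L) {a b d : ℕ} (ha : a < M) (hb : b < M) (hc : d < M)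
    (foo : a ≠ b) (bar : a ≠ d) (baz : b ≠ d) :
    MonoL (PL L) L (fun z => eb q z (π a) (π b) (π d)) :=
  (h.hU _ _ _ (hπ _ ha) (hπ _ hb) (hπ _ hc) (π.injective.ne foo) (π.injective.ne bar)
    (π.injective.ne baz)).mono hL
lemma un_A {L : List (Zp τ)} (hL : ∀ p ∈ B, p ∈ L) : MonoL (PL L) L (ccA q π) :=
  have := h.hM
  Mono.inv (ueb h π hπ hL om om om om om om)
lemma un_B {L : List (Zp τ)} (hL : ∀ p ∈ B, p ∈ L) : MonoL (PL L) L (ccB q π) :=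
  have := h.hM
  Mono.inv (ueb h π hπ hL om om om om om om)
lemma un_C {L : List (Zp τ)} (hL : ∀ p ∈ B, p ∈ L) : MonoL (PL L) L (ccC q π) :=
  have := h.hM
  Mono.inv (ueb h π hπ hL om om om om om om)
lemma un_tt {L : List (Zp τ)} (hL : ∀ p ∈ B, p ∈ L) {a : ℕ} (ha : a < M) :
    MonoL (PL L) L (fun z => tt q π z a) := by
  have := h.hM
  have e := ueb h π hπ hL (a := 0) (b := 1) (d := 2)
    om om om om om om
  by_cases h0 : a = 0
  · simp only [tt, if_pos h0]; exact e.mul (un_C h π hπ hL)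
  by_cases foo : a = 1
  · simp only [tt, if_neg h0, if_pos foo]; exact e.mul (un_B h π hπ hL)
  by_cases bar : a = 2
  · simp only [tt, if_neg h0, if_neg foo, if_pos bar]; exact e.mul (un_A h π hπ hL)
  simp only [tt, if_neg h0, if_neg foo, if_neg bar]
  exact (ueb h π hπ hL om om om om om om).mul
    (un_A h π hπ hL)
lemma un_DD {L : List (Zp τ)} (hL : ∀ p ∈ B, p ∈ L) : MonoL (PL L) L (DD q π) := by
  have := h.hM
  have e := ueb h π hπ hL (a := 0) (b := 1) (d := 2)
    om om om om om om
  refine Mono.congr ((((un_A h π hπ hL).mul (un_B h π hπ hL)).mul (un_C h π hπ hL)).mul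
    (e.mul e)) fun z _ => ?_
  simp only [DD]; ring
lemma vec_eq {z : τ → E} (hz : PL B z) {a : ℕ} (ha : a < M) :
    ![dt (fun i => ev z (q (π 0) i)) (fun i => ev z (q (π 1) i)) (fun i => ev z (q (π a) i)) * ccA q π z,
      dt (fun i => ev z (q (π 0) i)) (fun i => ev z (q (π 2) i)) (fun i => ev z (q (π a) i)) * ccB q π z,
      dt (fun i => ev z (q (π 1) i)) (fun i => ev z (q (π 2) i)) (fun i => ev z (q (π a) i)) * ccC q π z]
     = fun i => tt q π z a * ev (Th q c π z) (q a i) := by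
  have hM := h.hM
  simp only [← eb_d3]
  have hA : eb q z (π 0) (π 1) (π 3) * ccA q π z = 1 := mul_inv'
    ((ueb h π hπ (fun _ h => h) om om om om om om).ne hz)
  have hB : eb q z (π 0) (π 2) (π 3) * ccB q π z = 1 := mul_inv'
    ((ueb h π hπ (fun _ h => h) om om om om om om).ne hz)
  have hC : eb q z (π 1) (π 2) (π 3) * ccC q π z = 1 := mul_inv'
    ((ueb h π hπ (fun _ h => h) om om om om om om).ne hz)
  have s1 : ∀ a b, eb q z a b a = 0 := fun a b => by simp [eb, br_aba]
  have s2 : ∀ a b, eb q z a b b = 0 := fun a b => by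
    rw [eb, br_swap1, br_aba]; simp
  have s3 : eb q z (π 0) (π 2) (π 1) = - eb q z (π 0) (π 1) (π 2) := by
    simp only [eb]; rw [br_swap2, map_neg]
  have s4 : eb q z (π 1) (π 2) (π 0) = eb q z (π 0) (π 1) (π 2) := by
    simp only [eb]; rw [br_swap2, br_swap1, neg_neg]
  by_cases h0 : a = 0
  · subst h0
    funext i
    simp only [h.std.q0, tt, if_true]
    fin_cases i <;> simp [s1, s4]
  by_cases foo : a = 1
  · subst foo
    funext i
    simp only [h.std.q1, tt, if_true]
    fin_cases i <;> simp [s1, s2, s3]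
  by_cases bar : a = 2
  · subst bar
    funext i
    simp only [h.std.q2, tt, if_true]
    fin_cases i <;> simp [s1, s2, s3]
  by_cases baz : a = 3
  · subst baz
    funext i
    simp only [h.q3, tt]
    fin_cases i <;> simp [hA, hB, hC]
  obtain ⟨k, k', hk, hk', e⟩ := h.co a om ha
  have hu : eb q z (π 0) (π 1) (π a) * ccA q π z * (eb q z (π 0) (π 1) (π a) * ccA q π z)⁻¹ = 1 :=
    mul_inv' (((ueb h π hπ (fun _ h => h) om om om om
      om om).mul (un_A h π hπ (fun _ h => h))).ne hz)
  funext i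
  simp only [e, tt, if_neg h0, if_neg foo, if_neg bar]
  fin_cases i
  · simp
  · simp only [Fin.mk_one, cv1, cv0, ev_X, Th, hk]
    simp only [Bool.false_eq_true, if_false]
    linear_combination (- eb q z (π 0) (π 2) (π a) * ccB q π z) * hu
  · simp only [Fin.reduceFinMk, cv, ev_X, Th, hk', if_true]
    linear_combination (- eb q z (π 1) (π 2) (π a) * ccC q π z) * hu
lemma eb_Th {z : τ → E} (hz : PL B z) {a b d : ℕ} (ha : a < M) (hb : b < M) (hd : d < M) :
    eb q (Th q c π z) a b d = DD q π z * ((tt q π z a)⁻¹ * (tt q π z b)⁻¹ * (tt q π z d)⁻¹) *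
      eb q z (π a) (π b) (π d) := by
  have e := d3_gg (fun i => ev z (q (π 0) i)) (fun i => ev z (q (π 1) i)) (fun i => ev z (q (π 2) i))
    (fun i => ev z (q (π a) i)) (fun i => ev z (q (π b) i)) (fun i => ev z (q (π d) i))
    (ccA q π z) (ccB q π z) (ccC q π z)
  rw [vec_eq h π hπ hz ha, vec_eq h π hπ hz hb, vec_eq h π hπ hz hd, d3_smul, ← eb_d3, ← eb_d3,
    ← eb_d3] at e
  have ua := mul_inv' ((un_tt h π hπ (fun _ h => h) ha).ne hz)
  have ub := mul_inv' ((un_tt h π hπ (fun _ h => h) hb).ne hz)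
  have ud := mul_inv' ((un_tt h π hπ (fun _ h => h) hd).ne hz)
  rw [DD]
  calc eb q (Th q c π z) a b d = (tt q π z a * (tt q π z a)⁻¹) * (tt q π z b * (tt q π z b)⁻¹) *
      (tt q π z d * (tt q π z d)⁻¹) * eb q (Th q c π z) a b d := by rw [ua, ub, ud]; ring
    _ = _ := by linear_combination ((tt q π z a)⁻¹ * (tt q π z b)⁻¹ * (tt q π z d)⁻¹) * e
lemma ed_Th {z : τ → E} (hz : PL B z) {T : T3} (hT : lab M T) :
    ev (Th q c π z) (Dl q T) = DD q π z ^ 2 * ((tt q π z T.1.1)⁻¹ * (tt q π z T.1.2)⁻¹ *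
     (tt q π z T.2.1.1)⁻¹ * (tt q π z T.2.1.2)⁻¹ * (tt q π z T.2.2.1)⁻¹ * (tt q π z T.2.2.2)⁻¹) *
      ev z (Dl q (pT π T)) := by
  obtain ⟨foo, bar, baz, box, h5, h6⟩ := hT
  have e : ∀ z (T : T3), ev z (Dl q T) = eb q z T.1.1 T.2.1.1 T.2.1.2 * eb q z T.1.2 T.2.2.1 T.2.2.2
    - eb q z T.1.2 T.2.1.1 T.2.1.2 * eb q z T.1.1 T.2.2.1 T.2.2.2 := by
    intro z T; simp only [Dl, map_sub, map_mul, eb]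
  rw [e, e, eb_Th h π hπ hz foo baz box, eb_Th h π hπ hz bar h5 h6, eb_Th h π hπ hz bar baz box,
    eb_Th h π hπ hz foo h5 h6]
  simp only [pT]
  ring
lemma Th_mono {𝒟 : List T3} (h𝒟 : ∀ T ∈ 𝒟, lab M T) :
    ∀ p ∈ B ++ 𝒟.map (Dl q), MonoL (PL (B ++ (𝒟.map (pT π)).map (Dl q)))
      (B ++ (𝒟.map (pT π)).map (Dl q)) (fun z => ev (Th q c π z) p) := by
  have hL : ∀ p ∈ B, p ∈ B ++ (𝒟.map (pT π)).map (Dl q) := fun p hp => mL _ hp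
  have hD := un_DD h π hπ hL
  have ht : ∀ a, a < M → MonoL (PL (B ++ (𝒟.map (pT π)).map (Dl q)))
      (B ++ (𝒟.map (pT π)).map (Dl q)) (fun z => (tt q π z a)⁻¹) := fun a ha =>
    (un_tt h π hπ hL ha).inv
  intro p hp
  rcases mA.1 hp with hp | hp
  · obtain ⟨a, b, d, ha, hb, hd, foo, bar, baz, rfl⟩ := h.mem p hp
    refine Mono.congr ((hD.mul (((ht a ha).mul (ht b hb)).mul (ht d hd))).mul
      (ueb h π hπ hL ha hb hd foo bar baz)) fun z hz => ?_
    exact eb_Th h π hπ (fun p hp => hz p (hL p hp)) ha hb hd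
  · obtain ⟨T, hT, rfl⟩ := mM.1 hp
    have hl := h𝒟 T hT
    have hm : Un (B ++ (𝒟.map (pT π)).map (Dl q)) (Dl q (pT π T)) :=
      Un.mem (mR _ (mMM (mMM hT)))
    obtain ⟨foo, bar, baz, box, h5, h6⟩ := id hl
    refine Mono.congr (((hD.mul hD).mul ((((((ht _ foo).mul (ht _ bar)).mul (ht _ baz)).mul
      (ht _ box)).mul (ht _ h5)).mul (ht _ h6))).mul hm) fun z hz => ?_
    rw [ed_Th h π hπ (fun p hp => hz p (hL p hp)) hl]
    ring
lemma quot_eq {n1 n2 n3 n4 w : E} (bar : n2.fst ≠ 0) (baz : n3.fst ≠ 0) (box : n4.fst ≠ 0)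
    (e : n1 * n4 = w * (n2 * n3)) : n1 * n2⁻¹ * (n3 * n4⁻¹)⁻¹ = w := by
  have h4' : (n4⁻¹).fst ≠ 0 := by rw [fst_inv']; exact inv_ne_zero box
  have a2 := mul_inv' bar
  have a4 := mul_inv' box
  have a3 : n3 * n4⁻¹ * (n3 * n4⁻¹)⁻¹ = 1 := mul_inv' (by
    rw [TrivSqZeroExt.fst_mul]; exact mul_ne_zero baz h4')
  have : n1 = w * n2 * n3 * n4⁻¹ := by linear_combination (n4⁻¹) * e - n1 * a4
  rw [this]
  linear_combination (w * n3 * n4⁻¹ * (n3 * n4⁻¹)⁻¹) * a2 + w * a3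
lemma Th_inv (hπ' : ∀ a, a < M → π.symm a < M) {z : τ → E} (hz : PL B z) :
    Th q c π.symm (Th q c π z) = z := by
  have hM := h.hM
  have hz' : PL B (Th q c π z) := by
    intro p hp
    have := Th_mono h π hπ (𝒟 := []) sm p (by simpa using hp)
    exact this.ne (by simpa using hz)
  have ne : ∀ a b d, a < M → b < M → d < M → a ≠ b → a ≠ d → b ≠ d →
      (eb q (Th q c π z) (π.symm a) (π.symm b) (π.symm d)).fst ≠ 0 := fun a b d foo bar baz box h5 h6 =>
    (ueb h π.symm hπ' (fun _ h => h) foo bar baz box h5 h6).ne hz'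
  have hh : ∀ a b d, a < M → b < M → d < M → eb q (Th q c π z) (π.symm a) (π.symm b) (π.symm d) =
      DD q π z * ((tt q π z (π.symm a))⁻¹ * (tt q π z (π.symm b))⁻¹ * (tt q π z (π.symm d))⁻¹) *
      eb q z a b d := by
    intro a b d foo bar baz
    have := eb_Th h π hπ hz (hπ' a foo) (hπ' b bar) (hπ' d baz)
    simpa using this
  have v013 : eb q z 0 1 3 = 1 := by simp [eb, br, dt, h.std.q0, h.std.q1, h.q3]
  have v023 : eb q z 0 2 3 = 1 := by simp [eb, br, dt, h.std.q0, h.std.q2, h.q3]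
  have v123 : eb q z 1 2 3 = 1 := by simp [eb, br, dt, h.std.q1, h.std.q2, h.q3]
  funext k
  obtain ⟨hk1, hk2⟩ := h.cX k
  have hX := h.cX' k
  obtain ⟨k1, k2, e1, e2, e3⟩ := h.co _ hk1 hk2
  have v01 : eb q z 0 1 (c k).1 = 1 := by simp [eb, br, dt, h.std.q0, h.std.q1, e3]
  rw [Th]
  split_ifs with hb
  · have w : eb q z 1 2 (c k).1 = z k := by
      rw [if_pos hb] at hX
      rw [← ev_X z k, hX]
      simp [eb, br, dt, h.std.q1, h.std.q2]
    refine quot_eq h π hπ (ne _ _ _ ?_ ?_ ?_ ?_ ?_ ?_) (ne _ _ _ ?_ ?_ ?_ ?_ ?_ ?_)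
      (ne _ _ _ ?_ ?_ ?_ ?_ ?_ ?_) ?_ <;> try omega
    rw [hh _ _ _ om om om, hh _ _ _ om om om,
      hh _ _ _ om om om, hh _ _ _ om om om,
      v013, v123, v01, w]
    ring
  · have w : eb q z 0 2 (c k).1 = z k := by
      rw [if_neg hb] at hX
      rw [← ev_X z k, hX]
      simp [eb, br, dt, h.std.q0, h.std.q2]
    refine quot_eq h π hπ (ne _ _ _ ?_ ?_ ?_ ?_ ?_ ?_) (ne _ _ _ ?_ ?_ ?_ ?_ ?_ ?_)
      (ne _ _ _ ?_ ?_ ?_ ?_ ?_ ?_) ?_ <;> try omega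
    rw [hh _ _ _ om om om, hh _ _ _ om om om,
      hh _ _ _ om om om, hh _ _ _ om om om,
      v013, v023, v01, w]
    ring
omit h hπ in
lemma Th_fst [Fintype τ] (z z' : τ → E) (hzz : ∀ k, (z k).fst = (z' k).fst) (k : τ) :
    (Th q c π z k).fst = (Th q c π z' k).fst := by
  have e : ∀ a b d, (eb q z a b d).fst = (eb q z' a b d).fst := fun a b d =>
    fst_ev_congr hzz _
  simp only [Th, ccA, ccB, ccC]
  split_ifs <;> simp only [TrivSqZeroExt.fst_mul, fst_inv', e]
theorem sym [Fintype τ] (hπ' : ∀ a, a < M → π.symm a < M) {𝒟 : List T3} (h𝒟 : ∀ T ∈ 𝒟, lab M T) :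
    NN (B ++ 𝒟.map (Dl q)) = NN (B ++ (𝒟.map (pT π)).map (Dl q)) := by
  have hg : ∀ L', LGood (B ++ L') := fun L' => h.hB.mono fun p hp => mL _ hp
  refine NN_iso (hg _) (hg _) (Th q c π.symm) (Th q c π) (Th_mono h π hπ h𝒟) ?_ ?_ ?_
    (Th_fst _) (Th_fst _)
  · have bar := Th_mono h π.symm hπ' (𝒟 := 𝒟.map (pT π)) (by
      intro T hT
      obtain ⟨T', hT', rfl⟩ := mM.1 hT
      obtain ⟨foo, bar, baz, box, h5, h6⟩ := h𝒟 T' hT'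
      exact ⟨hπ _ foo, hπ _ bar, hπ _ baz, hπ _ box, hπ _ h5, hπ _ h6⟩)
    have e : (𝒟.map (pT π)).map (pT π.symm) = 𝒟 := by
      rw [List.map_map]
      conv_rhs => rw [← List.map_id 𝒟]
      congr 1
      funext T
      simp [pT]
    rw [e] at bar
    exact bar
  · intro z hz
    have := Th_inv h π.symm hπ' hπ (z := z) (fun p hp => hz p (mL _ hp))
    simpa using this
  · intro z hz
    exact Th_inv h π hπ hπ' fun p hp => hz p (mL _ hp)
end sym
section graph
variable {q : Pts σ} {q' : Pts τ} {e : Option τ ≃ σ} {M : ℕ} {b c : Zp τ}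
def lam (c : Zp τ) (j : ℕ) : Zp τ := if j = 5 then c else 1
def lam' (c : Zp τ) (j : ℕ) : Zp τ := if j = 5 then 1 else c
lemma lam_mul (c : Zp τ) (j : ℕ) : lam' c j * lam c j = c := by
  simp only [lam, lam']; split_ifs <;> simp
variable (hj : ∀ j, j < M → ∀ i, gpoly e b c ∣ rho e (lam c j) * q j i - rho e (q' j i))
include hj
lemma graph_br {x y z : ℕ} (hx : x < M) (hy : y < M) (hz : z < M) :
    gpoly e b c ∣ rho e (lam c x * lam c y * lam c z) * br q x y z - rho e (br q' x y z) := by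
  have key : ∀ j, j < M → ∀ i, Ideal.Quotient.mk (Ideal.span {gpoly e b c}) (rho e (q' j i)) =
      Ideal.Quotient.mk (Ideal.span {gpoly e b c}) (rho e (lam c j)) *
      Ideal.Quotient.mk (Ideal.span {gpoly e b c}) (q j i) := by
    intro j h i
    rw [← map_mul, eq_comm, Ideal.Quotient.eq, Ideal.mem_span_singleton]
    exact hj j h i
  rw [← Ideal.mem_span_singleton, ← Ideal.Quotient.eq]
  have e1 : ∀ p, rho e p = (rho e).toRingHom p := fun _ => rfl
  rw [map_mul, br, d3_map, e1 (br q' x y z), br, d3_map, d3_map]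
  simp only [← e1, key x hx, key y hy, key z hz]
  rw [d3_smul]
  simp only [map_mul]
lemma graph_Dl {T : T3} (hT : lab M T) :
    gpoly e b c ∣ rho e (lam c T.1.1 * lam c T.1.2 * lam c T.2.1.1 * lam c T.2.1.2 * lam c T.2.2.1
      * lam c T.2.2.2) * Dl q T - rho e (Dl q' T) := by
  obtain ⟨foo, bar, baz, box, h5, h6⟩ := hT
  obtain ⟨u1, e1⟩ := graph_br hj foo baz box
  obtain ⟨u2, e2⟩ := graph_br hj bar h5 h6
  obtain ⟨u3, e3⟩ := graph_br hj bar baz box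
  obtain ⟨u4, e4⟩ := graph_br hj foo h5 h6
  simp only [Dl, map_sub, map_mul] at *
  set g := gpoly e b c
  refine ⟨u1 * (rho e (lam c T.1.2) * rho e (lam c T.2.2.1) * rho e (lam c T.2.2.2) *
    br q T.1.2 T.2.2.1 T.2.2.2) + rho e (br q' T.1.1 T.2.1.1 T.2.1.2) * u2
    - (u3 * (rho e (lam c T.1.1) * rho e (lam c T.2.2.1) * rho e (lam c T.2.2.2) *
    br q T.1.1 T.2.2.1 T.2.2.2) + rho e (br q' T.1.2 T.2.1.1 T.2.1.2) * u4), ?_⟩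
  linear_combination (rho e (lam c T.1.2) * rho e (lam c T.2.2.1) * rho e (lam c T.2.2.2) *
    br q T.1.2 T.2.2.1 T.2.2.2) * e1 + rho e (br q' T.1.1 T.2.1.1 T.2.1.2) * e2 -
    (rho e (lam c T.1.1) * rho e (lam c T.2.2.1) * rho e (lam c T.2.2.2) *
    br q T.1.1 T.2.2.1 T.2.2.2) * e3 - rho e (br q' T.1.2 T.2.1.1 T.2.1.2) * e4
theorem graph_T [Fintype τ] [Fintype σ] {B : List (Zp σ)} {B' : List (Zp τ)}
    (hB : LGood B) (hB' : LGood B') (hU : BrU q M B) (hU' : BrU q' M B')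
    (hc : Un B' c) (hc' : Un B (rho e c))
    (hm : ∀ p ∈ B, ∃ x y z, x < M ∧ y < M ∧ z < M ∧ x ≠ y ∧ x ≠ z ∧ y ≠ z ∧ p = br q x y z)
    (hm' : ∀ p ∈ B', ∃ x y z, x < M ∧ y < M ∧ z < M ∧ x ≠ y ∧ x ≠ z ∧ y ≠ z ∧
      (p = br q' x y z ∨ c * p = br q' x y z))
    {𝒟 : List T3} (h𝒟 : ∀ T ∈ 𝒟, lab M T) :
    NN (gpoly e b c :: (B ++ 𝒟.map (Dl q))) = NN (B ++ 𝒟.map (Dl q)) + NN (B' ++ 𝒟.map (Dl q')) := by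
  have hl : ∀ j, Un (B' ++ 𝒟.map (Dl q')) (lam' c j) := by
    intro j
    rw [lam']; split_ifs
    · exact Un.one
    · exact hc.mono fun p hp => mL _ hp
  have hl' : ∀ j, Un (B ++ 𝒟.map (Dl q)) (rho e (lam c j)) := by
    intro j
    rw [lam]; split_ifs
    · exact hc'.mono fun p hp => mL _ hp
    · rw [map_one]; exact Un.one
  have hcc : ∀ j, rho e (lam' c j) * rho e (lam c j) = rho e c := fun j => by
    rw [← map_mul, lam_mul]
  refine graph_add (hB.mono fun p hp => mL _ hp)
    (hB'.mono fun p hp => mL _ hp)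
    (hc.mono fun p hp => mL _ hp) ?_ ?_
  · intro p hp
    rcases mA.1 hp with hp | hp
    · obtain ⟨x, y, z, hx, hy, hz, foo, bar, baz, rfl⟩ := hm p hp
      obtain ⟨u, hu⟩ := graph_br hj hx hy hz
      refine ⟨3, lam' c x * lam' c y * lam' c z * br q' x y z,
        rho e (lam' c x * lam' c y * lam' c z) * u, ?_, ?_⟩
      · exact (((hl x).mul (hl y)).mul (hl z)).mul
          ((hU' x y z hx hy hz foo bar baz).mono fun p hp => mL _ hp)
      · have : rho e c ^ 3 = (rho e (lam' c x) * rho e (lam c x)) *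
          (rho e (lam' c y) * rho e (lam c y)) * (rho e (lam' c z) * rho e (lam c z)) := by
          rw [hcc, hcc, hcc]; ring
        rw [this]
        simp only [map_mul] at hu ⊢
        linear_combination (rho e (lam' c x) * rho e (lam' c y) * rho e (lam' c z)) * hu
    · obtain ⟨T, hT, rfl⟩ := mM.1 hp
      obtain ⟨u, hu⟩ := graph_Dl hj (h𝒟 T hT)
      refine ⟨6, lam' c T.1.1 * lam' c T.1.2 * lam' c T.2.1.1 * lam' c T.2.1.2 * lam' c T.2.2.1
        * lam' c T.2.2.2 * Dl q' T,
        rho e (lam' c T.1.1 * lam' c T.1.2 * lam' c T.2.1.1 * lam' c T.2.1.2 * lam' c T.2.2.1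
        * lam' c T.2.2.2) * u, ?_, ?_⟩
      · exact ((((((hl _).mul (hl _)).mul (hl _)).mul (hl _)).mul (hl _)).mul (hl _)).mul
          (Un.mem (mR _ (mMM hT)))
      · have : rho e c ^ 6 = (rho e (lam' c T.1.1) * rho e (lam c T.1.1)) *
          (rho e (lam' c T.1.2) * rho e (lam c T.1.2)) * (rho e (lam' c T.2.1.1) * rho e (lam c T.2.1.1))
           * (rho e (lam' c T.2.1.2) * rho e (lam c T.2.1.2)) *
          (rho e (lam' c T.2.2.1) * rho e (lam c T.2.2.1)) * (rho e (lam' c T.2.2.2) * rho e (lam c T.2.2.2)) := by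
          simp only [hcc]; ring
        rw [this]
        simp only [map_mul] at hu ⊢
        linear_combination (rho e (lam' c T.1.1) * rho e (lam' c T.1.2) * rho e (lam' c T.2.1.1)
          * rho e (lam' c T.2.1.2) * rho e (lam' c T.2.2.1) * rho e (lam' c T.2.2.2)) * hu
  · intro p hp
    rcases mA.1 hp with hp | hp
    · obtain ⟨x, y, z, hx, hy, hz, foo, bar, baz, hpe⟩ := hm' p hp
      obtain ⟨u, hu⟩ := graph_br hj hx hy hz
      have hg : Un (B ++ 𝒟.map (Dl q)) (rho e (lam c x * lam c y * lam c z) * br q x y z) := by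
        simp only [map_mul]
        exact (((hl' _).mul (hl' _)).mul (hl' _)).mul
          ((hU x y z hx hy hz foo bar baz).mono fun p hp => mL _ hp)
      rcases hpe with rfl | hpe
      · exact ⟨1, _, -u, Un.one, hg, by linear_combination -hu⟩
      · refine ⟨rho e c, _, -u, hc'.mono fun p hp => mL _ hp, hg, ?_⟩
        rw [← map_mul, hpe]
        linear_combination -hu
    · obtain ⟨T, hT, rfl⟩ := mM.1 hp
      obtain ⟨u, hu⟩ := graph_Dl hj (h𝒟 T hT)
      refine ⟨1, rho e (lam c T.1.1 * lam c T.1.2 * lam c T.2.1.1 * lam c T.2.1.2 * lam c T.2.2.1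
        * lam c T.2.2.2) * Dl q T, -u, Un.one, ?_, by linear_combination -hu⟩
      simp only [map_mul]
      exact ((((((hl' _).mul (hl' _)).mul (hl' _)).mul (hl' _)).mul (hl' _)).mul (hl' _)).mul
          (Un.mem (mR _ (mMM hT)))
end graph
lemma secSum_drop [Fintype τ] {B : List (Zp τ)} (hB : LGood B) {S R : List (Sec τ)}
    {s : Sec τ} (h : ∀ t ∈ S, Un B (rs t s)) :
    secSum B S (s :: R) = NN B + secSum B (S ++ [s]) R := by
  rw [secSum, NN_drop hB]
  intro p hp
  obtain ⟨t, ht, rfl⟩ := mM.1 hp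
  exact h t ht
lemma Un.int {L : List (Zp σ)} {p : Zp σ} (n : ℤ) (hn : n ≠ 0)
    (h : p = (n : Zp σ)) : Un L p := by
  refine (Un.const hn).congr (h.trans ?_)
  simp
lemma NN_repl [Fintype σ] {B L : List (Zp σ)} (hB : LGood B) (Q : Zp σ)
    (foo : ∀ p ∈ L, Un (Q :: B) p) (bar : Un (B ++ L) Q) : NN (B ++ L) = NN (Q :: B) := by
  refine NN_congr (hB.mono fun p hp => mL _ hp)
    (hB.mono fun p hp => mCC _ hp) ?_ ?_
  · intro p hp
    rcases mA.1 hp with hp | hp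
    · exact Un.mem (mCC _ hp)
    · exact foo p hp
  · intro p hp
    rcases mC.1 hp with rfl | hp
    · exact bar
    · exact Un.mem (mL _ hp)
abbrev tq : Zp (Option Empty) := X none
lemma hX4 : LGood X4 := fun k => k.elim
lemma NN_X4' : NN X4 = 1 := NN_X4 _ (by simp [X4])
lemma curve1 : NN [tq, tq - 1] = 1 := by
  have e : [tq, tq - 1] = [tq] ++ [tq - 1] := rfl
  have h := NS_sum hX4 (S := S2) [(1, 1)] sm sm (secOK_of _ (by
    intro s hs
    refine ⟨(0, -1), by simp, ?_⟩
    simp only [mC, nmn, or_false] at hs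
    subst hs
    exact Un.int 1 nn (by simp [rs])))
  rw [NS_base hX4, secSum_drop hX4, secSum, NN_X4', zero_add, add_zero] at h
  · rw [← h]
    refine NN_congr (by rintro (_ | k); · simp
                        · exact k.elim) (NS_good hX4 sm) ?_ ?_
    · intro p hp
      simp only [mC, nmn, or_false] at hp
      rcases hp with rfl | rfl
      · exact Un.mem (by simp [NS, sp])
      · exact Un.mem (by simp [NS, sp])
    · intro p hp
      simp only [NS, sp, X4, mpN, nA, cA, mpC, mC, nmn, or_false] at hp
      rcases hp with rfl | rfl | rfl
      · exact Un.int 1 nn sm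
      · exact (Un.mem (p := tq) sm).congr sm
      · exact (Un.mem (p := tq - 1) sm).congr sm
  · intro t ht
    simp only [mC, nmn, or_false] at ht
    rcases ht with rfl | rfl
    · exact Un.int 1 nn (by simp [rs])
    · exact Un.int 1 nn (by simp [rs])
lemma curve2 (m n : ℤ) (hm : m ≠ 0) (hn : n ≠ 0) (hmn : n - m ≠ 0) :
    NN [tq, tq - 1, C m * tq - C n] = 2 := by
  have u1 : ∀ t ∈ (S2 : List (Sec Empty)), Un X4 (rs t (1, 1)) := by
    intro t ht
    simp only [mC, nmn, or_false] at ht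
    rcases ht with rfl | rfl
    · exact Un.int 1 nn (by simp [rs])
    · exact Un.int 1 nn (by simp [rs])
  have u2 : ∀ t ∈ ([(0, -1), (1, 0), (1, 1)] : List (Sec Empty)), Un X4 (rs t (C m, C n)) := by
    intro t ht
    simp only [mC, nmn, or_false] at ht
    rcases ht with rfl | rfl | rfl
    · exact Un.int m hm (by simp [rs])
    · exact Un.int n hn (by simp [rs])
    · exact Un.int (n - m) hmn (by simp [rs])
  have h := NS_sum hX4 (S := S2) [(1, 1), (C m, C n)] sm sm (secOK_of _ (by
    intro s hs
    refine ⟨(0, -1), by simp, ?_⟩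
    simp only [mC, nmn, or_false] at hs
    rcases hs with rfl | rfl
    · exact u1 _ sm
    · exact u2 _ sm))
  rw [NS_base hX4, secSum_drop hX4 u1, secSum_drop hX4 (by simpa using u2), secSum, NN_X4', zero_add, add_zero] at h
  rw [show (2 : ℕ∞) = 1 + 1 by rfl, ← h]
  refine NN_congr (by rintro (_ | k); · simp
                      · exact k.elim) (NS_good hX4 sm) ?_ ?_
  · intro p hp
    simp only [mC, nmn, or_false] at hp
    rcases hp with rfl | rfl | rfl
    · exact Un.mem (by simp [NS, sp])
    · exact Un.mem (by simp [NS, sp])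
    · exact Un.mem (by simp [NS, sp])
  · intro p hp
    simp only [NS, sp, X4, mpN, nA, cA, mpC, mC, nmn, or_false] at hp
    rcases hp with rfl | rfl | rfl | rfl
    · exact Un.int 1 nn sm
    · exact (Un.mem (p := tq) sm).congr sm
    · exact (Un.mem (p := tq - 1) sm).congr sm
    · exact (Un.mem (p := C m * tq - C n) sm).congr sm
lemma curve3 : NN [tq ^ 2 - tq + 1, tq, tq - 1] = 3 := by
  have hG : LGood [tq, tq - 1] := by
    rintro (_ | k)
    · simp
    · exact k.elim
  obtain ⟨ξ, hξ⟩ := hG.good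
  obtain ⟨s, hs⟩ := exists_gen_complex (Fin [tq, tq - 1].length)
  have hd : ∀ z : Option Empty → ℂ, ev z (pderiv none (tq ^ 2 - tq + 1)) = 2 * z none - 1 := by
    intro z
    simp
    exact Or.inl (map_ofNat _ 2)
  have hne : ∀ w : ℂ, w ^ 2 - w + 1 = 0 → 2 * w - 1 ≠ 0 := by
    intro w hw h
    have : w = 1 / 2 := by linear_combination h / 2
    rw [this] at hw; norm_num at hw
  rw [NN_cons hG, add_HC hξ (s := s) ?_ hs]
  · change NN [tq, tq - 1] + _ = 3
    rw [curve1]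
    have e : HC (fl [tq, tq - 1]) (tq ^ 2 - tq + 1) s =
        {fun _ => (1 + Real.sqrt 3 * Complex.I) / 2, fun _ => (1 - Real.sqrt 3 * Complex.I) / 2} := by
      have baz : ((Real.sqrt 3 : ℝ) : ℂ) ^ 2 = 3 := by
        rw [← Complex.ofReal_pow, Real.sq_sqrt nn]; norm_num
      have hI := Complex.I_sq
      ext z
      have hz : ∀ w : ℂ, z = (fun _ => w) ↔ z none = w := by
        intro w
        constructor
        · intro h; rw [h]
        · intro h; funext k
          rcases k with _ | k
          · exact h
          · exact k.elim
      rw [Set.mem_insert_iff, Set.mem_singleton_iff, hz, hz]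
      constructor
      · rintro ⟨-, h, -⟩
        simp only [map_add, map_sub, map_pow, ev_X, map_one] at h
        have : (z none - (1 + Real.sqrt 3 * Complex.I) / 2) * (z none - (1 - Real.sqrt 3 * Complex.I) / 2) = 0 := by
          linear_combination h - 3 / 4 * hI - Complex.I ^ 2 / 4 * baz
        rcases mul_eq_zero.1 this with h | h
        · left; linear_combination h
        · right; linear_combination h
      · intro h
        have h0 : z none ^ 2 - z none + 1 = 0 := by
          rcases h with h | h
          · rw [h]; linear_combination 3 / 4 * hI + Complex.I ^ 2 / 4 * baz
          · rw [h]; linear_combination 3 / 4 * hI + Complex.I ^ 2 / 4 * baz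
        refine ⟨?_, by simpa using h0, ?_⟩
        · have : ∀ p ∈ [tq, tq - 1], ev z p ≠ 0 := by
            intro p hp
            simp only [mC, nmn, or_false] at hp
            rcases hp with rfl | rfl
            · rw [ev_X]; intro h; rw [h] at h0; norm_num at h0
            · rw [map_sub, map_one, ev_X]; intro h
              rw [sub_eq_zero.1 h] at h0; norm_num at h0
          exact fun i => this _ (gM _ _)
        · refine ⟨(∑ i, s i * ((ev z (fl [tq, tq - 1] i))⁻¹ * ev z (pderiv none (fl [tq, tq - 1] i)))) / (2 * z none - 1), ?_⟩
          rintro (_ | k)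
          · rw [hd, div_mul_cancel₀ _ (hne _ h0)]
          · exact k.elim
    rw [e, Set.encard_pair]
    · rfl
    · intro h
      have h' := congrFun h none
      have bar : (Real.sqrt 3 : ℂ) * Complex.I = 0 := by linear_combination h'
      rcases mul_eq_zero.1 bar with bar | bar
      · rw [Complex.ofReal_eq_zero, Real.sqrt_eq_zero nn] at bar
        norm_num at bar
      · exact Complex.I_ne_zero bar
  · intro z _ hz
    refine ⟨none, ?_⟩
    rw [hd]
    exact hne _ (by simpa using hz)
abbrev xa : Zp τ1 := X (some none)
abbrev yb : Zp τ1 := X none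
lemma X5_eq : X5 = [1, xa, xa - 1, yb, yb - 1, yb - xa] := by
  have e : pairs 4 = [(0, 1), (0, 2), (0, 3), (1, 2), (1, 3), (2, 3)] := by decide
  simp [X5, VV, e, X4, br, dt, ext, q4]
lemma fa5 {P : Zp τ1 → Prop} (foo : P 1) (bar : P xa) (baz : P (xa - 1)) (box : P yb)
    (h5 : P (yb - 1)) (h6 : P (yb - xa)) : ∀ p ∈ X5, P p := by
  intro p hp
  rw [X5_eq] at hp
  simp only [mC, nmn, or_false] at hp
  rcases hp with rfl | rfl | rfl | rfl | rfl | rfl <;> assumption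
lemma hX5 : LGood X5 := tw5.hB
lemma u_a : Un X5 xa := Un.mem (by rw [X5_eq]; simp)
lemma u_a1 : Un X5 (xa - 1) := Un.mem (by rw [X5_eq]; simp)
lemma u_b : Un X5 yb := Un.mem (by rw [X5_eq]; simp)
lemma u_b1 : Un X5 (yb - 1) := Un.mem (by rw [X5_eq]; simp)
lemma u_ba : Un X5 (yb - xa) := Un.mem (by rw [X5_eq]; simp)
lemma LG1 {L : List (Zp (Option Empty))} (h : tq ∈ L) : LGood L := by
  rintro (_ | k)
  · exact h
  · exact k.elim
lemma rho_t : rho (Equiv.refl (Option (Option Empty))) tq = xa := by simp [rho]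
lemma surf1 : NN ((yb - xa - xa * yb) :: X5) = 4 := by
  have hg : gpoly (Equiv.refl (Option (Option Empty))) tq (1 - tq) = yb - xa - xa * yb := by
    rw [gpoly, map_sub, map_one, rho_t]
    simp only [Equiv.refl_apply]
    ring
  have hL : LGood [tq, tq - 1, C 2 * tq - C 1] := LG1 sm
  have u1 : Un [tq, tq - 1, C 2 * tq - C 1] tq := Un.mem sm
  have u2 : Un [tq, tq - 1, C 2 * tq - C 1] (tq - 1) := Un.mem sm
  have u3 : Un [tq, tq - 1, C 2 * tq - C 1] (C 2 * tq - C 1) := Un.mem sm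
  have bar : (rho (Equiv.refl (Option (Option Empty)))) (C 2) = 2 := by
    simp only [rho, rename_C]; rfl
  have foo : (rho (Equiv.refl (Option (Option Empty)))) (C 1) = 1 := by simp [rho]
  rw [← hg, graph_add hX5 hL (u2.neg.congr (by ring)) ?_ ?_, NN_X5, curve2 2 1 nn nn nn]
  · rfl
  · rw [hg]
    apply fa5
    · exact ⟨0, 1, 0, Un.one, by simp⟩
    · exact ⟨0, tq, 0, u1, by rw [rho_t]; ring⟩
    · exact ⟨0, tq - 1, 0, u2, by simp only [map_sub, map_one, rho_t]; ring⟩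
    · exact ⟨1, tq, 1, u1, by simp only [map_sub, map_one, rho_t]; ring⟩
    · exact ⟨1, C 2 * tq - C 1, 1, u3, by simp only [map_sub, map_mul, map_one, rho_t, foo, bar]; ring⟩
    · exact ⟨1, tq * tq, 1, u1.mul u1, by simp only [map_sub, map_mul, map_one, rho_t]; ring⟩
  · rw [hg]
    intro p hp
    simp only [mC, nmn, or_false] at hp
    rcases hp with rfl | rfl | rfl
    · exact ⟨1, xa, 0, Un.one, u_a, by rw [rho_t]; ring⟩
    · exact ⟨1, xa - 1, 0, Un.one, u_a1, by rw [map_sub, map_one, rho_t]; ring⟩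
    · exact ⟨1, -((xa - 1) * (yb - 1)), -1, Un.one, (u_a1.mul u_b1).neg,
        by simp only [map_sub, map_mul, map_one, rho_t, foo, bar]; ring⟩
lemma surf2 : NN ((yb - xa + xa * yb) :: X5) = 4 := by
  have hg : gpoly (Equiv.refl (Option (Option Empty))) tq (1 + tq) = yb - xa + xa * yb := by
    rw [gpoly, map_add, map_one, rho_t]
    simp only [Equiv.refl_apply]
    ring
  have hL : LGood [tq, tq - 1, C 1 * tq - C (-1)] := LG1 sm
  have u1 : Un [tq, tq - 1, C 1 * tq - C (-1)] tq := Un.mem sm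
  have u2 : Un [tq, tq - 1, C 1 * tq - C (-1)] (tq - 1) := Un.mem sm
  have u3 : Un [tq, tq - 1, C 1 * tq - C (-1)] (C 1 * tq - C (-1)) := Un.mem sm
  have bar : (rho (Equiv.refl (Option (Option Empty)))) (C (-1)) = -1 := by simp [rho]
  have foo : (rho (Equiv.refl (Option (Option Empty)))) (C 1) = 1 := by simp [rho]
  rw [← hg, graph_add hX5 hL (u3.congr (by simp; ring)) ?_ ?_, NN_X5, curve2 1 (-1) nn nn nn]
  · rfl
  · rw [hg]
    apply fa5
    · exact ⟨0, 1, 0, Un.one, by simp⟩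
    · exact ⟨0, tq, 0, u1, by rw [rho_t]; ring⟩
    · exact ⟨0, tq - 1, 0, u2, by simp only [map_sub, map_one, rho_t]; ring⟩
    · exact ⟨1, tq, 1, u1, by rw [map_add, map_one, rho_t]; ring⟩
    · exact ⟨1, -1, 1, Un.one.neg, by simp only [map_add, map_neg, map_mul, map_one, rho_t]; ring⟩
    · exact ⟨1, -(tq * tq), 1, (u1.mul u1).neg, by simp only [map_add, map_neg, map_mul, map_one, rho_t]; ring⟩
  · rw [hg]
    intro p hp
    simp only [mC, nmn, or_false] at hp
    rcases hp with rfl | rfl | rfl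
    · exact ⟨1, xa, 0, Un.one, u_a, by rw [rho_t]; ring⟩
    · exact ⟨1, xa - 1, 0, Un.one, u_a1, by rw [map_sub, map_one, rho_t]; ring⟩
    · exact ⟨yb, xa, 1, u_b, u_a, by simp only [map_sub, map_mul, map_one, rho_t, foo, bar]; ring⟩
lemma surf3 : NN ((yb ^ 2 - yb + xa) :: X5) = 5 := by
  set e : Option (Option Empty) ≃ τ1 := Equiv.swap none (some none) with he
  have rt : rho e tq = yb := by
    simp only [rho, rename_X, he, Equiv.swap_apply_right]
  have hg : gpoly e (tq - tq ^ 2) 1 = yb ^ 2 - yb + xa := by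
    rw [gpoly, map_sub, map_pow, map_one, rt, he, Equiv.swap_apply_left]
    ring
  have hL : LGood [tq ^ 2 - tq + 1, tq, tq - 1] := LG1 sm
  have u1 : Un [tq ^ 2 - tq + 1, tq, tq - 1] tq := Un.mem sm
  have u2 : Un [tq ^ 2 - tq + 1, tq, tq - 1] (tq - 1) := Un.mem sm
  have u3 : Un [tq ^ 2 - tq + 1, tq, tq - 1] (tq ^ 2 - tq + 1) := Un.mem sm
  rw [← hg, graph_add hX5 hL Un.one ?_ ?_, NN_X5, curve3]
  · rfl
  · rw [hg]
    apply fa5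
    · exact ⟨0, 1, 0, Un.one, by simp⟩
    · exact ⟨0, -(tq * (tq - 1)), 1, (u1.mul u2).neg, by simp only [map_sub, map_neg, map_mul, map_one, rt]; ring⟩
    · exact ⟨0, -(tq ^ 2 - tq + 1), 1, u3.neg, by
        simp only [map_sub, map_neg, map_add, map_pow, map_mul, map_one, rt]; ring⟩
    · exact ⟨0, tq, 0, u1, by rw [rt]; ring⟩
    · exact ⟨0, tq - 1, 0, u2, by rw [map_sub, map_one, rt]; ring⟩
    · exact ⟨0, tq * tq, -1, u1.mul u1, by simp only [map_mul, rt]; ring⟩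
  · rw [hg]
    intro p hp
    simp only [mC, nmn, or_false] at hp
    rcases hp with rfl | rfl | rfl
    · exact ⟨1, -(xa - 1), 1, Un.one, u_a1.neg, by
        simp only [map_sub, map_add, map_pow, map_one, rt]; ring⟩
    · exact ⟨1, yb, 0, Un.one, u_b, by rw [rt]; ring⟩
    · exact ⟨1, yb - 1, 0, Un.one, u_b1, by rw [map_sub, map_one, rt]; ring⟩
lemma surf4 : NN (X5 ++ [xa + 1, yb + 1]) = 6 := by
  let B := [tq, tq - 1, C 1 * tq - C (-1)]
  have hB : LGood B := LG1 (by simp [B])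
  have hBv : NN B = 2 := curve2 1 (-1) nn nn nn
  have u1 : Un B tq := Un.mem (by simp [B])
  have u2 : Un B (tq - 1) := Un.mem (by simp [B])
  have u3 : Un B (tq + 1) := (Un.mem (p := C 1 * tq - C (-1)) (by simp [B])).congr sm
  have v1 : ∀ t ∈ (S2 : List (Sec (Option Empty))), Un B (rs t (1, 1)) := by
    intro t ht
    simp only [mC, nmn, or_false] at ht
    rcases ht with rfl | rfl
    · exact Un.one.congr (by simp [rs])
    · exact Un.one.congr (by simp [rs])
  have v2 : ∀ t ∈ ([(0, -1), (1, 0), (1, 1)] : List (Sec (Option Empty))), Un B (rs t (1, tq)) := by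
    intro t ht
    simp only [mC, nmn, or_false] at ht
    rcases ht with rfl | rfl | rfl
    · exact Un.one.congr (by simp [rs])
    · exact u1.congr (by simp [rs])
    · exact u2.congr (by simp [rs])
  have v3 : ∀ t ∈ ([(0, -1), (1, 0), (1, 1), (1, tq)] : List (Sec (Option Empty))), Un B (rs t (1, -1)) := by
    intro t ht
    simp only [mC, nmn, or_false] at ht
    rcases ht with rfl | rfl | rfl | rfl
    · exact Un.one.congr (by simp [rs])
    · exact Un.one.neg.congr (by simp [rs])
    · exact Un.int (-2) nn (by simp [rs]; norm_num)
    · exact u3.neg.congr (by simp [rs]; ring)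
  have h := NS_sum hB (S := S2) [(1, 1), (1, tq), (1, -1)] sm sm
    (secOK_of _ (by
    intro s hs
    refine ⟨(0, -1), by simp, ?_⟩
    simp only [mC, nmn, or_false] at hs
    rcases hs with rfl | rfl | rfl
    · exact v1 _ sm
    · exact v2 _ sm
    · exact v3 _ sm))
  rw [NS_base hB, secSum_drop hB v1, secSum_drop hB (by simpa using v2),
    secSum_drop hB (by simpa using v3), secSum, hBv, zero_add, add_zero] at h
  rw [show (6 : ℕ∞) = 2 + (2 + 2) by rfl, ← h]
  refine NN_congr (hX5.mono fun p hp => mL _ hp) (NS_good hB sm) ?_ ?_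
  · have w1 : ∀ p ∈ X5, Un (NS B [(0, -1), (1, 0), (1, 1), (1, tq), (1, -1)]) p := by
      apply fa5
      · exact Un.one
      · exact Un.mem (by simp [NS, sp, B])
      · exact Un.mem (by simp [NS, sp, B])
      · exact Un.mem (by simp [NS, sp, B])
      · exact Un.mem (by simp [NS, sp, B])
      · exact Un.mem (by simp [NS, sp, B])
    intro p hp
    rcases mA.1 hp with hp | hp
    · exact w1 p hp
    · simp only [mC, nmn, or_false] at hp
      rcases hp with rfl | rfl
      · exact Un.mem (by simp [NS, sp, B])
      · exact Un.mem (by simp [NS, sp, B])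
  · have a1 : ∀ {p}, Un X5 p → Un (X5 ++ [xa + 1, yb + 1]) p := fun h =>
      h.mono fun p hp => mL _ hp
    intro p hp
    simp only [NS, sp, B, cA, nA, mpN, mpC, mC, nmn, or_false] at hp
    rcases hp with rfl | rfl | rfl | rfl | rfl | rfl | rfl | rfl
    · exact (a1 u_a).congr sm
    · exact (a1 u_a1).congr sm
    · exact (Un.mem (p := xa + 1) sm).congr sm
    · exact Un.one.congr sm
    · exact (a1 u_b).congr sm
    · exact (a1 u_b1).congr sm
    · exact (a1 u_ba).congr sm
    · exact (Un.mem (p := yb + 1) sm).congr sm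
abbrev τd := Option τ1
abbrev Ad : Zp τd := up xa
abbrev Bd : Zp τd := up yb
abbrev xd : Zp τd := X none
def qd : Pts τd := fun j =>
  if j = 5 then ![Ad, Ad * xd, Ad + Bd * (xd - 1)] else fun i => up (q5 j i)
def D6 : List (Zp τd) := xd :: (X5.map up ++ (pairs 5).map (fun p => br qd p.1 p.2 5))
lemma br_qd {a b c : ℕ} (ha : a < 5) (hb : b < 5) (hc : c < 5) : br qd a b c = up (br q5 a b c) := by
  simp only [br, qd, if_neg ha.ne, if_neg hb.ne, if_neg hc.ne]
  simp only [dt, map_add, map_sub, map_mul]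
lemma qd0 : qd 0 = ![0, 0, 1] := by
  funext i; fin_cases i <;> simp [qd, q5, ext, q4]
lemma qd1 : qd 1 = ![0, -1, 0] := by
  funext i; fin_cases i <;> simp [qd, q5, ext, q4]
lemma qd2 : qd 2 = ![1, 0, 0] := by
  funext i; fin_cases i <;> simp [qd, q5, ext, q4]
lemma qd3 : qd 3 = ![1, 1, 1] := by
  funext i; fin_cases i <;> simp [qd, q5, ext, q4]
lemma qd4 : qd 4 = ![1, Ad, Bd] := by
  funext i; fin_cases i <;> simp [qd, q5, ext, Ad, Bd]
lemma qd5 : qd 5 = ![Ad, Ad * xd, Ad + Bd * (xd - 1)] := by simp [qd]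
lemma qdStd : Std qd := ⟨qd0, qd1, qd2⟩
lemma qdU : BrU qd 6 D6 := by
  have old : ∀ p, Un X5 p → Un D6 (up p) := by
    intro p hp
    exact hp.up fun q hq => mCC _ (mL _ hq)
  have key : ∀ a b : ℕ, a < 5 → b < 5 → a ≠ b → Un D6 (br qd a b 5) := by
    have key' : ∀ a b : ℕ, a < b → b < 5 → Un D6 (br qd a b 5) := by
      intro a b foo bar
      refine Un.mem (mCC _ (mR _ (mM.2 ⟨(a, b), ?_, rfl⟩)))
      simp only [pairs, mF, mPr, mRg, decide_eq_true_eq]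
      omega
    intro a b foo bar baz
    rcases lt_or_gt_of_ne baz with h | h
    · exact key' a b h bar
    · rw [br_swap1]; exact (key' b a h foo).neg
  intro a b c ha hb hc foo bar baz
  by_cases hcM : c = 5
  · subst hcM; exact key _ _ om om foo
  by_cases hbM : b = 5
  · subst hbM; rw [br_swap2]; exact (key _ _ om om bar).neg
  by_cases haM : a = 5
  · subst haM; rw [br_swap1, br_swap2, neg_neg]; exact key _ _ om om baz
  rw [br_qd om om om]
  exact old _ (tw5.hU _ _ _ om om om foo bar baz)
lemma hD6 : LGood D6 := by
  rintro (_ | k)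
  · exact mCS
  · refine mCC _ (mL _ (mM.2 ⟨X k, hX5 k, ?_⟩))
    simp
lemma D6_mem : ∀ p ∈ D6, ∃ x y z, x < 6 ∧ y < 6 ∧ z < 6 ∧ x ≠ y ∧ x ≠ z ∧ y ≠ z ∧
      (p = br qd x y z ∨ Ad * p = br qd x y z) := by
  intro p hp
  rcases mC.1 hp with rfl | hp
  · refine ⟨0, 2, 5, by omega, by omega, by omega, by omega, by omega, by omega, Or.inr ?_⟩
    simp [br, dt, qd0, qd2, qd5]
  rcases mA.1 hp with hp | hp
  · obtain ⟨p', hp', rfl⟩ := mM.1 hp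
    obtain ⟨a, b, c, ha, hb, hc, foo, bar, baz, rfl⟩ := tw5.mem _ hp'
    exact ⟨a, b, c, by omega, by omega, by omega, foo, bar, baz, Or.inl (br_qd ha hb hc).symm⟩
  · obtain ⟨⟨a, b⟩, hi, rfl⟩ := mM.1 hp
    simp only [pairs, mF, mPr, mRg, decide_eq_true_eq] at hi
    exact ⟨a, b, 5, by omega, by omega, by omega, by omega, by omega, by omega, Or.inl rfl⟩
lemma pairs5 : pairs 5 = [(0, 1), (0, 2), (0, 3), (0, 4), (1, 2), (1, 3), (1, 4), (2, 3), (2, 4), (3, 4)] := by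
  decide
lemma D6_eq : D6 = xd :: (X5.map up ++ [Ad, Ad * xd, Ad * (xd - 1), Ad * (xd - Ad), Ad + Bd * (xd - 1),
    Bd * (xd - 1), Bd * xd - (Bd + Ad * Bd - Ad), (Bd - Ad) * (xd - 1), Ad * (Ad - Bd),
    (Ad - Bd) * (xd - 1)]) := by
  rw [D6, pairs5]
  simp only [mpC, mpN, br, dt, qd0, qd1, qd2, qd3, qd4, qd5, cv0,
    cv1, cv]
  congr 2
  simp only [List.cons.injEq, and_true]
  refine ⟨?_, ?_, ?_, ?_, ?_, ?_, ?_, ?_, ?_, ?_⟩ <;> ring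
def Sd : List (Sec τ1) := [(1, 1), (1, xa), (yb, yb - xa), (yb, yb + xa * yb - xa)]
lemma D6_NS (R : List (Sec τ1)) (L : List (Zp τd))
    (foo : ∀ p ∈ L, ∃ s ∈ R, ∃ u, Un X5 u ∧ p = up u * sp s)
    (bar : ∀ s ∈ R, ∃ p ∈ L, ∃ u, Un X5 u ∧ p = up u * sp s) :
    NN (D6 ++ L) = NN (NS X5 (S2 ++ (Sd ++ R))) := by
  have gN : LGood (NS X5 (S2 ++ (Sd ++ R))) := NS_good hX5 sm
  have gD : LGood (D6 ++ L) := hD6.mono fun p hp => mL _ hp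
  have uN : ∀ {p}, Un X5 p → Un (NS X5 (S2 ++ (Sd ++ R))) (up p) := fun h =>
    h.up fun q hq => mL _ hq
  have uD : ∀ {p}, Un X5 p → Un (D6 ++ L) (up p) := fun h =>
    h.up fun q hq => mL _ (mCC _ (mL _ hq))
  have sN : ∀ s ∈ (S2 ++ (Sd ++ R)), Un (NS X5 (S2 ++ (Sd ++ R))) (sp s) := by
    intro s hs
    exact Un.mem (mR _ (mMM hs))
  have t1 : Un (NS X5 (S2 ++ (Sd ++ R))) xd := (sN (1, 0) sm).congr (by simp [sp])
  have t2 : Un (NS X5 (S2 ++ (Sd ++ R))) (xd - 1) :=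
    (sN (1, 1) (by simp [Sd])).congr (by simp [sp])
  have t3 : Un (NS X5 (S2 ++ (Sd ++ R))) (xd - Ad) :=
    (sN (1, xa) (by simp [Sd])).congr (by simp [sp])
  have t4 : Un (NS X5 (S2 ++ (Sd ++ R))) (Ad + Bd * (xd - 1)) :=
    (sN (yb, yb - xa) (by simp [Sd])).congr (by simp only [sp, map_sub]; ring)
  have t5 : Un (NS X5 (S2 ++ (Sd ++ R))) (Bd * xd - (Bd + Ad * Bd - Ad)) :=
    (sN (yb, yb + xa * yb - xa) (by simp [Sd])).congr (by simp only [sp, map_sub, map_add, map_mul])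
  have dd : ∀ P : Zp τd → Prop, (∀ p ∈ D6, P p) → P xd ∧ P (Ad * (xd - 1)) ∧
      P (Ad * (xd - Ad)) ∧ P (Ad + Bd * (xd - 1)) ∧ P (Bd * xd - (Bd + Ad * Bd - Ad)) := by
    intro P hP
    rw [D6_eq] at hP
    simp only [fmC, fmA] at hP
    obtain ⟨d1, -, -, -, d4, d5, d6, -, d8, -⟩ := hP
    exact ⟨d1, d4, d5, d6, d8⟩
  obtain ⟨d1, d4, d5, d6, d8⟩ := dd _ fun p hp => (Un.mem (mL L hp))
  have mD : ∀ p ∈ D6, Un (NS X5 (S2 ++ (Sd ++ R))) p := by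
    rw [D6_eq]
    simp only [fmC, fmA]
    have ba : Un (NS X5 (S2 ++ (Sd ++ R))) (Bd - Ad) := (uN u_ba).congr sm
    have ab : Un (NS X5 (S2 ++ (Sd ++ R))) (Ad - Bd) := ba.neg.congr (by ring)
    have a := uN u_a
    have b := uN u_b
    refine ⟨t1, fun p hp => Un.mem (mL _ hp), a, a.mul t1, a.mul t2, a.mul t3, t4,
      b.mul t2, t5, ba.mul t2, a.mul ab, ab.mul t2, by simp⟩
  refine NN_congr gD gN ?_ ?_
  · intro p hp
    rcases mA.1 hp with hp | hp
    · exact mD p hp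
    · obtain ⟨s, hs, u, hu, rfl⟩ := foo p hp
      exact (uN hu).mul (sN s (by simp [hs]))
  · intro p hp
    rcases mA.1 hp with hp | hp
    · exact Un.mem (mL _ (mCC _ (mL _ hp)))
    · obtain ⟨s, hs, rfl⟩ := mM.1 hp
      rcases mA.1 hs with hs | hs
      · simp only [mC, nmn, or_false] at hs
        rcases hs with rfl | rfl
        · exact Un.one.congr (by simp [sp])
        · exact d1.congr (by simp [sp])
      rcases mA.1 hs with hs | hs
      · simp only [Sd, mC, nmn, or_false] at hs
        rcases hs with rfl | rfl | rfl | rfl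
        · exact (Un.div d4 (uD u_a) rfl).congr (by simp [sp])
        · exact (Un.div d5 (uD u_a) rfl).congr (by simp [sp])
        · exact d6.congr (by simp only [sp, map_sub]; ring)
        · exact d8.congr (by simp only [sp, map_sub, map_add, map_mul])
      · obtain ⟨p, hp, u, hu, he⟩ := bar s hs
        exact Un.div (Un.mem (mR _ hp)) (uD hu) he
lemma secSum_repl {B : List (Zp τ1)} (hB : LGood B) {S R : List (Sec τ1)}
    {s : Sec τ1} (Q : Zp τ1) (foo : ∀ t ∈ S, Un (Q :: B) (rs t s))
    (bar : ∃ t ∈ S, ∃ u, Un B u ∧ rs t s = u * Q) :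
    secSum B S (s :: R) = NN (Q :: B) + secSum B (S ++ [s]) R := by
  rw [secSum, NN_repl hB Q]
  · intro p hp
    obtain ⟨t, ht, rfl⟩ := mM.1 hp
    exact foo t ht
  · obtain ⟨t, ht, u, hu, he⟩ := bar
    exact Un.div (Un.mem (mR _ (mM.2 ⟨t, ht, rfl⟩)))
      (hu.mono fun p hp => mL _ hp) he
lemma sum_D6 (R : List (Sec τ1)) (hR : ∀ s ∈ R, Un X5 s.1) :
    NN (NS X5 (S2 ++ (Sd ++ R))) = 12 + secSum X5 (S2 ++ Sd) R := by
  rw [NS_sum hX5 (S := S2) (Sd ++ R) sm sm, NS_base hX5, zero_add, Sd]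
  · simp only [cA, nA]
    rw [secSum_drop hX5, secSum_drop hX5, secSum_repl hX5 (yb - xa - xa * yb), secSum_repl hX5 (yb - xa + xa * yb),
      NN_X5, surf1, surf2]
    · simp only [cA, nA, ← add_assoc]
      rfl
    · simp only [cA, nA, fmC]
      have m : ∀ {p}, Un X5 p → Un ((yb - xa + xa * yb) :: X5) p :=
        fun h => h.mono fun p hp => mCC _ hp
      refine ⟨(m u_b).congr (by simp [rs]), ?_, (m (u_a.mul u_b1)).congr (by simp [rs]; ring),
        (m u_ba).congr (by simp [rs]; ring), (m (u_a.mul (u_b.mul u_b))).congr (by simp [rs]; ring), by simp⟩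
      exact (Un.mem mCS).congr (by simp [rs]; ring)
    · exact ⟨(1, 0), by simp, 1, Un.one, by simp [rs]; ring⟩
    · simp only [cA, nA, fmC]
      have m : ∀ {p}, Un X5 p → Un ((yb - xa - xa * yb) :: X5) p :=
        fun h => h.mono fun p hp => mCC _ hp
      refine ⟨(m u_b).congr (by simp [rs]), (m u_ba).congr (by simp [rs]), (m u_a.neg).congr (by simp [rs]), ?_, by simp⟩
      exact (Un.mem mCS).congr (by simp [rs]; ring)
    · exact ⟨(1, xa), by simp, 1, Un.one, by simp [rs]; ring⟩
    · simp only [cA, nA, fmC]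
      exact ⟨Un.one.congr (by simp [rs]), u_a.congr (by simp [rs]), u_a1.congr (by simp [rs]), by simp⟩
    · simp only [fmC]
      exact ⟨Un.one.congr (by simp [rs]), Un.one.congr (by simp [rs]), by simp⟩
  · refine secOK_of _ fun s hs => ⟨(0, -1), by simp, ?_⟩
    have : Un X5 s.1 := by
      rcases mA.1 hs with hs | hs
      · simp only [Sd, mC, nmn, or_false] at hs
        rcases hs with rfl | rfl | rfl | rfl
        · exact Un.one
        · exact Un.one
        · exact u_b
        · exact u_b
      · exact hR s hs
    exact this.congr (by simp [rs])
lemma NN_D6 : NN D6 = 12 := by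
  have := D6_NS [] [] sm sm
  rw [sum_D6 [] sm, secSum, List.append_nil] at this
  simpa using this
lemma NN_D6a : NN (D6 ++ [Dl qd ((4, 5), (0, 1), (2, 3))]) = 18 := by
  have e : Dl qd ((4, 5), (0, 1), (2, 3)) = up (yb - xa) * sp (1, 1 + xa) := by
    simp only [Dl, br, dt, qd0, qd1, qd2, qd3, qd4, qd5, cv0,
      cv1, cv, sp, map_add, map_one, map_sub]
    ring
  rw [D6_NS [(1, 1 + xa)] _ (by simp only [mS, forall_eq]; exact ⟨_, rfl, _, u_ba, e⟩)
    (by simp only [mS, forall_eq]; exact ⟨_, rfl, _, u_ba, e⟩),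
    sum_D6 _ (by simp only [mS, forall_eq]; exact Un.one), secSum, secSum, add_zero]
  have : NN (X5 ++ List.map (fun t => rs t (1, 1 + xa)) (S2 ++ Sd)) = 6 := by
    rw [← surf4]
    have g : ∀ L, LGood (X5 ++ L) := fun L => hX5.mono fun p hp => mL _ hp
    have m : ∀ {p} L, Un X5 p → Un (X5 ++ L) p :=
        fun L h => h.mono fun p hp => mL _ hp
    refine NN_congr (g _) (g _) ?_ ?_
    · simp only [fmA]
      refine ⟨fun p hp => Un.mem (mL _ hp), ?_⟩
      simp only [Sd, cA, nA, mpC, mpN, fmC]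
      have w1 : Un (X5 ++ [xa + 1, yb + 1]) (xa + 1) := Un.mem sm
      have w2 : Un (X5 ++ [xa + 1, yb + 1]) (yb + 1) := Un.mem sm
      exact ⟨Un.one.congr (by simp [rs]), w1.congr (by simp [rs]; ring), (m _ u_a).congr (by simp [rs]),
        Un.one.congr (by simp [rs]), ((m _ u_a).mul w2).congr (by simp [rs]; ring), (m _ u_a).congr (by simp [rs]; ring), by simp⟩
    · simp only [fmA]
      refine ⟨fun p hp => Un.mem (mL _ hp), ?_⟩
      simp only [fmC]
      refine ⟨(Un.mem (mR _ (mM.2 ⟨(1, 0), by simp, rfl⟩))).congr (by simp [rs]; ring),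
        Un.div (r := rs (yb, yb - xa) (1, 1 + xa)) (p := xa) (Un.mem (mR _ (mM.2 ⟨(yb, yb - xa), by simp [Sd], rfl⟩)))
          (m _ u_a) (by simp [rs]; ring), by simp⟩
  rw [this]
  rfl
lemma NN_D6b : NN (D6 ++ [Dl qd ((4, 5), (0, 2), (1, 3))]) = 17 := by
  have e : Dl qd ((4, 5), (0, 2), (1, 3)) = up xa * sp (1, yb) := by
    simp only [Dl, br, dt, qd0, qd1, qd2, qd3, qd4, qd5, cv0,
      cv1, cv, sp, map_one]
    ring
  rw [D6_NS [(1, yb)] _ (by simp only [mS, forall_eq]; exact ⟨_, rfl, _, u_a, e⟩)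
    (by simp only [mS, forall_eq]; exact ⟨_, rfl, _, u_a, e⟩),
    sum_D6 _ (by simp only [mS, forall_eq]; exact Un.one),
    secSum_repl hX5 (yb ^ 2 - yb + xa), secSum, add_zero, surf3]
  · rfl
  · have m : ∀ {p}, Un X5 p → Un ((yb ^ 2 - yb + xa) :: X5) p :=
        fun h => h.mono fun p hp => mCC _ hp
    simp only [Sd, cA, nA, fmC]
    refine ⟨Un.one.congr (by simp [rs]), (m u_b).congr (by simp [rs]), (m u_b1).congr (by simp [rs]),
      (m u_ba).congr (by simp [rs]), ?_, (m (u_b1.mul u_ba)).congr (by simp [rs]; ring), by simp⟩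
    exact (Un.mem mCS).congr (by simp [rs]; ring)
  · exact ⟨(yb, yb - xa), by simp [Sd], 1, Un.one, by simp [rs]; ring⟩
def pm {R : Type} [CommRing R] (a b : R) : Prop := a = b ∨ a = -b
lemma pm.trans {R : Type} [CommRing R] {a b c : R} (h : pm a b) (h' : pm b c) : pm a c := by
  rcases h with rfl | rfl <;> rcases h' with rfl | rfl
  · exact Or.inl rfl
  · exact Or.inr rfl
  · exact Or.inr rfl
  · exact Or.inl (neg_neg _)
def flp (l : Ln) : List Ln := [l, (l.2, l.1)]
def vari (T : T3) : List T3 := ((flp T.1).product ((flp T.2.1).product (flp T.2.2))).flatMap fun S =>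
  [S, (S.2.1, S.2.2, S.1), (S.2.2, S.1, S.2.1), (S.1, S.2.2, S.2.1), (S.2.2, S.2.1, S.1), (S.2.1, S.1, S.2.2)]
lemma Dl_flip1 {q : Pts τ} (l i j : Ln) : Dl q ((l.2, l.1), i, j) = - Dl q (l, i, j) := by
  simp only [Dl]; ring
lemma Dl_vari (q : Pts τ) {T T' : T3} (h : T' ∈ vari T) : pm (Dl q T') (Dl q T) := by
  simp only [vari, List.mem_flatMap] at h
  obtain ⟨⟨l', i', j'⟩, foo, bar⟩ := h
  obtain ⟨l, i, j⟩ := T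
  have a : pm (Dl q (l', i', j')) (Dl q (l, i, j)) := by
    obtain ⟨ha, hbc⟩ := List.pair_mem_product.1 foo
    obtain ⟨hb, hc⟩ := List.pair_mem_product.1 hbc
    have e1 : pm (Dl q (l', i', j')) (Dl q (l, i', j')) := by
      simp only [flp, mC, nmn, or_false] at ha
      rcases ha with rfl | rfl
      · exact Or.inl rfl
      · exact Or.inr (Dl_flip1 _ _ _)
    have e2 : pm (Dl q (l, i', j')) (Dl q (l, i, j')) := by
      simp only [flp, mC, nmn, or_false] at hb
      rcases hb with rfl | rfl
      · exact Or.inl rfl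
      · exact Or.inr (Dl_flip2 _ _ _)
    have e3 : pm (Dl q (l, i, j')) (Dl q (l, i, j)) := by
      simp only [flp, mC, nmn, or_false] at hc
      rcases hc with rfl | rfl
      · exact Or.inl rfl
      · exact Or.inr (Dl_flip3 _ _ _)
    exact (e1.trans e2).trans e3
  refine pm.trans ?_ a
  simp only [mC, nmn, or_false] at bar
  rcases bar with rfl | rfl | rfl | rfl | rfl | rfl
  · exact Or.inl rfl
  · exact Or.inl (Dl_rot _ _ _)
  · exact Or.inl (by rw [← Dl_rot])
  · exact Or.inr (Dl_swap _ _ _)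
  · exact Or.inr (by rw [← Dl_rot, ← Dl_rot, Dl_swap, ← Dl_rot])
  · exact Or.inr (by rw [Dl_rot, Dl_swap, ← Dl_rot, ← Dl_rot])
lemma pm.un {L : List (Zp τ)} {p q : Zp τ} (h : pm q p) (hp : Un L p) : Un L q :=
  hp.of h
def T0 : T3 := ((0, 1), (2, 4), (3, 5))
def tl (T : T3) : List ℕ := [T.1.1, T.1.2, T.2.1.1, T.2.1.2, T.2.2.1, T.2.2.2]
def dis (M : ℕ) (T : T3) : Bool := (tl T).all (fun a => decide (a < M)) && decide (tl T).Nodup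
lemma dis.lab {M : ℕ} {T : T3} (h : dis M T = true) : lab M T := by
  simp [dis, tl] at h
  exact ⟨h.1.1, h.1.2.1, h.1.2.2.1, h.1.2.2.2.1, h.1.2.2.2.2.1, h.1.2.2.2.2.2⟩
lemma exP {M : ℕ} {T : T3} (h : dis M T = true) (hM : 6 ≤ M) : ∃ π : Equiv.Perm ℕ,
    (∀ a, a < M → π a < M) ∧ (∀ a, a < M → π.symm a < M) ∧ pT π T = T0 := by
  have hl := dis.lab h
  have hn : (tl T).Nodup := by simp only [dis, Bool.and_eq_true, decide_eq_true_eq] at h; exact h.2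
  obtain ⟨⟨a, b⟩, ⟨c, d⟩, e, f⟩ := T
  obtain ⟨ha, hb, hc, hd, he, hf⟩ := hl
  simp only at ha hb hc hd he hf
  simp only [tl] at hn
  have hin : Inj (![⟨a, ha⟩, ⟨b, hb⟩, ⟨c, hc⟩, ⟨d, hd⟩, ⟨e, he⟩, ⟨f, hf⟩] : Fin 6 → Fin M) := by
    have := List.nodup_iff_injective_get.1 hn
    intro x y hxy
    apply this
    have bar := congrArg Fin.val hxy
    fin_cases x <;> fin_cases y <;> exact bar
  have hin' : Inj (![⟨0, by omega⟩, ⟨1, by omega⟩, ⟨2, by omega⟩, ⟨4, by omega⟩, ⟨3, by omega⟩,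
      ⟨5, by omega⟩] : Fin 6 → Fin M) := by
    intro x y hxy
    have bar : (![0, 1, 2, 4, 3, 5] : Fin 6 → ℕ) x = (![0, 1, 2, 4, 3, 5] : Fin 6 → ℕ) y := by
      have bar := congrArg Fin.val hxy
      revert bar
      clear hxy
      fin_cases x <;> fin_cases y <;> exact id
    have baz : ∀ x y : Fin 6, (![0, 1, 2, 4, 3, 5] : Fin 6 → ℕ) x = (![0, 1, 2, 4, 3, 5] : Fin 6 → ℕ) y → x = y := by
      decide
    exact baz x y bar
  obtain ⟨g, hg⟩ := (Equiv.Perm.isMultiplyPretransitive (Fin M) 6).exists_smul_eq ⟨_, hin⟩ ⟨_, hin'⟩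
  have key : ∀ x : Fin M, g.extendDomain Fin.equivSubtype (x : ℕ) = (g x : ℕ) := by
    intro x
    exact Equiv.Perm.extendDomain_apply_image g Fin.equivSubtype x
  have key' : ∀ x : Fin M, (g.extendDomain Fin.equivSubtype).symm (x : ℕ) = (g.symm x : ℕ) := by
    intro x
    rw [Equiv.symm_apply_eq, key, Equiv.apply_symm_apply]
  refine ⟨g.extendDomain Fin.equivSubtype, fun x hx => ?_, fun x hx => ?_, ?_⟩
  · rw [key ⟨x, hx⟩]; exact (g _).2
  · rw [key' ⟨x, hx⟩]; exact (g.symm _).2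
  · have hg' : ∀ i, g ((![⟨a, ha⟩, ⟨b, hb⟩, ⟨c, hc⟩, ⟨d, hd⟩, ⟨e, he⟩, ⟨f, hf⟩] : Fin 6 → Fin M) i) =
      (![⟨0, by omega⟩, ⟨1, by omega⟩, ⟨2, by omega⟩, ⟨4, by omega⟩, ⟨3, by omega⟩,
      ⟨5, by omega⟩] : Fin 6 → Fin M) i := fun i => DFunLike.congr_fun hg i
    have e0 := hg' 0
    have e1 := hg' 1
    have e2 := hg' 2
    have e3 := hg' 3
    have e4 := hg' 4
    have e5 := hg' 5
    simp only [cv0, cv1, cv] at e0 e1 e2 e3 e4 e5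
    simp only [pT, T0]
    rw [key ⟨a, ha⟩, key ⟨b, hb⟩, key ⟨c, hc⟩, key ⟨d, hd⟩, key ⟨e, he⟩, key ⟨f, hf⟩, e0, e1, e2, e3, e4, e5]
lemma Dl_q6 : Dl q6 T0 = gpoly (Equiv.refl τ2) (Ad + Bd * (xd - 1)) Ad := by
  have h0 : q6 0 = ![0, 0, 1] := tw6.std.q0
  have foo : q6 1 = ![0, -1, 0] := tw6.std.q1
  have bar : q6 2 = ![1, 0, 0] := tw6.std.q2
  have baz : q6 3 = ![1, 1, 1] := tw6.q3
  have box : q6 4 = ![1, up (up xa), up (up yb)] := by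
    funext i; fin_cases i <;> simp [q6, q5, ext]
  have h5 : q6 5 = ![1, X (some none), X none] := by simp [q6, ext]
  have e1 : ∀ p : Zp τd, rho (Equiv.refl τ2) p = up p := fun p => rfl
  have e2 : up xd = (X (some none) : Zp τ2) := by simp [up]
  rw [gpoly, e1, e1]
  simp only [Dl, T0, br, dt, h0, foo, bar, baz, box, h5, cv0, cv1,
    cv, map_add, map_mul, map_sub, map_one, e2, Equiv.refl_apply]
  ring
lemma gr6 {𝒟 : List T3} (h : ∀ T ∈ 𝒟, lab 6 T) :
    NN (X6 ++ (T0 :: 𝒟).map (Dl q6)) = NN (X6 ++ 𝒟.map (Dl q6)) + NN (D6 ++ 𝒟.map (Dl qd)) := by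
  have e1 : ∀ p : Zp τd, rho (Equiv.refl τ2) p = up p := fun p => rfl
  have h5 : q6 5 = ![1, X (some none), X none] := by simp [q6, ext]
  have e2 : up xd = (X (some none) : Zp τ2) := by simp [up]
  rw [← graph_T (q := q6) (q' := qd) (e := Equiv.refl τ2) (M := 6) (b := Ad + Bd * (xd - 1)) (c := Ad) ?_
    tw6.hB hD6 tw6.hU qdU ?_ ?_ tw6.mem D6_mem h, ← Dl_q6]
  · refine NN_perm (tw6.hB.mono fun p hp => mL _ hp) ?_
    intro p
    simp only [mA, mpC, mC]
    tauto
  · intro j hj i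
    by_cases h : j = 5
    · subst h
      simp only [lam, if_true, qd5, h5]
      fin_cases i
      · simp
      · simp [e1, up]
      · refine dvd_of_eq ?_
        simp only [gpoly, Equiv.refl_apply]
        rfl
    · have : q6 j i = rho (Equiv.refl τ2) (qd j i) := by
        simp only [q6, ext, qd, if_neg h]
        rfl
      rw [lam, if_neg h, map_one, this, one_mul, sub_self]
      exact dvd_zero _
  · exact u_a.up fun q hq => mCC _ (mL _ hq)
  · rw [e1]
    have : Un (X5.map up) (up xa) := u_a.up fun q hq => hq
    exact this.up fun q hq => mL _ hq
lemma NN_X6T {T : T3} (h : dis 6 T = true) : NN (X6 ++ [T].map (Dl q6)) = 38 := by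
  obtain ⟨π, foo, bar, baz⟩ := exP h le_rfl
  rw [sym tw6 π foo bar (by simpa using dis.lab h), List.map_singleton, baz, gr6 sm]
  simp only [mpN, List.append_nil, NN_X6, NN_D6]
  rfl
lemma NN_X7 : NN X7 = 1272 := by
  have h := fib tw6.std tw6.hU tw6.hB om
  have e : ∀ Ds ∈ fibT 6, Ds.length ≤ 1 ∧ ∀ T ∈ Ds, dis 6 T = true := by decide
  have e2 : (((fibT 6).map fun Ds => 26 + 12 * Ds.length).sum) = 1272 := by decide
  rw [X7, h]
  have : (fibT 6).map (fun Ds => NN (X6 ++ Ds.map (Dl q6))) =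
      (fibT 6).map (fun Ds => ((26 + 12 * Ds.length : ℕ) : ℕ∞)) := by
    refine List.map_congr_left fun Ds hDs => ?_
    obtain ⟨foo, bar⟩ := e Ds hDs
    match Ds, foo, bar with
    | [], _, _ => simpa using NN_X6
    | [T], _, bar => rw [NN_X6T (bar T sm)]; rfl
  rw [this, show (1272 : ℕ∞) = ((1272 : ℕ) : ℕ∞) from rfl, ← e2, Nat.cast_list_sum, List.map_map]
  rfl
def pw : List (ℕ × ℕ) → Equiv.Perm ℕ
  | [] => 1
  | s :: w => Equiv.swap s.1 s.2 * pw w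
lemma swap_lt {M a b x : ℕ} (ha : a < M) (hb : b < M) (hx : x < M) : Equiv.swap a b x < M := by
  rw [Equiv.swap_apply_def]; split_ifs <;> assumption
lemma pw_lt {M : ℕ} {w : List (ℕ × ℕ)} (h : ∀ s ∈ w, s.1 < M ∧ s.2 < M) :
    ∀ a, a < M → pw w a < M ∧ (pw w).symm a < M := by
  induction w with
  | nil => intro a ha; exact ⟨ha, ha⟩
  | cons s w ih =>
    intro a ha
    obtain ⟨foo, bar⟩ := h s mCS
    have ih' := ih fun s hs => h s (mCC _ hs)
    refine ⟨swap_lt foo bar (ih' a ha).1, ?_⟩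
    have : (pw (s :: w)).symm a = (pw w).symm (Equiv.swap s.1 s.2 a) := by
      rw [Equiv.symm_apply_eq]
      simp [pw]
    rw [this]
    exact (ih' _ (swap_lt foo bar ha)).2
def tab : List (T3 × List (ℕ × ℕ) × Bool) := [
  (((2, 3), (0, 5), (1, 4)), [(0, 3), (1, 5)], false),
  (((2, 3), (0, 4), (1, 5)), [(2, 4), (3, 5)], false),
  (((2, 4), (0, 5), (1, 3)), [(0, 1), (0, 2), (1, 4)], true),
  (((2, 4), (0, 3), (1, 5)), [(0, 2), (1, 4)], true),
  (((2, 5), (0, 4), (1, 3)), [(2, 4)], false),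
  (((2, 5), (0, 3), (1, 4)), [(0, 1), (2, 4)], false),
  (((3, 4), (0, 5), (1, 2)), [(0, 1), (3, 5)], false),
  (((3, 4), (0, 2), (1, 5)), [(3, 5)], false),
  (((3, 4), (0, 1), (2, 5)), [(2, 4)], true),
  (((3, 5), (0, 4), (1, 2)), [(0, 1), (0, 3), (1, 5)], true),
  (((3, 5), (0, 2), (1, 4)), [(0, 3), (1, 5)], true),
  (((4, 5), (0, 3), (1, 2)), [(0, 1)], false),
  (((4, 5), (0, 2), (1, 3)), [], false),
  (((4, 5), (0, 1), (2, 3)), [], true)]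
def Tab (b : Bool) : T3 := if b then ((4, 5), (0, 1), (2, 3)) else ((4, 5), (0, 2), (1, 3))
lemma tab_ok : ∀ r ∈ tab, (∀ s ∈ r.2.1, s.1 < 6 ∧ s.2 < 6) ∧ dis 6 r.1 = true ∧
    pT (pw r.2.1) T0 ∈ vari T0 ∧ pT (pw r.2.1) (Tab r.2.2) ∈ vari r.1 := by
  decide
lemma tab_NN {r : T3 × List (ℕ × ℕ) × Bool} (hr : r ∈ tab) :
    NN (D6 ++ [r.1].map (Dl qd)) = if r.2.2 then 18 else 17 := by
  obtain ⟨foo, bar, baz, box⟩ := tab_ok r hr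
  have hp := pw_lt foo
  have ht : dis 6 (Tab r.2.2) = true := by cases r.2.2 <;> decide
  have hv : NN (D6 ++ [Tab r.2.2].map (Dl qd)) = if r.2.2 then 18 else 17 := by
    cases r.2.2
    · exact NN_D6b
    · exact NN_D6a
  have g1 := gr6 (𝒟 := [r.1]) (by simpa using dis.lab bar)
  have g2 := gr6 (𝒟 := [Tab r.2.2]) (by simpa using dis.lab ht)
  rw [NN_X6T bar] at g1
  rw [NN_X6T ht, hv] at g2
  have g3 := sym tw6 (pw r.2.1) (fun a ha => (hp a ha).1) (fun a ha => (hp a ha).2)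
    (𝒟 := [T0, Tab r.2.2]) (by
      simp only [fmC]
      exact ⟨dis.lab (by decide), dis.lab ht, by simp⟩)
  have g4 : NN (X6 ++ ([T0, Tab r.2.2].map (pT (pw r.2.1))).map (Dl q6)) = NN (X6 ++ [T0, r.1].map (Dl q6)) := by
    have hg : ∀ L, LGood (X6 ++ L) := fun L => tw6.hB.mono fun p hp => mL _ hp
    have p1 := Dl_vari q6 baz
    have p2 := Dl_vari q6 box
    have sw : ∀ {a b : Zp τ2}, pm a b → pm b a := by
      rintro a b (h | h)
      · exact Or.inl h.symm
      · exact Or.inr (by rw [h, neg_neg])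
    refine NN_congr (hg _) (hg _) ?_ ?_
    · simp only [fmA, mpC, mpN, fmC]
      exact ⟨fun p hp => Un.mem (mL _ hp), p1.un (Un.mem sm),
        p2.un (Un.mem sm), by simp⟩
    · simp only [fmA, mpC, mpN, fmC]
      exact ⟨fun p hp => Un.mem (mL _ hp), (sw p1).un (Un.mem sm),
        (sw p2).un (Un.mem sm), by simp⟩
  rw [← g4, ← g3, g2] at g1
  exact ((ENat.add_right_injective_of_ne_top (by decide)) g1).symm
def val : List T3 → ℕ
  | [] => 12
  | T :: _ => if T = ((3, 5), (0, 1), (2, 4)) then 0 else if (T, true) ∈ tab.map (fun r => (r.1, r.2.2)) then 18 else 17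
lemma val_ok : ∀ Ds ∈ fibT 6, NN (D6 ++ Ds.map (Dl qd)) = (val Ds : ℕ∞) := by
  have e : ∀ Ds ∈ fibT 6, Ds = [] ∨ Ds = [((3, 5), (0, 1), (2, 4))] ∨
      ∃ r ∈ tab, Ds = [r.1] ∧ val Ds = if r.2.2 then 18 else 17 := by decide
  intro Ds hDs
  rcases e Ds hDs with rfl | rfl | ⟨r, hr, rfl, hv⟩
  · simpa [val] using NN_D6
  · rw [NN_zero]
    · rfl
    · refine mR _ (mS.2 ?_)
      simp only [Dl, br, dt, qd0, qd1, qd2, qd3, qd4, qd5, cv0,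
        cv1, cv]
      ring
  · rw [tab_NN hr, hv]
    cases r.2.2 <;> rfl
def qD : Pts (Option (Option τd)) := ext qd 6
def D7 := VV qd 6 D6
lemma NN_D7 : NN D7 = 568 := by
  have h := fib qdStd qdU hD6 om
  have e2 : ((fibT 6).map val).sum = 568 := by decide
  rw [D7, h, List.map_congr_left val_ok, show (568 : ℕ∞) = ((568 : ℕ) : ℕ∞) from rfl, ← e2, Nat.cast_list_sum, List.map_map]
  rfl
lemma hj6 : ∀ j, j < 6 → ∀ i, gpoly (Equiv.refl τ2) (Ad + Bd * (xd - 1)) Ad ∣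
    up (lam Ad j) * q6 j i - up (qd j i) := by
  have h5 : q6 5 = ![1, X (some none), X none] := by simp [q6, ext]
  intro j hj i
  by_cases h : j = 5
  · subst h
    simp only [lam, if_true, qd5, h5]
    fin_cases i
    · simp
    · simp [up]
    · refine dvd_of_eq ?_
      simp only [gpoly, Equiv.refl_apply]
      rfl
  · have : q6 j i = up (qd j i) := by
      simp only [q6, ext, qd, if_neg h]
    rw [lam, if_neg h, map_one, this, one_mul, sub_self]
    exact dvd_zero _
def e7 : Option (Option (Option τd)) ≃ τ3 where
  toFun := fun k => match k with
    | none => some (some none)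
    | some none => none
    | some (some none) => some none
    | some (some (some k)) => some (some (some k))
  invFun := fun k => match k with
    | none => some none
    | some none => some (some none)
    | some (some none) => none
    | some (some (some k)) => some (some (some k))
  left_inv := by rintro (_ | _ | _ | k) <;> rfl
  right_inv := by rintro (_ | _ | _ | k) <;> rfl
lemma rho7 (p : Zp τd) : rho e7 (up (up p)) = up (up (up p)) := by
  simp only [rho, up, rename_rename]
  rfl
lemma gp7 : gpoly e7 (up (up (Ad + Bd * (xd - 1)))) (up (up Ad)) =
    up (up (gpoly (Equiv.refl τ2) (Ad + Bd * (xd - 1)) Ad)) := by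
  rw [gpoly, gpoly, rho7, rho7, map_sub, map_sub, map_mul, map_mul]
  congr 2
  simp [up, e7]
lemma Dl_q7 : Dl q7 T0 = gpoly e7 (up (up (Ad + Bd * (xd - 1)))) (up (up Ad)) := by
  rw [gp7, ← Dl_q6, q7, Dl_ext q6 (by decide)]
lemma qDU : BrU qD 7 D7 := BrU_ext qdU
lemma hD7 : LGood D7 := VV_good qdStd qdU hD6 om
lemma D7_mem : ∀ p ∈ D7, ∃ x y z, x < 7 ∧ y < 7 ∧ z < 7 ∧ x ≠ y ∧ x ≠ z ∧ y ≠ z ∧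
      (p = br qD x y z ∨ up (up Ad) * p = br qD x y z) := by
  intro p hp
  rcases mA.1 hp with hp | hp
  · obtain ⟨p', hp', rfl⟩ := mM.1 hp
    obtain ⟨p'', hp'', rfl⟩ := mM.1 hp'
    obtain ⟨a, b, c, ha, hb, hc, foo, bar, baz, box⟩ := D6_mem _ hp''
    refine ⟨a, b, c, by omega, by omega, by omega, foo, bar, baz, ?_⟩
    rw [qD, br_ext qd ha hb hc, ← map_mul, ← map_mul]
    exact box.imp (fun h => congrArg up (congrArg up h)) (fun h => congrArg up (congrArg up h))
  · obtain ⟨⟨a, b⟩, hi, rfl⟩ := mM.1 hp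
    simp only [pairs, mF, mPr, mRg, decide_eq_true_eq] at hi
    exact ⟨a, b, 6, by omega, by omega, by omega, by omega, by omega, by omega, Or.inl rfl⟩
lemma gr7 {𝒟 : List T3} (h : ∀ T ∈ 𝒟, lab 7 T) :
    NN (X7 ++ (T0 :: 𝒟).map (Dl q7)) = NN (X7 ++ 𝒟.map (Dl q7)) + NN (D7 ++ 𝒟.map (Dl qD)) := by
  have uA : Un D6 Ad := u_a.up fun q hq => mCC _ (mL _ hq)
  have uA' : Un X6 (up Ad) := by
    have : Un (X5.map up) (up xa) := u_a.up fun q hq => hq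
    exact this.up fun q hq => mL _ hq
  rw [← graph_T (q := q7) (q' := qD) (e := e7) (M := 7) (b := up (up (Ad + Bd * (xd - 1))))
    (c := up (up Ad)) ?_ tw7.hB hD7 tw7.hU qDU ?_ ?_ tw7.mem D7_mem h, ← Dl_q7]
  · refine NN_perm (tw7.hB.mono fun p hp => mL _ hp) ?_
    intro p
    simp only [mA, mpC, mC]
    tauto
  · intro j hj i
    by_cases h : j = 6
    · subst h
      rw [lam, if_neg om, map_one, one_mul]
      have : q7 6 i = rho e7 (qD 6 i) := by
        simp only [q7, qD, ext, if_true]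
        fin_cases i <;> simp [rho, e7]
      rw [this, sub_self]
      exact dvd_zero _
    · have e1 : lam (up (up Ad)) j = up (up (lam Ad j)) := by
        simp only [lam]; split_ifs <;> simp
      rw [gp7, e1, rho7]
      have e2 : q7 j i = up (up (q6 j i)) := by simp only [q7, ext, if_neg h]
      have e3 : qD j i = up (up (qd j i)) := by simp only [qD, ext, if_neg h]
      rw [e2, e3, rho7, ← map_mul, ← map_mul, ← map_sub, ← map_sub]
      exact map_dvd up (map_dvd up (hj6 j om i))
  · have : Un (D6.map up) (up Ad) := uA.up fun q hq => hq
    exact this.up fun q hq => mL _ hq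
  · rw [rho7]
    have : Un (X6.map up) (up (up Ad)) := uA'.up fun q hq => hq
    exact this.up fun q hq => mL _ hq
lemma plk (q : Pts τ) (a x z u y : ℕ) :
    br q a x z * br q x u y = br q a x u * br q x z y - br q a x y * br q x z u := by
  simp only [br, dt]; ring
lemma Dl_plk (q : Pts τ) (l i : Ln) (x z u y : ℕ) : Dl q (l, (x, z), i) * br q x u y =
    Dl q (l, (x, u), i) * br q x z y - Dl q (l, (x, y), i) * br q x z u := by
  simp only [Dl]
  linear_combination br q l.2 i.1 i.2 * plk q l.1 x z u y - br q l.1 i.1 i.2 * plk q l.2 x z u y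
lemma DlD0 : Dl qD T0 = 0 := by
  have : Dl qd T0 = 0 := by
    simp only [T0, Dl, br, dt, qd0, qd1, qd2, qd3, qd4, qd5, cv0,
      cv1, cv]
    ring
  rw [qD, Dl_ext qd (by decide), this, map_zero, map_zero]
lemma unD {x u : ℕ} (hx : x = 2 ∧ u = 4 ∨ x = 4 ∧ u = 2) : Un D7 (Dl qD ((0, 1), (x, 6), (3, 5))) := by
  have h0 : Dl qD ((0, 1), (x, u), (3, 5)) = 0 := by
    rcases hx with ⟨rfl, rfl⟩ | ⟨rfl, rfl⟩
    · exact DlD0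
    · have := Dl_flip2 (q := qD) (0, 1) (2, 4) (3, 5)
      rw [this]; exact neg_eq_zero.2 DlD0
  have hr : (br qD 0 1 3 * br qD 3 x 5) * br qD x 6 u = br qD x u 3 * Dl qD ((0, 1), (x, 6), (3, 5)) := by
    have foo := Dl_plk qD (0, 1) (3, 5) x 6 u 3
    have bar : Dl qD ((0, 1), (x, 3), (3, 5)) = - Dl qD ((0, 1), (3, x), (3, 5)) :=
      Dl_flip2 (q := qD) (0, 1) (3, x) (3, 5)
    rw [h0, bar, pl1] at foo
    linear_combination -foo
  refine Un.div (((qDU 0 1 3 ?_ ?_ ?_ ?_ ?_ ?_).mul (qDU 3 x 5 ?_ ?_ ?_ ?_ ?_ ?_)).mul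
    (qDU x 6 u ?_ ?_ ?_ ?_ ?_ ?_)) (qDU x u 3 ?_ ?_ ?_ ?_ ?_ ?_) hr <;> omega
lemma unD' {j : Ln} (h : j = (2, 6) ∨ j = (6, 2) ∨ j = (4, 6) ∨ j = (6, 4)) :
    Un D7 (Dl qD ((0, 1), j, (3, 5))) := by
  rcases h with rfl | rfl | rfl | rfl
  · exact unD (u := 4) om
  · exact (unD (x := 2) (u := 4) om).neg.congr (Dl_flip2 (q := qD) (0, 1) (2, 6) (3, 5))
  · exact unD (u := 2) om
  · exact (unD (x := 4) (u := 2) om).neg.congr (Dl_flip2 (q := qD) (0, 1) (4, 6) (3, 5))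
def rel (T S : T3) : Bool := decide (S.1 = T.1 ∧ S.2.2 = T.2.2 ∧ S.2.1 ≠ T.2.1 ∧ S.2.1 ≠ (T.2.1.2, T.2.1.1))
lemma unR {π : Equiv.Perm ℕ} (hπ : ∀ a, a < 7 → π a < 7) {T S : T3} (hS : dis 7 S = true) (h : rel T S = true)
    (hT : pT π T = T0) : Un D7 (Dl qD (pT π S)) := by
  have hl := dis.lab hS
  obtain ⟨⟨a, b⟩, ⟨c, d⟩, e, f⟩ := T
  obtain ⟨⟨a', b'⟩, ⟨x, y⟩, e', f'⟩ := S
  simp only [rel, decide_eq_true_eq, Prod.mk.injEq, ne_eq] at h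
  obtain ⟨⟨rfl, rfl⟩, ⟨rfl, rfl⟩, baz, box⟩ := h
  simp only [pT, T0, Prod.mk.injEq] at hT
  obtain ⟨⟨ha, hb⟩, ⟨hc, hd⟩, he, hf⟩ := hT
  have hn : (tl ((a', b'), (x, y), e', f')).Nodup := by
    simp only [dis, Bool.and_eq_true, decide_eq_true_eq] at hS; exact hS.2
  obtain ⟨-, -, hx, hy, -, -⟩ := hl
  simp only [pT, ha, hb, he, hf]
  apply unD'
  have i : ∀ {u v : ℕ}, u ≠ v → π u ≠ π v := fun h h' => h (π.injective h')
  simp only [tl, List.nodup_cons, mC, nmn, not_or, or_false] at hn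
  obtain ⟨⟨-, n1, n2, -⟩, ⟨n3, n4, -⟩, ⟨n5, n6, n7⟩, ⟨n8, n9⟩, -⟩ := hn
  have m1 := hπ x hx
  have m2 := hπ y hy
  have k1 := i n1
  have k2 := i n2
  have k3 := i n3
  have k4 := i n4
  have k5 := i n5
  have k6 := i n6
  have k7 := i n7
  have k8 := i n8
  have k9 := i n9
  have w3 : ¬ (π x = 2 ∧ π y = 4) := fun hw => baz ⟨π.injective (hw.1.trans hc.symm), π.injective (hw.2.trans hd.symm)⟩
  have w4 : ¬ (π x = 4 ∧ π y = 2) := fun hw => box ⟨π.injective (hw.1.trans hd.symm), π.injective (hw.2.trans hc.symm)⟩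
  rw [ha] at k1 k2
  rw [hb] at k3 k4
  rw [he] at k6 k8
  rw [hf] at k7 k9
  simp only [Prod.mk.injEq]
  omega
lemma NN_X7T {Ds : List T3} (h : Ds.Pairwise fun T S => rel T S = true) (h' : ∀ T ∈ Ds, dis 7 T = true) :
    NN (X7 ++ Ds.map (Dl q7)) = ((1272 + 568 * Ds.length : ℕ) : ℕ∞) := by
  induction Ds with
  | nil => simpa using NN_X7
  | cons T 𝒟 ih =>
    have hd : ∀ S ∈ 𝒟, dis 7 S = true := fun S hS => h' S (mCC _ hS)
    have hl : ∀ S ∈ 𝒟, lab 7 S := fun S hS => dis.lab (hd S hS)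
    have foo := ih (List.pairwise_cons.1 h).2 hd
    obtain ⟨π, a1, a2, a3⟩ := exP (h' T mCS) om
    rw [sym tw7 π a1 a2 hl] at foo
    rw [sym tw7 π a1 a2 (fun S hS => dis.lab (h' S hS)), mpC, a3, gr7, foo, NN_drop hD7, NN_D7]
    · rw [List.length_cons, show (568 : ℕ∞) = ((568 : ℕ) : ℕ∞) from rfl, ← Nat.cast_add,
        Nat.mul_add, Nat.mul_one, Nat.add_assoc]
    · intro p hp
      obtain ⟨S', hS', rfl⟩ := mM.1 hp
      obtain ⟨S, hS, rfl⟩ := mM.1 hS'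
      exact unR a1 (hd S hS) ((List.pairwise_cons.1 h).1 S hS) a3
    · intro S' hS'
      obtain ⟨S, hS, rfl⟩ := mM.1 hS'
      obtain ⟨b1, b2, b3, b4, b5, b6⟩ := hl S hS
      exact ⟨a1 _ b1, a1 _ b2, a1 _ b3, a1 _ b4, a1 _ b5, a1 _ b6⟩
lemma NN_X8 : NN X8 = 188112 := by
  have h := fib tw7.std tw7.hU tw7.hB om
  have e : ∀ Ds ∈ fibT 7, (Ds.Pairwise fun T S => rel T S = true) ∧ ∀ T ∈ Ds, dis 7 T = true := by decide
  have e2 : (((fibT 7).map fun Ds => 1272 + 568 * Ds.length).sum) = 188112 := by decide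
  rw [X8, h, show (188112 : ℕ∞) = ((188112 : ℕ) : ℕ∞) from rfl, ← e2, Nat.cast_list_sum, List.map_map]
  congr 1
  exact List.map_congr_left fun Ds hDs => NN_X7T (e Ds hDs).1 (e Ds hDs).2
section ultra
variable {J K : Type} [Field K] (U : Ultrafilter J) (φ : (J → ℂ) →+* K)
  (hφ : Sur φ) (h0 : ∀ a, φ a = 0 ↔ ∀ᶠ p in (U : Filter J), a p = 0)
include h0
lemma u_eq {a b : J → ℂ} : φ a = φ b ↔ ∀ᶠ p in (U : Filter J), a p = b p := by
  rw [← sub_eq_zero, ← map_sub, h0]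
  simp only [Pi.sub_apply, sub_eq_zero]
lemma u_inv (a : J → ℂ) : (φ a)⁻¹ = φ (fun p => (a p)⁻¹) := by
  by_cases h : φ a = 0
  · rw [h, inv_zero, eq_comm, h0]
    exact ((h0 a).1 h).mono fun p hp => by rw [hp, inv_zero]
  · have h' : ∀ᶠ p in (U : Filter J), ¬ a p = 0 := by
      rw [Ultrafilter.eventually_not]
      exact fun bar => h ((h0 a).2 bar)
    refine inv_eq_of_mul_eq_one_right ?_
    rw [← map_mul, ← map_one φ, u_eq U φ h0]
    exact h'.mono fun p hp => by simp [hp]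
omit h0 in
lemma u_ev (z : σ → J → ℂ) (P : Zp σ) :
    ev (fun k => φ (z k)) P = φ (fun p => ev (fun k => z k p) P) := by
  rw [← mev]
  congr 1
  funext p
  exact mev (Pi.evalRingHom (fun _ => ℂ) p) z P
lemma u_crit [Finite σ] [Fintype ι] (f : ι → Zp σ) (s : ι → J → ℂ) (z : σ → J → ℂ) :
    (fun k => φ (z k)) ∈ Crit K f (fun i => φ (s i)) ↔
      ∀ᶠ p in (U : Filter J), (fun k => z k p) ∈ Crit ℂ f (fun i => s i p) := by
  simp only [Crit, mem_ofPred_eq, u_ev φ, u_inv U φ h0, ← map_mul, ← map_sum, ne_eq, h0, Filter.eventually_and,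
    Filter.eventually_all, Ultrafilter.eventually_not]
  simp
include hφ
lemma u_closed : IsAlgClosed K := by
  refine IsAlgClosed.of_exists_root _ fun P hP hirr => ?_
  have hd : P.natDegree ≠ 0 := (Polynomial.natDegree_pos_iff_degree_pos.2
    (Polynomial.degree_pos_of_irreducible hirr)).ne'
  choose c hc using fun n => hφ (P.coeff n)
  let Q : J → Polynomial ℂ := fun p => Polynomial.X ^ P.natDegree +
    ∑ i ∈ Finset.range P.natDegree, Polynomial.C (c i p) * Polynomial.X ^ i
  have hQ : ∀ p, ∃ x, (Q p).IsRoot x := by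
    intro p
    apply IsAlgClosed.exists_root
    have hlt : (∑ i ∈ Finset.range P.natDegree, Polynomial.C (c i p) * Polynomial.X ^ i).degree <
        (P.natDegree : WithBot ℕ) := by
      refine lt_of_le_of_lt (Polynomial.degree_sum_le _ _) ?_
      refine (Finset.sup_lt_iff (WithBot.bot_lt_coe _)).2 fun i hi => ?_
      refine lt_of_le_of_lt (Polynomial.degree_C_mul_X_pow_le _ _) ?_
      exact_mod_cast Finset.mem_range.1 hi
    rw [Polynomial.degree_add_eq_left_of_degree_lt (by rw [Polynomial.degree_X_pow]; exact hlt),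
      Polynomial.degree_X_pow]
    exact_mod_cast hd
  choose x hx using hQ
  refine ⟨φ x, ?_⟩
  rw [Polynomial.eval_eq_sum_range, Finset.sum_range_succ, Polynomial.Monic.coeff_natDegree hP, one_mul]
  simp only [← hc, ← map_pow, ← map_mul, ← map_sum, ← map_add]
  rw [h0]
  refine Filter.Eventually.of_forall fun p => ?_
  have := hx p
  simp only [Q, Polynomial.IsRoot, Polynomial.eval_add, Polynomial.eval_pow, Polynomial.eval_X,
    Polynomial.eval_finset_sum, Polynomial.eval_mul, Polynomial.eval_C] at this
  simp only [Pi.add_apply, Finset.sum_apply, Pi.mul_apply, Pi.pow_apply]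
  rw [add_comm]; exact this
omit h0 hφ in
lemma le_enc {α : Type} {A : Set α} {n : ℕ} : (n : ℕ∞) ≤ A.encard ↔
    ∃ g : Fin n → α, Inj g ∧ ∀ i, g i ∈ A := by
  constructor
  · intro h
    obtain ⟨t, ht, hc⟩ := exists_subset_encard_eq h
    have hf := finite_of_encard_eq_coe hc
    have hn : hf.toFinset.card = n := by
      rw [hf.encard_eq_coe_toFinset_card] at hc; exact_mod_cast hc
    let e := (hf.toFinset.equivFinOfCardEq hn).symm
    exact ⟨fun i => e i, Subtype.val_injective.comp e.injective, fun i => ht (hf.mem_toFinset.1 (e i).2)⟩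
  · rintro ⟨g, hg, hA⟩
    have : (range g).encard = n := by
      rw [← image_univ, hg.encard_image, encard_univ]; simp
    rw [← this]
    exact encard_le_encard (range_subset_iff.2 hA)
lemma u_le [Finite σ] [Fintype ι] (f : ι → Zp σ) (s : ι → J → ℂ) (n : ℕ) :
    (n : ℕ∞) ≤ (Crit K f (fun i => φ (s i))).encard ↔
      ∀ᶠ p in (U : Filter J), (n : ℕ∞) ≤ (Crit ℂ f (fun i => s i p)).encard := by
  simp only [le_enc]
  constructor
  · rintro ⟨g, hg, hA⟩
    choose w hw using fun i k => hφ (g i k)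
    have hg' : ∀ i, g i = fun k => φ (w i k) := fun i => funext fun k => (hw i k).symm
    have foo : ∀ i, ∀ᶠ p in (U : Filter J), (fun k => w i k p) ∈ Crit ℂ f (fun i => s i p) := by
      intro i
      rw [← u_crit U φ h0, ← hg']; exact hA i
    have bar : ∀ i j, ∀ᶠ p in (U : Filter J), i ≠ j → (fun k => w i k p) ≠ fun k => w j k p := by
      intro i j
      by_cases hij : i = j
      · exact Filter.Eventually.of_forall fun p h => absurd hij h
      have : ¬ ∀ᶠ p in (U : Filter J), ∀ k, w i k p = w j k p := by
        rw [Filter.eventually_all]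
        intro h
        refine hij (hg ?_)
        rw [hg', hg']
        funext k
        exact (u_eq U φ h0).2 (h k)
      rw [← Ultrafilter.eventually_not] at this
      exact this.mono fun p hp _ h => hp fun k => congrFun h k
    have h1' := Filter.eventually_all.2 foo
    have h2' := Filter.eventually_all.2 fun i => Filter.eventually_all.2 (bar i)
    filter_upwards [h1', h2'] with p a1 a2
    exact ⟨fun i k => w i k p, fun i j h => by_contra fun hij => a2 i j hij h, a1⟩
  · intro h
    classical
    let S : J → Prop := fun p => ∃ g : Fin n → σ → ℂ, Inj g ∧ ∀ i, g i ∈ Crit ℂ f (fun i => s i p)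
    have hS : ∀ p, ∃ g : Fin n → σ → ℂ, S p → Inj g ∧ ∀ i, g i ∈ Crit ℂ f (fun i => s i p) := by
      intro p
      by_cases hp : S p
      · obtain ⟨g, hg⟩ := hp
        exact ⟨g, fun _ => hg⟩
      · exact ⟨0, fun h => absurd h hp⟩
    choose G hG using hS
    refine ⟨fun i k => φ (fun p => G p i k), fun i j hij => ?_, fun i => ?_⟩
    · have foo : ∀ᶠ p in (U : Filter J), ∀ k, G p i k = G p j k := by
        rw [Filter.eventually_all]
        exact fun k => (u_eq U φ h0).1 (congrFun hij k)
      obtain ⟨p, a1, a2⟩ := (foo.and h).exists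
      exact (hG p a2).1 (funext a1)
    · refine (u_crit U φ h0 f s _).2 ?_
      exact h.mono fun p hp => (hG p hp).2 i
end ultra
theorem exists_g [Finite σ] [Fintype ι] {f : ι → Zp σ} {ξ : σ → ι} (hG : Good f ξ) {N : ℕ}
    (hN : NNf f = N) : ∃ g : Zp ι, g ≠ 0 ∧ ∀ s : ι → ℂ, ev s g ≠ 0 → (Crit ℂ f s).encard = N := by
  classical
  by_contra hcon
  push Not at hcon
  let J := {g : Zp ι // g ≠ 0}
  choose s hs1 hs2 using fun p : J => hcon p.1 p.2
  let F : Filter J := ⨅ g : J, Filter.principal {p | g.1 ∣ p.1}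
  haveI : Nonempty J := ⟨⟨1, one_ne_zero⟩⟩
  haveI : F.NeBot := by
    apply Filter.iInf_neBot_of_directed
    · intro a b
      refine ⟨⟨a.1 * b.1, mul_ne_zero a.2 b.2⟩, ?_, ?_⟩
      · exact Filter.principal_mono.2 fun p (hp : a.1 * b.1 ∣ p.1) => dvd_of_mul_right_dvd hp
      · exact Filter.principal_mono.2 fun p (hp : a.1 * b.1 ∣ p.1) => dvd_of_mul_left_dvd hp
    · intro a
      exact Filter.principal_neBot_iff.2 ⟨a, dvd_refl a.1⟩
  let U : Ultrafilter J := Ultrafilter.of F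
  have hU : ∀ g : J, ∀ᶠ p in (U : Filter J), g.1 ∣ p.1 := by
    intro g
    have : (U : Filter J) ≤ Filter.principal {p | g.1 ∣ p.1} := (Ultrafilter.of_le F).trans (iInf_le _ g)
    exact Filter.le_principal_iff.1 this
  obtain ⟨K, iK, φ, hφ, h0⟩ : ∃ (K : Type) (_ : Field K) (φ : (J → ℂ) →+* K), Sur φ ∧
      ∀ a, φ a = 0 ↔ ∀ᶠ p in (U : Filter J), a p = 0 := by
    refine ⟨Filter.Germ (U : Filter J) ℂ, inferInstance, Filter.Germ.coeRingHom _, ?_, ?_⟩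
    · intro x
      induction x using Filter.Germ.inductionOn with
      | _ a => exact ⟨a, rfl⟩
    · intro a
      exact Filter.Germ.coe_eq
  haveI : IsAlgClosed K := u_closed U φ hφ h0
  haveI : CharZero K := by
    refine charZero_of_injective_ringHom (f := φ.comp (Pi.constRingHom J ℂ)) ?_
    exact RingHom.injective _
  have hgen : Gen (fun i => φ (fun p => s p i)) := by
    refine (injective_iff_map_eq_zero _).2 fun P hP => ?_
    by_contra hne
    rw [u_ev φ, h0] at hP
    obtain ⟨p, foo, bar⟩ := (hP.and (hU ⟨P, hne⟩)).exists
    obtain ⟨r, hr⟩ := bar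
    apply hs1 p
    rw [hr, map_mul, foo, zero_mul]
  have hc := NNf_eq hG hgen
  rw [hN] at hc
  have l1 := (u_le U φ hφ h0 f (fun i p => s p i) N).1 hc.ge
  have l2 : ¬ ∀ᶠ p in (U : Filter J), ((N + 1 : ℕ) : ℕ∞) ≤ (Crit ℂ f (s p)).encard := by
    intro h
    have := (u_le U φ hφ h0 f (fun i p => s p i) (N + 1)).2 h
    rw [hc] at this
    have : N + 1 ≤ N := by exact_mod_cast this
    omega
  rw [← Ultrafilter.eventually_not] at l2
  obtain ⟨p, a1, a2⟩ := (l1.and l2).exists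
  refine hs2 p (le_antisymm ?_ a1)
  rw [not_le] at a2
  exact Order.le_of_lt_add_one (by exact_mod_cast a2)
theorem exists_gC [Finite σ] [Fintype ι] {f : ι → Zp σ} {ξ : σ → ι} (hG : Good f ξ) {N : ℕ}
    (hN : NNf f = N) : ∃ g : MvPolynomial ι ℂ, g ≠ 0 ∧ ∀ s : ι → ℂ, eval s g ≠ 0 →
      (Crit ℂ f s).Finite ∧ (Crit ℂ f s).ncard = N := by
  obtain ⟨g, hg, h⟩ := exists_g hG hN
  refine ⟨map (Int.castRingHom ℂ) g, ?_, fun s hs => ?_⟩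
  · intro h'
    exact hg (map_injective _ Int.cast_injective (by rw [h', map_zero]))
  · have := h s (by rw [eval_map] at hs; exact hs)
    exact ⟨finite_of_encard_eq_coe this, by rw [ncard, this]; rfl⟩
lemma fd_ev [Fintype τ] (P : Zp τ) (z : τ → ℂ) :
    HasFDerivAt (fun z : τ → ℂ => ev z P)
      (∑ k, ev z (pderiv k P) • (ContinuousLinearMap.proj k : (τ → ℂ) →L[ℂ] ℂ)) z := by
  classical
  induction P using MvPolynomial.induction_on with
  | C a =>
    have e : (fun z : τ → ℂ => ev z (C a)) = fun _ => (a : ℂ) := by funext z; simp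
    rw [e]
    refine (hasFDerivAt_const (𝕜 := ℂ) (a : ℂ) z).congr_fderiv ?_
    ext v
    simp
  | add p q hp hq =>
    have e : (fun z : τ → ℂ => ev z (p + q)) = fun z => ev z p + ev z q := by funext z; simp
    rw [e]
    refine (hp.fun_add hq).congr_fderiv ?_
    ext v
    simp [add_mul, sAd]
  | mul_X p k hp =>
    have foo : HasFDerivAt (fun z : τ → ℂ => z k) (ContinuousLinearMap.proj k : (τ → ℂ) →L[ℂ] ℂ) z :=
      (ContinuousLinearMap.proj k : (τ → ℂ) →L[ℂ] ℂ).hasFDerivAt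
    have bar := hp.mul foo
    simp only [map_mul, ev_X]
    refine bar.congr_fderiv ?_
    ext v
    simp only [Derivation.leibniz, pderiv_X, map_add, smul_eq_mul, map_mul, ev_X,
      ContinuousLinearMap.add_apply, ContinuousLinearMap.smul_apply, ContinuousLinearMap.sum_apply,
      ContinuousLinearMap.proj_apply, add_mul, sAd, mSm]
    congr 1
    · rw [Finset.sum_eq_single k]
      · simp
      · intro b _ hb
        simp [Pi.single_apply, hb.symm]
      · simp
    · refine sCg rfl fun j _ => ?_
      ring
section tower
variable [Fintype τ] {q : Pts τ} {m : ℕ} {B : List (Zp τ)} {c : τ → ℕ × Bool}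
def FF (q : Pts τ) (m : ℕ) (I : {I : ℕ × ℕ × ℕ // I ∈ cegmT m}) : Zp τ :=
  br q (I.1.1 - 1) (I.1.2.1 - 1) (I.1.2.2 - 1)
lemma mem_cegmT {a b c : ℕ} : (a, b, c) ∈ cegmT m ↔ 1 ≤ a ∧ a < b ∧ b < c ∧ c ≤ m ∧
    ¬ (a = 1 ∧ b = 2) ∧ ¬ (a = 1 ∧ b = 3 ∧ c = 4) ∧ ¬ (a = 2 ∧ b = 3 ∧ c = 4) := by
  simp only [cegmT, Finset.mem_filter, Finset.mem_product, Finset.mem_Icc, Prod.mk.injEq]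
  omega
variable (h : Twr q m B c)
include h
lemma q_one {j : ℕ} (bar : 2 ≤ j) (hj : j < m) : q j 0 = 1 := by
  by_cases baz : j = 2
  · subst baz; simp [h.std.q2]
  by_cases box : j = 3
  · subst box; simp [h.q3]
  obtain ⟨k, k', -, -, e⟩ := h.co j om hj
  simp [e]
lemma F_X : ∃ ξ, Good (FF q m) ξ := by
  have : ∀ k, ∃ I, FF q m I = X k := by
    intro k
    obtain ⟨foo, bar⟩ := h.cX k
    have baz := h.cX' k
    have hM := h.hM
    cases hb : (c k).2
    · refine ⟨⟨(1, 3, (c k).1 + 1), mem_cegmT.2 om⟩, ?_⟩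
      rw [baz, hb]
      simp [FF, br, dt, h.std.q0, h.std.q2]
    · refine ⟨⟨(2, 3, (c k).1 + 1), mem_cegmT.2 om⟩, ?_⟩
      rw [baz, hb]
      simp [FF, br, dt, h.std.q1, h.std.q2]
  choose ξ hξ using this
  exact ⟨ξ, fun a b hab => X_injective ((hξ a).symm.trans ((congrArg _ hab).trans (hξ b))), hξ⟩
lemma F_mono {x y z : ℕ} (hx : x < m) (hy : y < m) (hz : z < m) (foo : x ≠ y) (bar : x ≠ z) (baz : y ≠ z) :
    Mono (Pt (FF q m)) (FF q m) (fun w => ev w (br q x y z)) := by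
  have key : ∀ {x y z : ℕ}, x < y → y < z → z < m →
      Mono (Pt (FF q m)) (FF q m) (fun w => ev w (br q x y z)) := by
    intro x y z a1 a2 a3
    by_cases hI : (x + 1, y + 1, z + 1) ∈ cegmT m
    · exact Mono.fn (f := FF q m) ⟨_, hI⟩ fun z hz => hz _
    · have : br q x y z = 1 := by
        rw [mem_cegmT] at hI
        have hc : (x = 0 ∧ y = 1) ∨ (x = 0 ∧ y = 2 ∧ z = 3) ∨ (x = 1 ∧ y = 2 ∧ z = 3) := by omega
        rcases hc with ⟨rfl, rfl⟩ | ⟨rfl, rfl, rfl⟩ | ⟨rfl, rfl, rfl⟩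
        · simp [br, dt, h.std.q0, h.std.q1, q_one h a2 a3]
        · simp [br, dt, h.std.q0, h.std.q2, h.q3]
        · simp [br, dt, h.std.q1, h.std.q2, h.q3]
      rw [this]
      exact Mono.one.congr fun z _ => by simp
  have n1 : ∀ {x y z : ℕ}, Mono (Pt (FF q m)) (FF q m) (fun w => ev w (br q x y z)) →
      Mono (Pt (FF q m)) (FF q m) (fun w => ev w (br q y x z)) := fun hh =>
    hh.neg.congr fun w _ => by rw [br_swap1, map_neg]
  have n2 : ∀ {x y z : ℕ}, Mono (Pt (FF q m)) (FF q m) (fun w => ev w (br q x y z)) →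
      Mono (Pt (FF q m)) (FF q m) (fun w => ev w (br q x z y)) := fun hh =>
    hh.neg.congr fun w _ => by rw [br_swap2, map_neg]
  rcases lt_or_gt_of_ne foo with a | a <;> rcases lt_or_gt_of_ne bar with b | b <;>
    rcases lt_or_gt_of_ne baz with d | d
  · exact key a d hz
  · exact n2 (key b d hy)
  · omega
  · exact n2 (n1 (key b a hy))
  · exact n1 (key a b hz)
  · omega
  · exact n1 (n2 (key d b hx))
  · exact n1 (n2 (n1 (key d a hx)))
lemma NNf_F : NNf (FF q m) = NN B := by
  obtain ⟨ξ, hξ⟩ := F_X h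
  obtain ⟨ξ', hξ'⟩ := h.hB.good
  have m1 : ∀ i, Un B (FF q m i) := by
    rintro ⟨⟨x, y, z⟩, hI⟩
    have := mem_cegmT.1 hI
    show Un B (br q (x - 1) (y - 1) (z - 1))
    exact h.hU _ _ _ om om om om om om
  have m2 : ∀ p ∈ B, Mono (Pt (FF q m)) (FF q m) (fun w => ev w p) := by
    intro p hp
    obtain ⟨x, y, z, a1, a2, a3, a4, a5, a6, rfl⟩ := h.mem p hp
    exact F_mono h a1 a2 a3 a4 a5 a6
  refine NNf_iso hξ hξ' (Θ := id) (Θ' := id) ?_ ?_ ?_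
  · rw [pli]
    exact ⟨fun z hz p hp => (m2 p hp).ne hz, fun z hz p => (m1 p).ne hz, fun _ _ => rfl, fun _ _ => rfl,
      fun z z' _ _ h => h, fun z z' _ _ h => h⟩
  · rw [pli]; exact m1
  · exact fun i => m2 _ (gM _ _)
lemma c_inj : Inj c := fun a b hab => X_injective (R := ℤ) (by rw [h.cX' a, h.cX' b, hab])
lemma exκ : ∃ κ : Fin (m - 4) × Bool → τ, ∀ i b, c (κ (i, b)) = ((i : ℕ) + 4, b) := by
  have : ∀ x : Fin (m - 4) × Bool, ∃ k, c k = ((x.1 : ℕ) + 4, x.2) := by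
    rintro ⟨i, b⟩
    obtain ⟨k, k', e1, e2, -⟩ := h.co ((i : ℕ) + 4) om om
    cases b
    · exact ⟨k, e1⟩
    · exact ⟨k', e2⟩
  choose κ hκ using this
  exact ⟨κ, fun i b => hκ (i, b)⟩
lemma exL : ∃ L : ((Fin (m - 4) → ℂ) × (Fin (m - 4) → ℂ)) ≃L[ℂ] (τ → ℂ), ∃ κ : Fin (m - 4) × Bool → τ,
    Sur κ ∧
    (∀ i b, c (κ (i, b)) = ((i : ℕ) + 4, b)) ∧ (∀ z i, L z (κ (i, false)) = z.1 i) ∧ (∀ z i, L z (κ (i, true)) = z.2 i) := by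
  obtain ⟨κ, hκ⟩ := exκ h
  have inj : Inj κ := by
    rintro ⟨i, b⟩ ⟨j, b'⟩ hh
    have := congrArg c hh
    rw [hκ, hκ] at this
    simp only [Prod.mk.injEq] at this ⊢
    exact ⟨Fin.ext om, this.2⟩
  have sur : Sur κ := by
    intro k
    obtain ⟨foo, bar⟩ := h.cX k
    refine ⟨(⟨(c k).1 - 4, by omega⟩, (c k).2), c_inj h ?_⟩
    rw [hκ]
    exact Prod.ext (by simp only; omega) rfl
  let eκ := Equiv.ofBijective κ ⟨inj, sur⟩
  have he : ∀ x, eκ.symm (κ x) = x := fun x => eκ.symm_apply_apply x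
  let L0 : ((Fin (m - 4) → ℂ) × (Fin (m - 4) → ℂ)) ≃ₗ[ℂ] (τ → ℂ) :=
    { toFun := fun z k => if (eκ.symm k).2 then z.2 (eκ.symm k).1 else z.1 (eκ.symm k).1
      invFun := fun w => (fun i => w (κ (i, false)), fun i => w (κ (i, true)))
      map_add' := by intro z w; funext k; simp only [Pi.add_apply, Prod.fst_add, Prod.snd_add]; split_ifs <;> rfl
      map_smul' := by intro a w; funext k; simp only [Pi.smul_apply, Prod.smul_fst, Prod.smul_snd]; split_ifs <;> rfl
      left_inv := by
        intro z
        simp [he]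
      right_inv := by
        intro w
        funext k
        obtain ⟨⟨i, b⟩, rfl⟩ := sur k
        cases b <;> simp [he] }
  refine ⟨L0.toContinuousLinearEquiv, κ, sur, hκ, fun z i => ?_, fun z i => ?_⟩
  · change (if (eκ.symm (κ (i, false))).2 then _ else _) = _
    simp [he]
  · change (if (eκ.symm (κ (i, true))).2 then _ else _) = _
    simp [he]
variable {L : ((Fin (m - 4) → ℂ) × (Fin (m - 4) → ℂ)) ≃L[ℂ] (τ → ℂ)} {κ : Fin (m - 4) × Bool → τ}
  (sur : Sur κ)
  (hκ : ∀ i b, c (κ (i, b)) = ((i : ℕ) + 4, b)) (hL : ∀ z i, L z (κ (i, false)) = z.1 i)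
  (hL' : ∀ z i, L z (κ (i, true)) = z.2 i)
include hκ hL hL'
lemma col_eq (z) {j : ℕ} (foo : 1 ≤ j) (bar : j ≤ m) (r : Fin 3) : cegmCol m z j r = ev (L z) (q (j - 1) r) := by
  by_cases j1 : j = 1
  · subst j1
    rw [h.std.q0]; fin_cases r <;> simp [cegmCol]
  by_cases j2 : j = 2
  · subst j2
    rw [h.std.q1]; fin_cases r <;> simp [cegmCol]
  by_cases j3 : j = 3
  · subst j3
    rw [h.std.q2]; fin_cases r <;> simp [cegmCol]
  by_cases j4 : j = 4
  · subst j4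
    rw [h.q3]; fin_cases r <;> simp [cegmCol]
  obtain ⟨k, k', e1, e2, e⟩ := h.co (j - 1) om om
  have hj : j - 5 < m - 4 := by omega
  have k1 : k = κ (⟨j - 5, hj⟩, false) := c_inj h (by rw [hκ, e1]; exact Prod.ext (by simp only; omega) rfl)
  have k2 : k' = κ (⟨j - 5, hj⟩, true) := c_inj h (by rw [hκ, e2]; exact Prod.ext (by simp only; omega) rfl)
  simp only [cegmCol, if_neg j1, if_neg j2, if_neg j3, if_neg j4, e, dif_pos hj]
  fin_cases r
  · simp
  · simp [k1, hL]
  · simp [k2, hL']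
lemma P_eq (I : {I : ℕ × ℕ × ℕ // I ∈ cegmT m}) : cegmP m I.1 = fun z => ev (L z) (FF q m I) := by
  funext z
  obtain ⟨⟨x, y, w⟩, hI⟩ := I
  have hh := mem_cegmT.1 hI
  simp only [cegmP, FF, br, dt, Matrix.det_fin_three, Matrix.of_apply, map_add, map_sub, map_mul,
    cv0, cv1, cv]
  have e := fun j foo bar r => col_eq h hκ hL hL' z (j := j) foo bar r
  rw [← e x om om, ← e x om om, ← e x om om,
    ← e y om om, ← e y om om, ← e y om om,
    ← e w om om, ← e w om om, ← e w om om]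
  ring
lemma fd_eq (I : {I : ℕ × ℕ × ℕ // I ∈ cegmT m}) (z v) : fderiv ℂ (cegmP m I.1) z v =
    ∑ k, ev (L z) (pderiv k (FF q m I)) * L v k := by
  rw [P_eq h hκ hL hL' I]
  have foo := (fd_ev (FF q m I) (L z)).comp z L.hasFDerivAt
  have bar := foo.fderiv
  simp only [Function.comp_def] at bar
  rw [bar]
  simp
include sur
lemma sol_eq (s : {I : ℕ × ℕ × ℕ // I ∈ cegmT m} → ℂ) : L '' cegmSol m s = Crit ℂ (FF q m) s := by
  classical
  have inj : Inj κ := by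
    rintro ⟨i, b⟩ ⟨j, b'⟩ hh
    have := congrArg c hh
    rw [hκ, hκ] at this
    simp only [Prod.mk.injEq] at this ⊢
    exact ⟨Fin.ext om, this.2⟩
  have s1 : ∀ i, L (Pi.single i 1, 0) = Pi.single (κ (i, false)) 1 := by
    intro i
    funext k
    obtain ⟨⟨j, b⟩, rfl⟩ := sur k
    cases b
    · rw [hL]; simp [Pi.single_apply, inj.eq_iff]
    · rw [hL']; simp [Pi.single_apply, inj.eq_iff]
  have s2 : ∀ i, L (0, Pi.single i 1) = Pi.single (κ (i, true)) 1 := by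
    intro i
    funext k
    obtain ⟨⟨j, b⟩, rfl⟩ := sur k
    cases b
    · rw [hL]; simp [Pi.single_apply, inj.eq_iff]
    · rw [hL']; simp [Pi.single_apply, inj.eq_iff]
  have key : ∀ z, z ∈ cegmSol m s ↔ L z ∈ Crit ℂ (FF q m) s := by
    intro z
    have pe := fun I => congrFun (P_eq h hκ hL hL' I) z
    have t1 : ∀ i, (∑ I ∈ (cegmT m).attach,
        s I * fderiv ℂ (cegmP m I.val) z (Pi.single i 1, 0) / cegmP m I.val z) =
        ∑ I, s I * ((ev (L z) (FF q m I))⁻¹ * ev (L z) (pderiv (κ (i, false)) (FF q m I))) := by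
      intro i
      refine sCg rfl fun I _ => ?_
      rw [fd_eq h hκ hL hL', s1, pe]
      simp only [Pi.single_apply, mul_ite, mul_one, mul_zero, Finset.sum_ite_eq', mU, if_true]
      ring
    have t2 : ∀ i, (∑ I ∈ (cegmT m).attach,
        s I * fderiv ℂ (cegmP m I.val) z (0, Pi.single i 1) / cegmP m I.val z) =
        ∑ I, s I * ((ev (L z) (FF q m I))⁻¹ * ev (L z) (pderiv (κ (i, true)) (FF q m I))) := by
      intro i
      refine sCg rfl fun I _ => ?_
      rw [fd_eq h hκ hL hL', s2, pe]
      simp only [Pi.single_apply, mul_ite, mul_one, mul_zero, Finset.sum_ite_eq', mU, if_true]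
      ring
    simp only [cegmSol, Crit, mem_ofPred_eq, t1, t2]
    constructor
    · rintro ⟨a1, a2, a3⟩
      refine ⟨fun I => by rw [← pe]; exact a1 _ I.2, fun k => ?_⟩
      obtain ⟨⟨j, b⟩, rfl⟩ := sur k
      cases b
      · exact a2 j
      · exact a3 j
    · rintro ⟨a1, a2⟩
      exact ⟨fun I hI => by rw [pe ⟨I, hI⟩]; exact a1 _, fun k => a2 _, fun k => a2 _⟩
  ext w
  constructor
  · rintro ⟨z, hz, rfl⟩
    exact (key z).1 hz
  · intro hw
    refine ⟨L.symm w, (key _).2 ?_, L.apply_symm_apply w⟩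
    rwa [L.apply_symm_apply]
omit sur hκ hL hL'
theorem final {N : ℕ} (hN : NN B = N) : ∃ g : MvPolynomial {I : ℕ × ℕ × ℕ // I ∈ cegmT m} ℂ, g ≠ 0 ∧
      ∀ s : {I : ℕ × ℕ × ℕ // I ∈ cegmT m} → ℂ, MvPolynomial.eval s g ≠ 0 →
        (cegmSol m s).Finite ∧ (cegmSol m s).ncard = N := by
  obtain ⟨L, κ, sur, hκ, hL, hL'⟩ := exL h
  obtain ⟨ξ, hξ⟩ := F_X h
  obtain ⟨g, hg, hh⟩ := exists_gC hξ ((NNf_F h).trans hN)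
  refine ⟨g, hg, fun s hs => ?_⟩
  obtain ⟨foo, bar⟩ := hh s hs
  rw [← sol_eq h sur hκ hL hL'] at foo bar
  exact ⟨foo.of_finite_image L.injective.injOn, by rwa [ncard_image_of_injective _ L.injective] at bar⟩
end tower
end ML

/-- For `m ∈ {6,7,8}` and generic Mandelstam invariants `s`, the number of
solutions of the CEGM scattering equations equals `26`, `1272`, `188112`
respectively. -/
theorem stmt8 (m : ℕ) (hm : m = 6 ∨ m = 7 ∨ m = 8) :
    ∃ g : MvPolynomial {I : ℕ × ℕ × ℕ // I ∈ cegmT m} ℂ, g ≠ 0 ∧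
      ∀ s : {I : ℕ × ℕ × ℕ // I ∈ cegmT m} → ℂ, MvPolynomial.eval s g ≠ 0 →
        (cegmSol m s).Finite ∧
        (cegmSol m s).ncard =
          (if m = 6 then 26 else if m = 7 then 1272 else 188112) := by
  rcases hm with rfl | rfl | rfl
  · exact ML.final ML.tw6 ML.NN_X6
  · exact ML.final ML.tw7 ML.NN_X7
  · exact ML.final ML.tw8 ML.NN_X8

end
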